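/- There exists a continuous strictly decreasing function Ψ : [0, π/2] → ℝ with Ψ(0) = π²/2 and Ψ(π/2) = 0 such that: (i) whenever 𝐟 : ℝ² → ℝ is a C² function on the open unit disk D = {(u,v) : u² + v² < 1} satisfying the minimal surface equation on D, the origin is an h-symmetric point of 𝐟 for some unit vector h, and θ ∈ [0, π/2) is defined by cos θ = 1/√(1 + (∂_u𝐟(0,0))² + (∂_v𝐟(0,0))²) (the angle the tangent plane at the point above the origin makes with the horizontal plane), then the Gaussian curvature K of the graph of 𝐟 at the point above the origin satisfies |K| < Ψ(θ); and (ii) for every θ ∈ [0, π/2) and every φ with 0 ≤ φ < Ψ(θ) there exists such a function 𝐟 with an h-symmetric point at the origin, cos θ = 1/√(1 + (∂_u𝐟(0,0))² + (∂_v𝐟(0,0))²), and |K| = φ. -/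

import Mathlib

open Real Set

/-- Partial derivative in the `u` (first coordinate) direction. -/
noncomputable def pdu (f : ℝ × ℝ → ℝ) (p : ℝ × ℝ) : ℝ := lineDeriv ℝ f p (1, 0)

/-- Partial derivative in the `v` (second coordinate) direction. -/
noncomputable def pdv (f : ℝ × ℝ → ℝ) (p : ℝ × ℝ) : ℝ := lineDeriv ℝ f p (0, 1)

/-- The open unit disk in `ℝ²`. -/
def unitDisk : Set (ℝ × ℝ) := {p | p.1 ^ 2 + p.2 ^ 2 < 1}

/-- The Gaussian curvature of the graph of `f` at the point above `p`. -/
noncomputable def gaussCurv (f : ℝ × ℝ → ℝ) (p : ℝ × ℝ) : ℝ :=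
  (pdu (pdu f) p * pdv (pdv f) p - (pdv (pdu f) p) ^ 2) /
    (1 + (pdu f p) ^ 2 + (pdv f p) ^ 2) ^ 2

/-- `f` satisfies the minimal surface equation on `D`. -/
def MinimalSurfaceEq (f : ℝ × ℝ → ℝ) (D : Set (ℝ × ℝ)) : Prop :=
  ∀ p ∈ D, (1 + (pdv f p) ^ 2) * pdu (pdu f) p
      - 2 * pdu f p * pdv f p * pdv (pdu f) p
      + (1 + (pdu f p) ^ 2) * pdv (pdv f) p = 0

/-- `ζ` is an `h`-symmetric point of `f`: `h` is a unit vector,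
`∇ₕ f(ζ) = 0` and `∇²_{h, ih} f(ζ) = 0` where `ih = (-h₂, h₁)`. -/
def IsSymmetricPt (f : ℝ × ℝ → ℝ) (ζ : ℝ × ℝ) (h : ℝ × ℝ) : Prop :=
  h.1 ^ 2 + h.2 ^ 2 = 1 ∧ lineDeriv ℝ f ζ h = 0 ∧
    lineDeriv ℝ (fun p => lineDeriv ℝ f p h) ζ (-h.2, h.1) = 0

open scoped Topology ComplexConjugate
open Filter

/-- The angle `κ(s)` attached to the Scherk trapezoid of parameter `s`. -/
noncomputable def scherkAngle (s : ℝ) : ℝ := π * s / (2 * (1 - s ^ 2))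

/-- The parameter `s_g = (√5 - 1) / 2`, where the trapezoid degenerates. -/
noncomputable def goldenParam : ℝ := (√5 - 1) / 2

/-- The sine of the tangent angle of the extremal surface of parameter `s`. -/
noncomputable def scherkSlope (s : ℝ) : ℝ :=
  (s + sin (scherkAngle s)) / (1 + s * sin (scherkAngle s))

/-- The curvature of the extremal surface of parameter `s`. -/
noncomputable def scherkCurv (s : ℝ) : ℝ :=
  π ^ 2 / 4 * (2 - s ^ 2) * cos (scherkAngle s) ^ 2 / (1 + s * sin (scherkAngle s)) ^ 4

lemma goldenParam_sq : goldenParam ^ 2 = 1 - goldenParam := by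
  have h := Real.sq_sqrt (show (0:ℝ) ≤ 5 by norm_num)
  unfold goldenParam
  nlinarith

lemma goldenParam_pos : 0 < goldenParam := by
  have h : (1:ℝ) < √5 := by
    rw [Real.lt_sqrt] <;> norm_num
  unfold goldenParam
  linarith

lemma goldenParam_lt_one : goldenParam < 1 := by
  nlinarith [goldenParam_sq, goldenParam_pos]

lemma lt_one_sub_sq_of_lt_goldenParam {s : ℝ} (h0 : 0 ≤ s) (h : s < goldenParam) :
    s < 1 - s ^ 2 := by
  nlinarith [goldenParam_sq, goldenParam_pos]

lemma one_sub_sq_pos_of_mem {s : ℝ} (h : s ∈ Icc 0 goldenParam) : 0 < 1 - s ^ 2 := by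
  nlinarith [goldenParam_lt_one, h.1, h.2]

lemma scherkAngle_strictMonoOn : StrictMonoOn scherkAngle (Icc 0 goldenParam) := by
  intro a ha b hb hab
  have h1 := one_sub_sq_pos_of_mem ha
  have h2 := one_sub_sq_pos_of_mem hb
  unfold scherkAngle
  rw [div_lt_div_iff₀ (by linarith) (by linarith)]
  have : a * (1 - b ^ 2) < b * (1 - a ^ 2) := by nlinarith [ha.1, hb.1, mul_nonneg ha.1 hb.1]
  nlinarith [Real.pi_pos]

lemma scherkAngle_zero : scherkAngle 0 = 0 := by simp [scherkAngle]

lemma scherkAngle_goldenParam : scherkAngle goldenParam = π / 2 := by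
  unfold scherkAngle
  rw [goldenParam_sq]
  have := goldenParam_pos
  rw [show 2 * (1 - (1 - goldenParam)) = goldenParam * 2 by ring]
  field_simp

lemma scherkAngle_mem {s : ℝ} (h : s ∈ Icc 0 goldenParam) : scherkAngle s ∈ Icc 0 (π / 2) := by
  have hg := goldenParam_pos.le
  constructor
  · rw [← scherkAngle_zero]
    exact scherkAngle_strictMonoOn.monotoneOn ⟨le_rfl, hg⟩ h h.1
  · rw [← scherkAngle_goldenParam]
    exact scherkAngle_strictMonoOn.monotoneOn h ⟨hg, le_rfl⟩ h.2

lemma continuousOn_scherkAngle : ContinuousOn scherkAngle (Icc 0 goldenParam) := by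
  unfold scherkAngle
  refine ContinuousOn.div (by fun_prop) (by fun_prop) fun s hs => ?_
  have := one_sub_sq_pos_of_mem hs
  positivity

lemma sin_scherkAngle_nonneg {s : ℝ} (h : s ∈ Icc 0 goldenParam) : 0 ≤ sin (scherkAngle s) :=
  sin_nonneg_of_nonneg_of_le_pi (scherkAngle_mem h).1
    (by linarith [(scherkAngle_mem h).2, Real.pi_pos])

lemma sin_scherkAngle_strictMonoOn :
    StrictMonoOn (fun s => sin (scherkAngle s)) (Icc 0 goldenParam) := by
  intro a ha b hb hab
  have h1 := scherkAngle_mem ha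
  have h2 := scherkAngle_mem hb
  exact strictMonoOn_sin ⟨by linarith [h1.1, Real.pi_pos], h1.2⟩
    ⟨by linarith [h2.1, Real.pi_pos], h2.2⟩ (scherkAngle_strictMonoOn ha hb hab)

lemma scherkSlope_strictMonoOn : StrictMonoOn scherkSlope (Icc 0 goldenParam) := by
  intro a ha b hb hab
  have h := sin_scherkAngle_strictMonoOn ha hb hab
  have h1 := sin_scherkAngle_nonneg ha
  have h2 := sin_scherkAngle_nonneg hb
  have h3 := sin_le_one (scherkAngle b)
  have hb1 : b < 1 := hb.2.trans_lt goldenParam_lt_one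
  have ha0 := ha.1
  unfold scherkSlope
  simp only at h
  generalize sin (scherkAngle a) = x at *
  generalize sin (scherkAngle b) = y at *
  rw [div_lt_div_iff₀ (by positivity) (by nlinarith [hb.1, mul_nonneg hb.1 h2])]
  have e1 : x * y < 1 := by nlinarith
  have e2 : a * b < 1 := by nlinarith
  nlinarith [mul_pos (sub_pos.2 hab) (sub_pos.2 e1), mul_pos (sub_pos.2 h) (sub_pos.2 e2)]

lemma one_add_mul_sin_scherkAngle_pos {s : ℝ} (h : s ∈ Icc 0 goldenParam) :
    0 < 1 + s * sin (scherkAngle s) := by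
  have := mul_nonneg h.1 (sin_scherkAngle_nonneg h)
  linarith

lemma continuousOn_scherkSlope : ContinuousOn scherkSlope (Icc 0 goldenParam) := by
  have h := continuousOn_scherkAngle
  unfold scherkSlope
  refine ContinuousOn.div ?_ ?_ fun s hs => (one_add_mul_sin_scherkAngle_pos hs).ne'
  all_goals fun_prop

lemma continuousOn_scherkCurv : ContinuousOn scherkCurv (Icc 0 goldenParam) := by
  have h := continuousOn_scherkAngle
  unfold scherkCurv
  refine ContinuousOn.div ?_ ?_ fun s hs =>
    (pow_pos (one_add_mul_sin_scherkAngle_pos hs) 4).ne'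
  all_goals fun_prop

lemma scherkCurv_strictAntiOn : StrictAntiOn scherkCurv (Icc 0 goldenParam) := by
  intro a ha b hb hab
  have h := sin_scherkAngle_strictMonoOn ha hb hab
  have h1 := sin_scherkAngle_nonneg ha
  have h3 := sin_le_one (scherkAngle b)
  have hb1 : b < 1 := hb.2.trans_lt goldenParam_lt_one
  have ha0 := ha.1
  unfold scherkCurv
  simp only at h
  rw [cos_sq', cos_sq']
  generalize sin (scherkAngle a) = x at *
  generalize sin (scherkAngle b) = y at *
  have hx : 0 < 1 - x ^ 2 := by nlinarith
  have hy : 0 ≤ 1 - y ^ 2 := by nlinarith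
  have hlt : π ^ 2 / 4 * (2 - b ^ 2) * (1 - y ^ 2) < π ^ 2 / 4 * (2 - a ^ 2) * (1 - x ^ 2) := by
    have e : (2 - b ^ 2) * (1 - y ^ 2) < (2 - a ^ 2) * (1 - x ^ 2) := by
      apply mul_lt_mul'' <;> nlinarith
    have := mul_lt_mul_of_pos_left e (show 0 < π ^ 2 / 4 by positivity)
    linarith
  have hden : (1 + a * x) ^ 4 ≤ (1 + b * y) ^ 4 := by
    have : 0 ≤ a * x := mul_nonneg ha0 h1
    have hb0 := hb.1
    gcongr
  have hpos : 0 < (1 + a * x) ^ 4 := by positivity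
  calc _ ≤ π ^ 2 / 4 * (2 - b ^ 2) * (1 - y ^ 2) / (1 + a * x) ^ 4 := by
        apply div_le_div_of_nonneg_left _ hpos hden
        have : 0 ≤ 2 - b ^ 2 := by nlinarith
        positivity
    _ < _ := by gcongr

lemma scherkSlope_zero : scherkSlope 0 = 0 := by simp [scherkSlope, scherkAngle_zero]

lemma scherkSlope_goldenParam : scherkSlope goldenParam = 1 := by
  have := goldenParam_pos
  rw [scherkSlope, scherkAngle_goldenParam, sin_pi_div_two, mul_one, add_comm, div_self]
  positivity

lemma image_scherkSlope : scherkSlope '' Icc 0 goldenParam = Icc 0 1 := by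
  have hg := goldenParam_pos.le
  apply Subset.antisymm
  · rintro _ ⟨s, hs, rfl⟩
    rw [← scherkSlope_zero, ← scherkSlope_goldenParam]
    exact ⟨scherkSlope_strictMonoOn.monotoneOn ⟨le_rfl, hg⟩ hs hs.1,
      scherkSlope_strictMonoOn.monotoneOn hs ⟨hg, le_rfl⟩ hs.2⟩
  · have := intermediate_value_Icc hg continuousOn_scherkSlope
    rwa [scherkSlope_zero, scherkSlope_goldenParam] at this

/-- A continuous strictly monotone bijection of compact intervals has a continuous strictly
monotone inverse. -/
lemma exists_inverse_scherkSlope : ∃ g : ℝ → ℝ, ContinuousOn g (Icc 0 1) ∧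
    StrictMonoOn g (Icc 0 1) ∧ ∀ y ∈ Icc (0:ℝ) 1, g y ∈ Icc 0 goldenParam ∧
      scherkSlope (g y) = y := by
  have hs : SurjOn scherkSlope (Icc 0 goldenParam) (Icc 0 1) := image_scherkSlope.ge
  choose! g hg hg' using hs
  have hmono : StrictMonoOn g (Icc 0 1) := by
    intro a ha b hb hab
    by_contra hcon
    have := scherkSlope_strictMonoOn.monotoneOn (hg hb) (hg ha) (not_lt.1 hcon)
    rw [hg' ha, hg' hb] at this
    exact absurd hab (not_lt.2 this)
  refine ⟨g, ?_, hmono, fun y hy => ⟨hg hy, hg' hy⟩⟩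
  have himg : g '' Icc 0 1 = Icc 0 goldenParam := by
    apply Subset.antisymm
    · rintro _ ⟨y, hy, rfl⟩
      exact hg hy
    · intro s hs
      have hy : scherkSlope s ∈ Icc (0:ℝ) 1 := image_scherkSlope ▸ mem_image_of_mem _ hs
      exact ⟨_, hy, scherkSlope_strictMonoOn.injOn (hg hy) hs (hg' hy)⟩
  rw [continuousOn_iff_continuous_domRestrict]
  have : OrdConnected (g '' Icc 0 1) := by rw [himg]; exact ordConnected_Icc
  exact continuous_subtype_val.comp (hmono.orderIso g (Icc 0 1)).continuous

/-- The function `Ψ`, together with its parametrization by the Scherk parameter. -/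
theorem exists_scherk_Psi : ∃ Ψ : ℝ → ℝ, ContinuousOn Ψ (Icc 0 (π / 2)) ∧
    StrictAntiOn Ψ (Icc 0 (π / 2)) ∧ Ψ 0 = π ^ 2 / 2 ∧ Ψ (π / 2) = 0 ∧
    ∀ θ ∈ Ico 0 (π / 2), ∃ s, 0 ≤ s ∧ s < 1 - s ^ 2 ∧ sin θ = scherkSlope s ∧
      Ψ θ = scherkCurv s := by
  obtain ⟨g, hc, hm, hg⟩ := exists_inverse_scherkSlope
  have hgold := goldenParam_pos.le
  have hmaps : MapsTo sin (Icc 0 (π / 2)) (Icc 0 1) := fun θ hθ =>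
    ⟨sin_nonneg_of_nonneg_of_le_pi hθ.1 (by linarith [hθ.2, Real.pi_pos]), sin_le_one θ⟩
  have hg0 : g 0 = 0 := scherkSlope_strictMonoOn.injOn (hg 0 (by simp)).1 ⟨le_rfl, hgold⟩
    (by rw [(hg 0 (by simp)).2, scherkSlope_zero])
  have hg1 : g 1 = goldenParam := scherkSlope_strictMonoOn.injOn (hg 1 (by simp)).1 ⟨hgold, le_rfl⟩
    (by rw [(hg 1 (by simp)).2, scherkSlope_goldenParam])
  have hsin : StrictMonoOn sin (Icc 0 (π / 2)) := strictMonoOn_sin.mono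
    (Icc_subset_Icc_left (by linarith [Real.pi_pos]))
  refine ⟨fun θ => scherkCurv (g (sin θ)), ?_, ?_, ?_, ?_, ?_⟩
  · exact continuousOn_scherkCurv.comp (hc.comp continuous_sin.continuousOn hmaps)
      fun θ hθ => (hg _ (hmaps hθ)).1
  · intro a ha b hb hab
    exact scherkCurv_strictAntiOn (hg _ (hmaps ha)).1 (hg _ (hmaps hb)).1
      (hm (hmaps ha) (hmaps hb) (hsin ha hb hab))
  · simp [hg0, scherkCurv, scherkAngle_zero]
    ring
  · simp [hg1, scherkCurv, scherkAngle_goldenParam]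
  · intro θ hθ
    have hθ' : θ ∈ Icc 0 (π / 2) := ⟨hθ.1, hθ.2.le⟩
    obtain ⟨h1, h2⟩ := hg _ (hmaps hθ')
    refine ⟨g (sin θ), h1.1, ?_, h2.symm, rfl⟩
    apply lt_one_sub_sq_of_lt_goldenParam h1.1
    rw [← hg1]
    refine hm (hmaps hθ') (by simp) ?_
    rw [← sin_pi_div_two]
    exact hsin hθ' ⟨by positivity, le_rfl⟩ hθ.2

/-- A parametrized form of the surjective implicit function theorem. -/
lemma eventually_exists_eq_zero_of_surjective {F : ℂ × ℝ → ℂ} {F' : ℂ × ℝ →L[ℝ] ℂ} {x₀ : ℂ}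
    (hF : HasStrictFDerivAt F F' (x₀, 0)) (h0 : F (x₀, 0) = 0)
    (hsurj : ∀ y, ∃ v, F' (v, 0) = y) {U : Set ℂ} (hU : U ∈ 𝓝 x₀) :
    ∀ᶠ s in 𝓝 (0:ℝ), ∃ x ∈ U, F (x, s) = 0 := by
  have hG : HasStrictFDerivAt (fun p : ℂ × ℝ => (F p, p.2))
      (F'.prod (ContinuousLinearMap.snd ℝ ℂ ℝ)) (x₀, 0) := hF.prodMk hasStrictFDerivAt_snd
  have hmap := hG.map_nhds_eq_of_surj (by
    rw [LinearMap.range_eq_top]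
    rintro ⟨y, t⟩
    obtain ⟨v, hv⟩ := hsurj (y - F' (0, t))
    refine ⟨(v, t), ?_⟩
    have : F' (v, t) = F' (v, 0) + F' (0, t) := by
      rw [← map_add]; simp
    simp [this, hv])
  have hmem : (fun p : ℂ × ℝ => (F p, p.2)) '' (U ×ˢ univ) ∈ 𝓝 ((0:ℂ), (0:ℝ)) := by
    rw [← h0, ← hmap]
    exact image_mem_map (prod_mem_nhds hU univ_mem)
  have hcont : Tendsto (fun s : ℝ => ((0:ℂ), s)) (𝓝 0) (𝓝 (0, 0)) :=
    (Continuous.prodMk_right (0:ℂ)).tendsto 0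
  filter_upwards [hcont hmem] with s hs
  obtain ⟨⟨x, t⟩, hx, hxt⟩ := hs
  simp only [Prod.mk.injEq] at hxt
  obtain ⟨h1, rfl⟩ := hxt
  exact ⟨x, hx.1, h1⟩

/-- For `‖μ‖ < 1` the real-linear map `x ↦ x - conj (μ x)` is onto. -/
lemma exists_sub_conj_mul_eq {μ : ℂ} (hμ : ‖μ‖ < 1) (y : ℂ) : ∃ x, x - conj (μ * x) = y := by
  have h : (1 - (μ * conj μ : ℂ)) ≠ 0 := by
    rw [Complex.mul_conj, Complex.normSq_eq_norm_sq]
    norm_cast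
    nlinarith [norm_nonneg μ]
  have h' : (1 - (conj μ * μ : ℂ)) ≠ 0 := by rwa [mul_comm]
  refine ⟨(y + conj (μ * y)) / (1 - μ * conj μ), ?_⟩
  simp only [map_mul, map_div₀, map_add, map_sub, map_one, Complex.conj_conj]
  field_simp
  ring

lemma eq_zero_of_sub_conj_mul_eq_zero {μ x : ℂ} (hμ : ‖μ‖ < 1) (h : x - conj (μ * x) = 0) :
    x = 0 := by
  have h1 : ‖x‖ = ‖μ‖ * ‖x‖ := by
    rw [← norm_mul, ← Complex.norm_conj (μ * x), ← sub_eq_zero.1 h]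
  have : ‖x‖ = 0 := by nlinarith [norm_nonneg x]
  exact norm_eq_zero.1 this

/-- Bifurcation of zeros of harmonic maps: when `A - conj B` vanishes to a higher order than
`E - conj D`, the perturbation `A - conj B + t (E - conj D)` has, for small `t = s ^ (n - k)`,
zeros close to, but different from, the origin. -/
lemma eventually_exists_zero_perturbation {a b e d : ℂ → ℂ} {μ : ℂ} {n k : ℕ} (hkn : k < n)
    (ha : AnalyticAt ℂ a 0) (hb : AnalyticAt ℂ b 0) (he : AnalyticAt ℂ e 0)
    (hd : AnalyticAt ℂ d 0) (ha0 : a 0 ≠ 0) (he0 : e 0 ≠ 0) (hμ : ‖μ‖ < 1)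
    (hb0 : b 0 = μ * a 0) (hd0 : d 0 = μ * e 0) {U : Set ℂ} (hU : U ∈ 𝓝 0) :
    ∀ᶠ s in 𝓝[>] (0:ℝ), ∃ ζ ∈ U, ζ ≠ 0 ∧
      ζ ^ n * a ζ - conj (ζ ^ n * b ζ)
        + ((s ^ (n - k) : ℝ) : ℂ) * (ζ ^ k * e ζ - conj (ζ ^ k * d ζ)) = 0 := by
  obtain ⟨x₀, hx₀⟩ : ∃ x : ℂ, x ^ (n - k) = -(e 0) / a 0 :=
    IsAlgClosed.exists_pow_nat_eq _ (Nat.sub_pos_of_lt hkn)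
  have hx0 : x₀ ≠ 0 := by
    rintro rfl
    rw [zero_pow (Nat.sub_pos_of_lt hkn).ne', eq_comm, div_eq_zero_iff, neg_eq_zero] at hx₀
    tauto
  have hroot : x₀ ^ n * a 0 + x₀ ^ k * e 0 = 0 := by
    rw [show n = (n - k) + k by omega, pow_add, hx₀]
    field_simp
    ring
  set F : ℂ × ℝ → ℂ := fun p => p.1 ^ n * a (p.2 * p.1) + p.1 ^ k * e (p.2 * p.1)
    - conj (p.1 ^ n * b (p.2 * p.1) + p.1 ^ k * d (p.2 * p.1)) with hFdef
  have hcomp : ∀ {c : ℂ → ℂ}, AnalyticAt ℂ c 0 →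
      ContDiffAt ℝ 1 (fun p : ℂ × ℝ => c (p.2 * p.1)) (x₀, 0) := by
    intro c hc
    have h1 : ContDiffAt ℝ 1 c ((((x₀, 0) : ℂ × ℝ).2 : ℂ) * ((x₀, 0) : ℂ × ℝ).1) := by
      simpa using (hc.contDiffAt (n := 1)).restrict_scalars ℝ
    have h2 : ContDiffAt ℝ 1 (fun p : ℂ × ℝ => (p.2 : ℂ) * p.1) (x₀, 0) :=
      (Complex.ofRealCLM.contDiff.contDiffAt.comp _ contDiffAt_snd).mul contDiffAt_fst
    exact h1.comp (f := fun p : ℂ × ℝ => (p.2 : ℂ) * p.1) (x₀, 0) h2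
  have hcd : ContDiffAt ℝ 1 F (x₀, 0) := by
    have h1 := hcomp ha
    have h2 := hcomp hb
    have h3 := hcomp he
    have h4 := hcomp hd
    have h5 : ContDiffAt ℝ 1 (fun p : ℂ × ℝ =>
        p.1 ^ n * b (p.2 * p.1) + p.1 ^ k * d (p.2 * p.1)) (x₀, 0) :=
      ((contDiffAt_fst.pow n).mul h2).add ((contDiffAt_fst.pow k).mul h4)
    have h6 := Complex.conjCLE.contDiff.contDiffAt.comp (x₀, (0:ℝ)) h5
    exact ContDiffAt.sub (((contDiffAt_fst.pow n).mul h1).add ((contDiffAt_fst.pow k).mul h3)) h6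
  have hF0 : ∀ x, F (x, 0) = (x ^ n * a 0 + x ^ k * e 0)
      - conj (μ * (x ^ n * a 0 + x ^ k * e 0)) := by
    intro x
    simp only [hFdef, Complex.ofReal_zero, zero_mul, hb0, hd0]
    congr 2
    ring
  have hstrict := hcd.hasStrictFDerivAt one_ne_zero
  set P' : ℂ := n * x₀ ^ (n - 1) * a 0 + k * x₀ ^ (k - 1) * e 0 with hP'
  have hP'0 : P' ≠ 0 := by
    have h1 : P' * x₀ = ((k : ℂ) - n) * (x₀ ^ k * e 0) := by
      have e1 : (n:ℂ) * x₀ ^ (n - 1) * x₀ = n * x₀ ^ n := by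
        rw [mul_assoc, ← pow_succ, Nat.sub_add_cancel (by omega)]
      have e2 : (k:ℂ) * x₀ ^ (k - 1) * x₀ = k * x₀ ^ k := by
        rcases Nat.eq_zero_or_pos k with rfl | hk
        · simp
        · rw [mul_assoc, ← pow_succ, Nat.sub_add_cancel hk]
      calc P' * x₀ = (n:ℂ) * x₀ ^ (n - 1) * x₀ * a 0 + (k:ℂ) * x₀ ^ (k - 1) * x₀ * e 0 := by
            rw [hP']; ring
        _ = _ := by rw [e1, e2]; linear_combination (n:ℂ) * hroot
    intro h
    rw [h, zero_mul, eq_comm, mul_eq_zero, mul_eq_zero] at h1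
    rcases h1 with h1 | h1 | h1
    · rw [sub_eq_zero, Nat.cast_inj] at h1
      omega
    · exact pow_ne_zero _ hx0 h1
    · exact he0 h1
  have hPd : HasDerivAt (fun x : ℂ => x ^ n * a 0 + x ^ k * e 0) P' x₀ :=
    ((hasDerivAt_pow n x₀).mul_const _).add ((hasDerivAt_pow k x₀).mul_const _)
  have hder : ∀ v : ℂ, fderiv ℝ F (x₀, 0) (v, 0) = P' * v - conj (μ * (P' * v)) := by
    intro v
    have h1 : HasFDerivAt (fun x : ℂ => F (x, 0))
        ((fderiv ℝ F (x₀, 0)).comp (ContinuousLinearMap.inl ℝ ℂ ℝ)) x₀ :=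
      HasFDerivAt.comp x₀ (f := fun x : ℂ => (x, (0:ℝ))) hstrict.hasFDerivAt
        (hasFDerivAt_prodMk_left x₀ (0:ℝ))
    have h2 := (hPd.hasFDerivAt.restrictScalars ℝ)
    have h3 := h2.sub ((Complex.conjCLE.toContinuousLinearMap.hasFDerivAt).comp x₀
      (((ContinuousLinearMap.mul ℝ ℂ μ).hasFDerivAt).comp x₀ h2))
    have h4 : (fun x : ℂ => F (x, 0)) = _ := funext hF0
    rw [h4] at h1
    have := congrArg (fun L => L v) (h1.unique h3)
    simp at this
    simp [this]
    ring
  have hsurj : ∀ y, ∃ v, fderiv ℝ F (x₀, 0) (v, 0) = y := by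
    intro y
    obtain ⟨x, hx⟩ := exists_sub_conj_mul_eq hμ y
    refine ⟨x / P', ?_⟩
    rw [hder, mul_div_cancel₀ _ hP'0, hx]
  have hzero : F (x₀, 0) = 0 := by rw [hF0, hroot]; simp
  have hV : Metric.ball x₀ ‖x₀‖ ∈ 𝓝 x₀ := Metric.ball_mem_nhds _ (norm_pos_iff.2 hx0)
  have hev := eventually_exists_eq_zero_of_surjective hstrict hzero hsurj hV
  obtain ⟨ε, hε, hεU⟩ := Metric.mem_nhds_iff.1 hU
  have hsmall : ∀ᶠ s in 𝓝 (0:ℝ), |s| * (2 * ‖x₀‖) < ε := by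
    have : Tendsto (fun s : ℝ => |s| * (2 * ‖x₀‖)) (𝓝 0) (𝓝 (|0| * (2 * ‖x₀‖))) :=
      ((continuous_abs.mul continuous_const).tendsto 0)
    rw [abs_zero, zero_mul] at this
    exact this.eventually (gt_mem_nhds hε)
  filter_upwards [nhdsWithin_le_nhds hev, nhdsWithin_le_nhds hsmall, self_mem_nhdsWithin]
    with s hs hs2 hs0
  obtain ⟨x, hx, hFx⟩ := hs
  have hs0' : (s:ℂ) ≠ 0 := by exact_mod_cast (ne_of_gt hs0)
  have hxne : x ≠ 0 := by
    rintro rfl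
    simp at hx
  have hxn : ‖x‖ < 2 * ‖x₀‖ := by
    have := norm_le_norm_add_norm_sub' x x₀
    rw [mem_ball_iff_norm] at hx
    linarith
  refine ⟨s * x, hεU ?_, mul_ne_zero hs0' hxne, ?_⟩
  · rw [mem_ball_zero_iff, norm_mul, Complex.norm_real, Real.norm_eq_abs]
    refine lt_of_le_of_lt ?_ hs2
    gcongr
  · have hpow : (s:ℂ) ^ (n - k) * s ^ k = s ^ n := by
      rw [← pow_add, Nat.sub_add_cancel hkn.le]
    have : (s:ℂ) ^ n * F (x, s) = 0 := by rw [hFx, mul_zero]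
    rw [← this, hFdef]
    simp only [map_add, map_mul, map_pow, mul_pow, Complex.conj_ofReal, Complex.ofReal_pow]
    rw [← hpow]
    ring

/-- If `B' = ν A'` near `0`, `B 0 = 0` and `A = ζ ^ n a`, then `B = ζ ^ n b` with
`b 0 = ν 0 * a 0`. -/
lemma exists_factor_of_deriv_eq_mul {A B ν a : ℂ → ℂ} {n : ℕ} (hn : n ≠ 0)
    (ha : AnalyticAt ℂ a 0) (hA : ∀ᶠ z in 𝓝 0, A z = z ^ n * a z) (hB : AnalyticAt ℂ B 0)
    (hB0 : B 0 = 0) (hν : AnalyticAt ℂ ν 0)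
    (hd : ∀ᶠ z in 𝓝 0, deriv B z = ν z * deriv A z) :
    ∃ b : ℂ → ℂ, AnalyticAt ℂ b 0 ∧ (∀ᶠ z in 𝓝 0, B z = z ^ n * b z) ∧ b 0 = ν 0 * a 0 := by
  obtain ⟨m, rfl⟩ := Nat.exists_eq_succ_of_ne_zero hn
  have hpow : ∀ {c C : ℂ → ℂ}, AnalyticAt ℂ c 0 → (∀ᶠ z in 𝓝 0, C z = z ^ (m + 1) * c z) →
      ∀ᶠ z in 𝓝 0, deriv C z = z ^ m * ((m + 1) * c z + z * deriv c z) := by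
    intro c C hc hC
    have h1 : ∀ᶠ z in 𝓝 0, C =ᶠ[𝓝 z] fun z => z ^ (m + 1) * c z := hC.eventually_nhds
    filter_upwards [h1, hc.eventually_analyticAt] with z hz hcz
    rw [hz.deriv_eq, deriv_fun_mul (by fun_prop) hcz.differentiableAt]
    simp
    ring
  have hdA := hpow ha hA
  have hord : ((m + 1 : ℕ) : ℕ∞) ≤ analyticOrderAt B 0 := by
    have h1 : (m : ℕ∞) ≤ analyticOrderAt (deriv B) 0 := by
      rw [natCast_le_analyticOrderAt hB.deriv]
      refine ⟨fun z => ν z * ((m + 1) * a z + z * deriv a z), ?_, ?_⟩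
      · have := ha.deriv
        fun_prop
      · filter_upwards [hd, hdA] with z h1 h2
        rw [h1, h2, sub_zero, smul_eq_mul]
        ring
    have h2 := hB.analyticOrderAt_deriv_add_one
    simp only [hB0, sub_zero] at h2
    rw [← h2]
    push_cast
    gcongr
  rw [natCast_le_analyticOrderAt hB] at hord
  obtain ⟨b, hb, hBb⟩ := hord
  simp only [sub_zero, smul_eq_mul] at hBb
  refine ⟨b, hb, hBb, ?_⟩
  have hdB := hpow hb hBb
  have heq : ∀ᶠ z in 𝓝[≠] (0:ℂ), (m + 1) * b z + z * deriv b z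
      = ν z * ((m + 1) * a z + z * deriv a z) := by
    filter_upwards [nhdsWithin_le_nhds hd, nhdsWithin_le_nhds hdA, nhdsWithin_le_nhds hdB,
      self_mem_nhdsWithin] with z h1 h2 h3 h4
    rw [h2, h3] at h1
    refine mul_left_cancel₀ (pow_ne_zero m h4) ?_
    rw [h1]
    ring
  have hlim1 : ContinuousAt (fun z => (m + 1) * b z + z * deriv b z) 0 := by
    have := hb.deriv.continuousAt
    have := hb.continuousAt
    fun_prop
  have hlim2 : ContinuousAt (fun z => ν z * ((m + 1) * a z + z * deriv a z)) 0 := by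
    have := ha.deriv.continuousAt
    have := ha.continuousAt
    have := hν.continuousAt
    fun_prop
  have h := tendsto_nhds_unique_of_eventuallyEq (hlim1.tendsto.mono_left nhdsWithin_le_nhds)
    (hlim2.tendsto.mono_left nhdsWithin_le_nhds) heq
  simp only [zero_mul, add_zero] at h
  have hm : (m + 1 : ℂ) ≠ 0 := by exact_mod_cast Nat.succ_ne_zero m
  refine mul_left_cancel₀ hm ?_
  rw [h]
  ring

/-- Bifurcation from a zero of the harmonic map `A - conj B`, with `B' = ν A'`. Here `k = 0` or
`k = 1` is the order of vanishing of `E`. -/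
lemma eventually_exists_zero_of_deriv_eq_mul {A B E D ν : ℂ → ℂ} {k : ℕ}
    (hA : AnalyticAt ℂ A 0) (hB : AnalyticAt ℂ B 0)
    (hA0 : A 0 = 0) (hB0 : B 0 = 0) (hν : AnalyticAt ℂ ν 0) (hν0 : ‖ν 0‖ < 1)
    (hd : ∀ᶠ z in 𝓝 0, deriv B z = ν z * deriv A z)
    (hne : ¬ ∀ᶠ z in 𝓝 0, A z = 0) (hk : k = 1 → deriv A 0 = 0)
    {e d : ℂ → ℂ} (he : AnalyticAt ℂ e 0) (hdan : AnalyticAt ℂ d 0) (he0 : e 0 ≠ 0)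
    (hd0 : d 0 = ν 0 * e 0) (hE : ∀ᶠ z in 𝓝 0, E z = z ^ k * e z)
    (hD : ∀ᶠ z in 𝓝 0, D z = z ^ k * d z) (hk1 : k ≤ 1) {U : Set ℂ} (hU : U ∈ 𝓝 0) :
    ∃ t > (0:ℝ), ∃ ζ ∈ U, ζ ≠ 0 ∧ A ζ - conj (B ζ) + t * (E ζ - conj (D ζ)) = 0 := by
  have hord : analyticOrderAt A 0 ≠ ⊤ := by rwa [Ne, analyticOrderAt_eq_top]
  obtain ⟨a, ha, ha0, hAa⟩ := (hA.analyticOrderAt_ne_top).1 hord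
  set n := analyticOrderNatAt A 0
  simp only [sub_zero, smul_eq_mul] at hAa
  have hn0 : n ≠ 0 := by
    intro h
    have : A 0 = 0 ^ n * a 0 := hAa.self_of_nhds
    rw [h, hA0, pow_zero, one_mul] at this
    exact ha0 this.symm
  have hkn : k < n := by
    rcases Nat.lt_or_ge k n with h | h
    · exact h
    · have hk' : k = 1 := by omega
      have hn1 : n = 1 := by omega
      exfalso
      have h1 : deriv A 0 = a 0 := by
        rw [hn1] at hAa
        simp only [pow_one] at hAa
        rw [EventuallyEq.deriv_eq (f := fun z => z * a z) hAa,
          deriv_fun_mul (by fun_prop) ha.differentiableAt]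
        simp
      exact ha0 (h1 ▸ hk hk')
  obtain ⟨b, hb, hBb, hb0⟩ := exists_factor_of_deriv_eq_mul hn0 ha hAa hB hB0 hν hd
  have hU' : U ∩ {z | A z = z ^ n * a z ∧ B z = z ^ n * b z ∧ E z = z ^ k * e z ∧
      D z = z ^ k * d z} ∈ 𝓝 0 := by
    filter_upwards [hU, hAa, hBb, hE, hD] with z h1 h2 h3 h4 h5
    exact ⟨h1, h2, h3, h4, h5⟩
  have h := eventually_exists_zero_perturbation hkn ha hb he hdan ha0 he0 hν0 hb0 hd0 hU'
  obtain ⟨s, ⟨ζ, hζ, hζ0, hz⟩, hs⟩ := (h.and self_mem_nhdsWithin).exists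
  refine ⟨s ^ (n - k), pow_pos hs _, ζ, hζ.1, hζ0, ?_⟩
  obtain ⟨-, h1, h2, h3, h4⟩ := hζ
  rw [h1, h2, h3, h4]
  exact hz

/-- The real-linear form `v ↦ (v + conj q ^ 2 * conj v) / (1 - ‖q‖ ^ 4)`: the differential of the
isothermal coordinate of a minimal graph whose Gauss map has value `q`. -/
noncomputable def isoForm (q : ℂ) : ℂ →L[ℝ] ℂ :=
  ((1 - ‖q‖ ^ 4)⁻¹ : ℝ) • (ContinuousLinearMap.id ℝ ℂ +
    (ContinuousLinearMap.mul ℝ ℂ (conj q ^ 2)).comp Complex.conjCLE.toContinuousLinearMap)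

/-- The inverse of `isoForm q`. -/
noncomputable def isoInv (q : ℂ) : ℂ →L[ℝ] ℂ :=
  ContinuousLinearMap.id ℝ ℂ -
    (ContinuousLinearMap.mul ℝ ℂ (conj q ^ 2)).comp Complex.conjCLE.toContinuousLinearMap

lemma isoForm_apply (q v : ℂ) :
    isoForm q v = ((1 - ‖q‖ ^ 4 : ℝ) : ℂ)⁻¹ * (v + conj q ^ 2 * conj v) := by
  simp [isoForm]
  ring

lemma isoInv_apply (q v : ℂ) : isoInv q v = v - conj q ^ 2 * conj v := by
  simp [isoInv]

lemma ofReal_norm_pow_four (q : ℂ) : ((‖q‖ ^ 4 : ℝ) : ℂ) = q ^ 2 * conj q ^ 2 := by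
  have : q * conj q = ((‖q‖ ^ 2 : ℝ) : ℂ) := by
    rw [Complex.mul_conj, Complex.normSq_eq_norm_sq]
  rw [← mul_pow, this]
  push_cast
  ring

lemma one_sub_norm_pow_four_pos {q : ℂ} (hq : ‖q‖ < 1) : 0 < 1 - ‖q‖ ^ 4 := by
  have := pow_lt_one₀ (norm_nonneg q) hq (show 4 ≠ 0 by norm_num)
  linarith

lemma isoInv_isoForm {q : ℂ} (hq : ‖q‖ < 1) (v : ℂ) : isoInv q (isoForm q v) = v := by
  have h : ((1 - ‖q‖ ^ 4 : ℝ) : ℂ) ≠ 0 := by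
    exact_mod_cast (one_sub_norm_pow_four_pos hq).ne'
  rw [isoInv_apply, isoForm_apply]
  simp only [map_mul, map_inv₀, Complex.conj_ofReal, map_add, map_pow, Complex.conj_conj]
  field_simp
  rw [Complex.ofReal_sub, ofReal_norm_pow_four]
  push_cast
  ring

lemma isoForm_isoInv {q : ℂ} (hq : ‖q‖ < 1) (v : ℂ) : isoForm q (isoInv q v) = v := by
  have h : ((1 - ‖q‖ ^ 4 : ℝ) : ℂ) ≠ 0 := by
    exact_mod_cast (one_sub_norm_pow_four_pos hq).ne'
  rw [isoInv_apply, isoForm_apply]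
  simp only [map_mul, map_sub, map_pow, Complex.conj_conj]
  field_simp
  rw [Complex.ofReal_sub, ofReal_norm_pow_four]
  push_cast
  ring

/-- `isoForm q` as a continuous linear equivalence. -/
noncomputable def isoEquiv {q : ℂ} (hq : ‖q‖ < 1) : ℂ ≃L[ℝ] ℂ :=
  ContinuousLinearEquiv.equivOfInverse (isoForm q) (isoInv q) (isoInv_isoForm hq)
    (isoForm_isoInv hq)

lemma continuousAt_isoForm {q : ℂ} (hq : ‖q‖ < 1) : ContinuousAt isoForm q := by
  have h := (one_sub_norm_pow_four_pos hq).ne'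
  unfold isoForm
  have h1 : ContinuousAt (fun q : ℂ => (1 - ‖q‖ ^ 4)⁻¹) q := by
    have h0 : ContinuousAt (fun q : ℂ => 1 - ‖q‖ ^ 4) q := by fun_prop
    exact h0.inv₀ h
  have h2 : ContinuousAt (fun q : ℂ => ContinuousLinearMap.mul ℝ ℂ (conj q ^ 2)) q := by
    have : Continuous (fun q : ℂ => conj q ^ 2) := by fun_prop
    exact ((ContinuousLinearMap.mul ℝ ℂ).continuous.comp this).continuousAt
  exact h1.smul (continuousAt_const.add (h2.clm_comp continuousAt_const))

/-- Isothermal data of a minimal graph over the unit disk: the Gauss map `q` and the isothermal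
coordinate `h`, with `dq = Q dh`. -/
structure IsothermalData (q h Q : ℂ → ℂ) : Prop where
  norm_lt : ∀ z ∈ Metric.ball (0:ℂ) 1, ‖q z‖ < 1
  hasFDerivAt_coord : ∀ z ∈ Metric.ball (0:ℂ) 1, HasFDerivAt h (isoForm (q z)) z
  hasFDerivAt_gauss : ∀ z ∈ Metric.ball (0:ℂ) 1,
    HasFDerivAt q ((ContinuousLinearMap.mul ℝ ℂ (Q z)).comp (isoForm (q z))) z

namespace IsothermalData

variable {q h Q : ℂ → ℂ}

lemma hasStrictFDerivAt_coord (hD : IsothermalData q h Q) {z : ℂ}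
    (hz : z ∈ Metric.ball (0:ℂ) 1) : HasStrictFDerivAt h (isoForm (q z)) z := by
  refine hasStrictFDerivAt_of_hasFDerivAt_of_continuousAt (f' := fun z => isoForm (q z)) ?_ ?_
  · filter_upwards [Metric.isOpen_ball.mem_nhds hz] with y hy using hD.hasFDerivAt_coord y hy
  · exact ContinuousAt.comp (f := q) (continuousAt_isoForm (hD.norm_lt z hz))
      (hD.hasFDerivAt_gauss z hz).continuousAt

/-- The local inverse of the isothermal coordinate, in which the Gauss map is holomorphic. -/
lemma exists_chart (hD : IsothermalData q h Q) {z₁ : ℂ} (hz₁ : z₁ ∈ Metric.ball (0:ℂ) 1) :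
    ∃ g n : ℂ → ℂ, g 0 = z₁ ∧ n 0 = 0 ∧ ContinuousAt g 0 ∧
      (∀ᶠ ζ in 𝓝 0, g ζ ∈ Metric.ball (0:ℂ) 1 ∧ g ζ = z₁ + ζ - conj (n ζ) ∧
        HasDerivAt n (q (g ζ) ^ 2) ζ ∧ HasDerivAt (fun ζ => q (g ζ)) (Q (g ζ)) ζ ∧
        h (g ζ) - h z₁ = ζ ∧ ContinuousAt g ζ) ∧
      ∀ᶠ z in 𝓝 z₁, g (h z - h z₁) = z := by
  have hs : HasStrictFDerivAt h (isoEquiv (hD.norm_lt z₁ hz₁) : ℂ →L[ℝ] ℂ) z₁ :=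
    hD.hasStrictFDerivAt_coord hz₁
  set φ := hs.toOpenPartialHomeomorph h with hφ
  have hφh : ∀ z, φ z = h z := fun z => rfl
  have hsrc : z₁ ∈ φ.source := hs.mem_toOpenPartialHomeomorph_source
  have htgt : h z₁ ∈ φ.target := φ.map_source hsrc
  set g : ℂ → ℂ := fun ζ => φ.symm (h z₁ + ζ) with hg
  have hg0 : g 0 = z₁ := by
    simp only [hg, add_zero]
    exact φ.left_inv hsrc
  have htgt' : ∀ᶠ ζ in 𝓝 (0:ℂ), h z₁ + ζ ∈ φ.target := by
    have : ContinuousAt (fun ζ : ℂ => h z₁ + ζ) 0 := by fun_prop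
    refine this.eventually (φ.open_target.mem_nhds ?_)
    simpa using htgt
  have hcont : ∀ ζ, h z₁ + ζ ∈ φ.target → ContinuousAt g ζ := fun ζ hζ =>
    ContinuousAt.comp (f := fun ζ : ℂ => h z₁ + ζ) (φ.continuousAt_symm hζ) (by fun_prop)
  have hg0c : ContinuousAt g 0 := hcont 0 htgt'.self_of_nhds
  have hball : ∀ᶠ ζ in 𝓝 (0:ℂ), g ζ ∈ Metric.ball (0:ℂ) 1 :=
    hg0c.eventually (Metric.isOpen_ball.mem_nhds (hg0 ▸ hz₁))
  have hder : ∀ ζ, h z₁ + ζ ∈ φ.target → g ζ ∈ Metric.ball (0:ℂ) 1 →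
      HasFDerivAt g (isoInv (q (g ζ))) ζ := by
    intro ζ hζ hgζ
    have h1 : HasFDerivAt φ (isoEquiv (hD.norm_lt _ hgζ) : ℂ →L[ℝ] ℂ) (φ.symm (h z₁ + ζ)) :=
      hD.hasFDerivAt_coord _ hgζ
    have h2 : HasFDerivAt φ.symm (isoInv (q (g ζ))) (h z₁ + ζ) := φ.hasFDerivAt_symm hζ h1
    have h3 : HasFDerivAt (fun ζ : ℂ => h z₁ + ζ) (ContinuousLinearMap.id ℝ ℂ) ζ :=
      (hasFDerivAt_id ζ).const_add _
    exact h2.comp ζ h3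
  refine ⟨g, fun ζ => conj (z₁ + ζ - g ζ), hg0, by simp [hg0], hg0c, ?_, ?_⟩
  · filter_upwards [htgt', hball] with ζ h1 h2
    refine ⟨h2, by simp, ?_, ?_, ?_, hcont ζ h1⟩
    · have h3 : HasFDerivAt (fun ζ : ℂ => z₁ + ζ - g ζ)
          (ContinuousLinearMap.id ℝ ℂ - isoInv (q (g ζ))) ζ :=
        ((hasFDerivAt_id ζ).const_add _).sub (hder ζ h1 h2)
      have h4 := Complex.conjCLE.toContinuousLinearMap.hasFDerivAt.comp ζ h3
      rw [hasDerivAt_iff_hasFDerivAt]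
      refine hasFDerivAt_of_restrictScalars ℝ h4 ?_
      ext; simp [isoInv_apply, mul_comm]
    · have h4 := (hD.hasFDerivAt_gauss _ h2).comp ζ (hder ζ h1 h2)
      rw [hasDerivAt_iff_hasFDerivAt]
      refine hasFDerivAt_of_restrictScalars ℝ h4 ?_
      have := isoForm_isoInv (hD.norm_lt _ h2)
      ext; simp [this, mul_comm]
    · have : φ (φ.symm (h z₁ + ζ)) = h z₁ + ζ := φ.right_inv h1
      rw [hφh] at this
      simp [hg, this]
  · filter_upwards [φ.open_source.mem_nhds hsrc] with z hz
    have : φ.symm (φ z) = z := φ.left_inv hz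
    rw [hφh] at this
    simp [hg, this]

end IsothermalData

/-- A comparison harmonic map `H - conj N` on the unit disk with `N' = q ^ 2 H'`, which is bounded
by one, vanishes at `q₀` and misses a point of the unit disk. -/
structure ComparisonMap (H N p : ℂ → ℂ) (q₀ : ℂ) : Prop where
  hasDerivAt_left : ∀ x ∈ Metric.ball (0:ℂ) 1, HasDerivAt H (p x) x
  hasDerivAt_right : ∀ x ∈ Metric.ball (0:ℂ) 1, HasDerivAt N (x ^ 2 * p x) x
  norm_le : ∀ x ∈ Metric.ball (0:ℂ) 1, ‖H x - conj (N x)‖ ≤ 1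
  eq_zero : H q₀ - conj (N q₀) = 0
  exists_not_mem : ∃ y ∈ Metric.ball (0:ℂ) 1, ∀ x ∈ Metric.ball (0:ℂ) 1, H x - conj (N x) ≠ y

section

variable {q h Q H N p : ℂ → ℂ}

/-- Description of `c z - w z`, with `w = (H - conj N) ∘ q`, in an isothermal chart. -/
lemma exists_chart_comparison (hD : IsothermalData q h Q) (hC : ComparisonMap H N p (q 0))
    {z₁ : ℂ} (hz₁ : z₁ ∈ Metric.ball (0:ℂ) 1) (c : ℝ)
    (hc : (c : ℂ) * z₁ = H (q z₁) - conj (N (q z₁))) :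
    ∃ g n A B : ℂ → ℂ, g 0 = z₁ ∧ n 0 = 0 ∧ A 0 = 0 ∧ B 0 = 0 ∧ ContinuousAt g 0 ∧
      AnalyticAt ℂ A 0 ∧ AnalyticAt ℂ B 0 ∧ AnalyticAt ℂ n 0 ∧
      AnalyticAt ℂ (fun ζ => q (g ζ) ^ 2) 0 ∧
      (∀ᶠ ζ in 𝓝 0, g ζ ∈ Metric.ball (0:ℂ) 1 ∧ g ζ = z₁ + ζ - conj (n ζ) ∧
        deriv n ζ = q (g ζ) ^ 2 ∧ HasDerivAt A (c - p (q (g ζ)) * Q (g ζ)) ζ ∧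
        HasDerivAt B (q (g ζ) ^ 2 * (c - p (q (g ζ)) * Q (g ζ))) ζ ∧
        h (g ζ) - h z₁ = ζ ∧ ContinuousAt g ζ ∧
        c * g ζ - (H (q (g ζ)) - conj (N (q (g ζ)))) = A ζ - conj (B ζ)) ∧
      ∀ᶠ z in 𝓝 z₁, g (h z - h z₁) = z := by
  obtain ⟨g, n, hg0, hn0, hgc, hev, hinv⟩ := hD.exists_chart hz₁
  have han : AnalyticAt ℂ n 0 := Complex.analyticAt_iff_eventually_differentiableAt.2
    (hev.mono fun ζ hζ => hζ.2.2.1.differentiableAt)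
  have haq : AnalyticAt ℂ (fun ζ => q (g ζ)) 0 :=
    Complex.analyticAt_iff_eventually_differentiableAt.2
      (hev.mono fun ζ hζ => hζ.2.2.2.1.differentiableAt)
  set A : ℂ → ℂ := fun ζ => c * ζ - (H (q (g ζ)) - H (q z₁)) with hA
  set B : ℂ → ℂ := fun ζ => c * n ζ - (N (q (g ζ)) - N (q z₁)) with hB
  have hdA : ∀ᶠ ζ in 𝓝 0, HasDerivAt A (c - p (q (g ζ)) * Q (g ζ)) ζ := by
    filter_upwards [hev] with ζ hζ
    have hq : q (g ζ) ∈ Metric.ball (0:ℂ) 1 := by simpa using hD.norm_lt _ hζ.1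
    have h1 := (hC.hasDerivAt_left _ hq).comp ζ hζ.2.2.2.1
    have h2 : HasDerivAt A (c * 1 - p (q (g ζ)) * Q (g ζ)) ζ :=
      ((hasDerivAt_id ζ).const_mul (c:ℂ)).sub (h1.sub_const (H (q z₁)))
    rwa [mul_one] at h2
  have hdB : ∀ᶠ ζ in 𝓝 0,
      HasDerivAt B (q (g ζ) ^ 2 * (c - p (q (g ζ)) * Q (g ζ))) ζ := by
    filter_upwards [hev] with ζ hζ
    have hq : q (g ζ) ∈ Metric.ball (0:ℂ) 1 := by simpa using hD.norm_lt _ hζ.1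
    have h1 := (hC.hasDerivAt_right _ hq).comp ζ hζ.2.2.2.1
    have h2 : HasDerivAt B (c * q (g ζ) ^ 2 - q (g ζ) ^ 2 * p (q (g ζ)) * Q (g ζ)) ζ :=
      (hζ.2.2.1.const_mul (c:ℂ)).sub (h1.sub_const (N (q z₁)))
    convert h2 using 1
    ring
  refine ⟨g, n, A, B, hg0, hn0, by simp [hA, hg0], by simp [hB, hg0, hn0], hgc, ?_, ?_, han,
    haq.pow 2, ?_, hinv⟩
  · exact Complex.analyticAt_iff_eventually_differentiableAt.2
      (hdA.mono fun ζ hζ => hζ.differentiableAt)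
  · exact Complex.analyticAt_iff_eventually_differentiableAt.2
      (hdB.mono fun ζ hζ => hζ.differentiableAt)
  · filter_upwards [hev, hdA, hdB] with ζ hζ h1 h2
    refine ⟨hζ.1, hζ.2.1, hζ.2.2.1.deriv, h1, h2, hζ.2.2.2.2.1, hζ.2.2.2.2.2, ?_⟩
    have hconj : conj (B ζ) = c * conj (n ζ) - (conj (N (q (g ζ))) - conj (N (q z₁))) := by
      simp [hB]
    rw [hconj, hA]
    have : (c:ℂ) * g ζ = c * z₁ + c * ζ - c * conj (n ζ) := by
      rw [hζ.2.1]; ring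
    rw [this, hc]
    ring

/-- Either `c z = w z` near `z₁`, or the equation `c' z = w z` has a solution `z ≠ 0` for some
`c' > c`. -/
lemma eventually_eq_or_exists_gt (hD : IsothermalData q h Q) (hC : ComparisonMap H N p (q 0))
    {z₁ : ℂ} (hz₁ : z₁ ∈ Metric.ball (0:ℂ) 1) (c : ℝ)
    (hc : (c : ℂ) * z₁ = H (q z₁) - conj (N (q z₁))) (hc' : z₁ = 0 → p (q 0) * Q 0 = c) :
    (∀ᶠ z in 𝓝 z₁, (c : ℂ) * z = H (q z) - conj (N (q z))) ∨
      ∃ c' > c, ∃ z ∈ Metric.ball (0:ℂ) 1, z ≠ 0 ∧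
        (c' : ℂ) * z = H (q z) - conj (N (q z)) := by
  obtain ⟨g, n, A, B, hg0, hn0, hA0, hB0, hgc, hA, hB, hn, hν, hev, hinv⟩ :=
    exists_chart_comparison hD hC hz₁ c hc
  have hν0 : ‖q (g 0) ^ 2‖ < 1 := by
    rw [norm_pow, hg0]
    exact pow_lt_one₀ (norm_nonneg _) (hD.norm_lt _ hz₁) two_ne_zero
  have hd : ∀ᶠ ζ in 𝓝 0, deriv B ζ = q (g ζ) ^ 2 * deriv A ζ := by
    filter_upwards [hev] with ζ hζ
    rw [hζ.2.2.2.1.deriv, hζ.2.2.2.2.1.deriv]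
  by_cases hne : ∀ᶠ ζ in 𝓝 0, A ζ = 0
  · left
    have hB' : ∀ᶠ ζ in 𝓝 0, B ζ = 0 := by
      have h1 : ∀ᶠ ζ in 𝓝 0, deriv B ζ = 0 := by
        filter_upwards [hd, hne.eventually_nhds] with ζ h1 h2
        have h3 : deriv A ζ = 0 := by
          rw [EventuallyEq.deriv_eq (f := fun _ => (0:ℂ)) h2]; simp
        rw [h1, h3, mul_zero]
      have h2 := hB.analyticOrderAt_deriv_add_one
      rw [analyticOrderAt_eq_top.2 h1] at h2
      simp only [hB0, sub_zero, top_add] at h2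
      exact analyticOrderAt_eq_top.1 h2.symm
    have hcoord : ContinuousAt (fun z => h z - h z₁) z₁ :=
      (hD.hasFDerivAt_coord z₁ hz₁).continuousAt.sub continuousAt_const
    have htend : Tendsto (fun z => h z - h z₁) (𝓝 z₁) (𝓝 0) := by
      simpa using hcoord.tendsto
    filter_upwards [hinv, htend.eventually hne, htend.eventually hB', htend.eventually hev]
      with z h1 h2 h3 h4
    have := h4.2.2.2.2.2.2.2
    rw [h1, h2, h3, map_zero, sub_zero, sub_eq_zero] at this
    exact this
  · right
    have key : ∃ t > (0:ℝ), ∃ ζ ∈ {ζ | g ζ ∈ Metric.ball (0:ℂ) 1 ∧ (ζ ≠ 0 → g ζ ≠ 0) ∧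
        c * g ζ - (H (q (g ζ)) - conj (N (q (g ζ)))) = A ζ - conj (B ζ)}, ζ ≠ 0 ∧
        A ζ - conj (B ζ) + t * g ζ = 0 := by
      rcases eq_or_ne z₁ 0 with rfl | hz0
      · obtain ⟨d, hd1, hd2, hd3⟩ := exists_factor_of_deriv_eq_mul (A := fun ζ => ζ)
          (a := fun _ => 1) one_ne_zero analyticAt_const (by simp) hn hn0 hν
          (by filter_upwards [hev] with ζ hζ; simp [hζ.2.2.1])
        have hU : {ζ | (g ζ ∈ Metric.ball (0:ℂ) 1 ∧ (ζ ≠ 0 → g ζ ≠ 0) ∧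
          c * g ζ - (H (q (g ζ)) - conj (N (q (g ζ)))) = A ζ - conj (B ζ)) ∧
          g ζ = ζ - conj (n ζ)} ∈ 𝓝 0 := by
          filter_upwards [hev] with ζ hζ
          refine ⟨⟨hζ.1, fun h0 hg => h0 ?_, hζ.2.2.2.2.2.2.2⟩, ?_⟩
          · rw [← hζ.2.2.2.2.2.1, hg, sub_self]
          · simpa using hζ.2.1
        obtain ⟨t, ht, ζ, hζ, hζ0, hz⟩ := eventually_exists_zero_of_deriv_eq_mul (k := 1)
          (E := fun ζ => ζ) (D := n) (e := fun _ => 1) hA hB hA0 hB0 hν hν0 hd hne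
          (fun _ => by rw [hev.self_of_nhds.2.2.2.1.deriv, hg0, hc' rfl, sub_self])
          analyticAt_const hd1 one_ne_zero hd3 (by simp) hd2 le_rfl hU
        refine ⟨t, ht, ζ, hζ.1, hζ0, ?_⟩
        rw [hζ.2]
        exact hz
      · obtain ⟨x₁, hx₁⟩ := exists_sub_conj_mul_eq hν0 z₁
        have hx0 : x₁ ≠ 0 := by
          rintro rfl
          simp at hx₁
          exact hz0 hx₁.symm
        have hU : {ζ | (g ζ ∈ Metric.ball (0:ℂ) 1 ∧ (ζ ≠ 0 → g ζ ≠ 0) ∧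
          c * g ζ - (H (q (g ζ)) - conj (N (q (g ζ)))) = A ζ - conj (B ζ)) ∧
          g ζ = z₁ + ζ - conj (n ζ)} ∈ 𝓝 0 := by
          have : ∀ᶠ ζ in 𝓝 0, g ζ ≠ 0 :=
            hgc.eventually (isOpen_ne.mem_nhds (by simpa [hg0] using hz0))
          filter_upwards [hev, this] with ζ hζ hζ'
          exact ⟨⟨hζ.1, fun _ => hζ', hζ.2.2.2.2.2.2.2⟩, hζ.2.1⟩
        obtain ⟨t, ht, ζ, hζ, hζ0, hz⟩ := eventually_exists_zero_of_deriv_eq_mul (k := 0)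
          (E := fun ζ => ζ + x₁) (D := fun ζ => n ζ + q (g 0) ^ 2 * x₁)
          (e := fun ζ => ζ + x₁) (d := fun ζ => n ζ + q (g 0) ^ 2 * x₁)
          hA hB hA0 hB0 hν hν0 hd hne (fun h => absurd h zero_ne_one)
          (by fun_prop) (by fun_prop) (by simpa using hx0) (by simp [hn0]) (by simp) (by simp)
          zero_le_one hU
        refine ⟨t, ht, ζ, hζ.1, hζ0, ?_⟩
        rw [hζ.2]
        rw [← hz]
        conv_lhs => rw [← hx₁]
        simp only [map_add]
        ring
    obtain ⟨t, ht, ζ, ⟨h1, h2, h3⟩, hζ0, hz⟩ := key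
    refine ⟨c + t, by linarith, g ζ, h1, h2 hζ0, ?_⟩
    rw [← h3] at hz
    push_cast
    linear_combination hz

/-- The identity `c z = w z` propagates from a neighbourhood of a point to the unit disk. -/
lemma eq_of_eventually_eq (hD : IsothermalData q h Q) (hC : ComparisonMap H N p (q 0))
    {z₁ : ℂ} (hz₁ : z₁ ∈ Metric.ball (0:ℂ) 1) (c : ℝ)
    (hc : ∀ᶠ z in 𝓝 z₁, (c : ℂ) * z = H (q z) - conj (N (q z))) :
    ∀ z ∈ Metric.ball (0:ℂ) 1, (c : ℂ) * z = H (q z) - conj (N (q z)) := by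
  set S : Set ℂ := {z | ∀ᶠ z' in 𝓝 z, (c : ℂ) * z' = H (q z') - conj (N (q z'))} with hS
  have hSo : IsOpen S := isOpen_setOfPred_eventually_nhds
  suffices Metric.ball (0:ℂ) 1 ⊆ S from fun z hz => (this hz).self_of_nhds
  refine (convex_ball (0:ℂ) 1).isPreconnected.subset_of_closure_inter_subset hSo
    ⟨z₁, hz₁, hc⟩ ?_
  rintro z₂ ⟨hz₂c, hz₂⟩
  have hqc : ContinuousAt q z₂ := (hD.hasFDerivAt_gauss z₂ hz₂).continuousAt
  have hqb : q z₂ ∈ Metric.ball (0:ℂ) 1 := by simpa using hD.norm_lt _ hz₂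
  have hwc : ContinuousAt (fun z => (c:ℂ) * z - (H (q z) - conj (N (q z)))) z₂ := by
    have h1 : ContinuousAt (fun z => H (q z)) z₂ :=
      ContinuousAt.comp (f := q) (hC.hasDerivAt_left _ hqb).continuousAt hqc
    have h2 : ContinuousAt (fun z => N (q z)) z₂ :=
      ContinuousAt.comp (f := q) (hC.hasDerivAt_right _ hqb).continuousAt hqc
    have h3 : ContinuousAt (fun z => conj (N (q z))) z₂ :=
      Complex.continuous_conj.continuousAt.comp h2
    exact (continuousAt_const.mul continuousAt_id).sub (h1.sub h3)
  have hfreq : ∃ᶠ z in 𝓝 z₂, z ∈ S := mem_closure_iff_frequently.1 hz₂c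
  have hval : (c:ℂ) * z₂ - (H (q z₂) - conj (N (q z₂))) = 0 := by
    by_contra hne
    have h1 := hwc.eventually (isOpen_ne.mem_nhds hne)
    obtain ⟨z, hz, hz'⟩ := (hfreq.and_eventually h1).exists
    exact hz' (sub_eq_zero.2 hz.self_of_nhds)
  obtain ⟨g, n, A, B, hg0, hn0, hA0, hB0, hgc, hA, hB, hn, hν, hev, hinv⟩ :=
    exists_chart_comparison hD hC hz₂ c (sub_eq_zero.1 hval)
  have hcoord : ContinuousAt (fun z => h z - h z₂) z₂ :=
    (hD.hasFDerivAt_coord z₂ hz₂).continuousAt.sub continuousAt_const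
  have htend : Tendsto (fun z => h z - h z₂) (𝓝 z₂) (𝓝 0) := by
    simpa using hcoord.tendsto
  -- near every chart point over `S` the derivative of `A` vanishes
  have hder0 : ∀ᶠ ζ in 𝓝 0, g ζ ∈ S → deriv A ζ = 0 := by
    filter_upwards [hev.eventually_nhds] with ζ hζ hgS
    have hζ' := hζ.self_of_nhds
    have h1 : ∀ᶠ ζ' in 𝓝 ζ, A ζ' - conj (B ζ') = 0 := by
      filter_upwards [hζ, hζ'.2.2.2.2.2.2.1.eventually hgS] with ζ' h1 h2
      rw [← h1.2.2.2.2.2.2.2, h2, sub_self]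
    have hdA := hζ'.2.2.2.1
    have hdB := hζ'.2.2.2.2.1
    have h2 := (hdA.hasFDerivAt.restrictScalars ℝ).sub
      (Complex.conjCLE.toContinuousLinearMap.hasFDerivAt.comp ζ
        (hdB.hasFDerivAt.restrictScalars ℝ))
    have h3 : HasFDerivAt (fun ζ => A ζ - conj (B ζ)) (0 : ℂ →L[ℝ] ℂ) ζ :=
      (hasFDerivAt_const (0:ℂ) ζ).congr_of_eventuallyEq h1
    have h4 := congrArg (fun L : ℂ →L[ℝ] ℂ => L 1) (HasFDerivAt.unique h2 h3)
    rw [hdA.deriv]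
    refine eq_zero_of_sub_conj_mul_eq_zero (μ := q (g ζ) ^ 2) ?_ ?_
    · rw [norm_pow]
      exact pow_lt_one₀ (norm_nonneg _) (hD.norm_lt _ hζ'.1) two_ne_zero
    · simpa using h4
  have hzero : ∀ᶠ ζ in 𝓝 0, deriv A ζ = 0 := by
    rcases hA.deriv.eventually_eq_zero_or_eventually_ne_zero with h1 | h1
    · exact h1
    · exfalso
      rw [eventually_nhdsWithin_iff] at h1
      have h2 := htend.eventually (h1.and hder0)
      have h3 := (h2.and hinv).eventually_nhds
      obtain ⟨z, hzS, hz⟩ := (hfreq.and_eventually h3).exists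
      have hS' : ∀ᶠ z' in 𝓝 z, z' ∈ S := hSo.mem_nhds hzS
      have hpt : ∀ᶠ z' in 𝓝 z, z' = z₂ := by
        filter_upwards [hS', hz] with z' h4 h5
        by_contra hne
        have h6 : deriv A (h z' - h z₂) = 0 := h5.1.2 (by rw [h5.2]; exact h4)
        refine h5.1.1 ?_ h6
        intro h7
        have h8 := h5.2
        rw [h7, hg0] at h8
        exact hne h8.symm
      have hz2 := hpt.self_of_nhds
      subst hz2
      obtain ⟨z', hz', hz'2⟩ := ((mem_closure_iff_frequently.1
        (by rw [closure_compl_singleton]; trivial : z ∈ closure ({z}ᶜ : Set ℂ))).and_eventually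
          hpt).exists
      exact hz' hz'2
  have hconst : ∀ {C : ℂ → ℂ}, AnalyticAt ℂ C 0 → C 0 = 0 → (∀ᶠ ζ in 𝓝 0, deriv C ζ = 0) →
      ∀ᶠ ζ in 𝓝 0, C ζ = 0 := by
    intro C hC hC0 h1
    have h2 := hC.analyticOrderAt_deriv_add_one
    rw [analyticOrderAt_eq_top.2 h1] at h2
    simp only [hC0, sub_zero, top_add] at h2
    exact analyticOrderAt_eq_top.1 h2.symm
  have hAz := hconst hA hA0 hzero
  have hBz := hconst hB hB0 (by
    filter_upwards [hev, hzero] with ζ h1 h2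
    rw [h1.2.2.2.1.deriv] at h2
    rw [h1.2.2.2.2.1.deriv, h2, mul_zero])
  change ∀ᶠ z in 𝓝 z₂, _
  filter_upwards [hinv, htend.eventually hAz, htend.eventually hBz, htend.eventually hev]
    with z h1 h2 h3 h4
  have := h4.2.2.2.2.2.2.2
  rw [h1, h2, h3, map_zero, sub_zero, sub_eq_zero] at this
  exact this

end

section

variable {q h Q H N p : ℂ → ℂ}

lemma continuousAt_comparison (hD : IsothermalData q h Q) (hC : ComparisonMap H N p (q 0))
    {z : ℂ} (hz : z ∈ Metric.ball (0:ℂ) 1) :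
    ContinuousAt (fun z => H (q z) - conj (N (q z))) z := by
  have hqc : ContinuousAt q z := (hD.hasFDerivAt_gauss z hz).continuousAt
  have hqb : q z ∈ Metric.ball (0:ℂ) 1 := by simpa using hD.norm_lt _ hz
  have h1 : ContinuousAt (fun z => H (q z)) z :=
    ContinuousAt.comp (f := q) (hC.hasDerivAt_left _ hqb).continuousAt hqc
  have h2 : ContinuousAt (fun z => N (q z)) z :=
    ContinuousAt.comp (f := q) (hC.hasDerivAt_right _ hqb).continuousAt hqc
  exact h1.sub (Complex.continuous_conj.continuousAt.comp h2)

/-- If `p (q 0) * Q 0 = c` is real, the comparison map `w` satisfies `w z = c z + o(z)`. -/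
lemma hasFDerivAt_comparison (hD : IsothermalData q h Q) (hC : ComparisonMap H N p (q 0))
    {c : ℝ} (hc : p (q 0) * Q 0 = c) :
    HasFDerivAt (fun z => H (q z) - conj (N (q z)))
      (ContinuousLinearMap.mul ℝ ℂ (c : ℂ)) 0 := by
  have h0 : (0:ℂ) ∈ Metric.ball (0:ℂ) 1 := by simp
  have hqb : q 0 ∈ Metric.ball (0:ℂ) 1 := by simpa using hD.norm_lt _ h0
  have hq := hD.hasFDerivAt_gauss 0 h0
  have h1 := ((hC.hasDerivAt_left _ hqb).hasFDerivAt.restrictScalars ℝ).comp 0 hq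
  have h2 := ((hC.hasDerivAt_right _ hqb).hasFDerivAt.restrictScalars ℝ).comp 0 hq
  have h3 := h1.sub (Complex.conjCLE.toContinuousLinearMap.hasFDerivAt.comp 0 h2)
  have h4 : HasFDerivAt (fun z => H (q z) - conj (N (q z))) _ 0 := h3
  convert h4 using 1
  ext v
  have hinv := isoInv_isoForm (hD.norm_lt 0 h0) v
  have hcc : conj (p (q 0)) * conj (Q 0) = c := by rw [← map_mul, hc, Complex.conj_ofReal]
  simp only [ContinuousLinearMap.mul_apply', sub_apply,
    ContinuousLinearMap.comp_apply, ContinuousLinearMap.coe_restrictScalars',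
    ContinuousLinearEquiv.coe_coe, Complex.conjCLE_apply,
    ContinuousLinearMap.toSpanSingleton_apply, smul_eq_mul, map_mul, map_pow]
  conv_lhs => rw [← hinv, isoInv_apply]
  linear_combination (-isoForm (q 0) v) * hc +
    (conj (q 0) ^ 2 * conj (isoForm (q 0) v)) * hcc

/-- The comparison principle at a symmetric point. -/
theorem not_one_le_of_comparison (hD : IsothermalData q h Q) (hC : ComparisonMap H N p (q 0))
    {c : ℝ} (hc : p (q 0) * Q 0 = c) : c < 1 := by
  by_contra! hc1
  have h0 : (0:ℂ) ∈ Metric.ball (0:ℂ) 1 := by simp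
  set w : ℂ → ℂ := fun z => H (q z) - conj (N (q z)) with hw
  have hbound : ∀ z ∈ Metric.ball (0:ℂ) 1, ‖w z‖ ≤ 1 := fun z hz =>
    hC.norm_le _ (by simpa using hD.norm_lt _ hz)
  have hno : ∀ c' : ℝ, 1 ≤ c' → ∀ z₁ ∈ Metric.ball (0:ℂ) 1,
      ¬ ∀ᶠ z in 𝓝 z₁, (c' : ℂ) * z = w z := by
    intro c' hc' z₁ hz₁ hev
    have hall := eq_of_eventually_eq hD hC hz₁ c' hev
    obtain ⟨y, hy, hy'⟩ := hC.exists_not_mem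
    have hc0 : (c' : ℂ) ≠ 0 := by exact_mod_cast (by linarith : c' ≠ 0)
    have hmem : y / c' ∈ Metric.ball (0:ℂ) 1 := by
      rw [mem_ball_zero_iff] at hy ⊢
      rw [norm_div, Complex.norm_real, Real.norm_eq_abs, abs_of_pos (by linarith)]
      exact (div_le_self (norm_nonneg _) hc').trans_lt hy
    refine hy' _ (by simpa using hD.norm_lt _ hmem) ?_
    rw [← hall _ hmem]
    field_simp
  have hzero : (c : ℂ) * 0 = w 0 := by rw [mul_zero, hw]; exact hC.eq_zero.symm
  obtain ⟨c₁, hc₁, z₁, hz₁, hz₁0, hz₁w⟩ :=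
    (eventually_eq_or_exists_gt hD hC h0 c hzero fun _ => hc).resolve_left (hno c hc1 0 h0)
  have hε : 0 < (c₁ - c) / 2 := by linarith
  -- solutions with `c' ≥ c₁` stay away from the origin
  have hlin : ∀ᶠ z in 𝓝 (0:ℂ), ‖w z - c * z‖ ≤ (c₁ - c) / 2 * ‖z‖ := by
    have h1 := (hasFDerivAt_comparison hD hC hc).isLittleO.bound hε
    filter_upwards [h1] with z hz
    have hw0 : H (q 0) - conj (N (q 0)) = 0 := hC.eq_zero
    simpa [hw0, hw] using hz
  obtain ⟨δ, hδ, hδ'⟩ := Metric.eventually_nhds_iff.1 hlin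
  have hann : ∀ c' : ℝ, c₁ ≤ c' → ∀ z ∈ Metric.ball (0:ℂ) 1, z ≠ 0 → (c' : ℂ) * z = w z →
      δ ≤ ‖z‖ ∧ ‖z‖ ≤ 1 / c₁ := by
    intro c' hc' z hz hz0 hzw
    have hzpos := norm_pos_iff.2 hz0
    constructor
    · by_contra! hlt
      have h1 := hδ' (y := z) (by simpa using hlt)
      rw [← hzw, ← sub_mul, norm_mul, ← Complex.ofReal_sub, Complex.norm_real,
        Real.norm_eq_abs, abs_of_pos (by linarith)] at h1
      have := le_of_mul_le_mul_right h1 hzpos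
      linarith
    · have h1 := hbound z hz
      rw [← hzw, norm_mul, Complex.norm_real, Real.norm_eq_abs, abs_of_pos (by linarith)] at h1
      rw [le_div_iff₀ (by linarith)]
      nlinarith
  set K : Set ℂ := Metric.closedBall 0 (1 / c₁) ∩ {z | δ ≤ ‖z‖} with hK
  have hKc : IsCompact K :=
    (isCompact_closedBall _ _).inter_right (isClosed_le continuous_const continuous_norm)
  have hKball : K ⊆ Metric.ball (0:ℂ) 1 := by
    rintro z ⟨hz, -⟩
    rw [mem_closedBall_zero_iff] at hz
    rw [mem_ball_zero_iff]
    refine hz.trans_lt ?_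
    rw [div_lt_one (by linarith)]
    linarith
  have hK0 : ∀ z ∈ K, z ≠ 0 := by
    rintro z ⟨-, hz⟩ rfl
    simp only [mem_ofPred_eq, norm_zero] at hz
    linarith
  have hcont : ContinuousOn (fun z => w z / z) K := fun z hz =>
    ((continuousAt_comparison hD hC (hKball hz)).div continuousAt_id
      (hK0 z hz)).continuousWithinAt
  set T : Set ℂ := {x : ℂ | x.im = 0 ∧ c₁ ≤ x.re} with hT
  have hTc : IsClosed T :=
    (isClosed_eq Complex.continuous_im continuous_const).inter
      (isClosed_le continuous_const Complex.continuous_re)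
  have hK' : IsCompact (K ∩ (fun z => w z / z) ⁻¹' T) :=
    hKc.of_isClosed_subset (hcont.preimage_isClosed_of_isClosed hKc.isClosed hTc)
      inter_subset_left
  have hmemK' : ∀ c' : ℝ, c₁ ≤ c' → ∀ z ∈ Metric.ball (0:ℂ) 1, z ≠ 0 → (c' : ℂ) * z = w z →
      z ∈ K ∩ (fun z => w z / z) ⁻¹' T ∧ w z / z = c' := by
    intro c' hc' z hz hz0 hzw
    obtain ⟨h1, h2⟩ := hann c' hc' z hz hz0 hzw
    have h3 : w z / z = c' := by rw [← hzw]; field_simp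
    refine ⟨⟨⟨by simpa using h2, h1⟩, ?_⟩, h3⟩
    rw [mem_preimage, h3]
    exact ⟨Complex.ofReal_im _, by simpa using hc'⟩
  obtain ⟨z, hz, hmax⟩ := hK'.exists_isMaxOn ⟨z₁, (hmemK' c₁ le_rfl z₁ hz₁ hz₁0 hz₁w).1⟩
    (Complex.continuous_re.comp_continuousOn (hcont.mono inter_subset_left))
  have hz0 := hK0 z hz.1
  set m : ℝ := (w z / z).re with hm
  have hmc : c₁ ≤ m := hz.2.2
  have hzw : (m : ℂ) * z = w z := by
    have : w z / z = m := Complex.ext (by simp [hm]) (by simpa using hz.2.1)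
    rw [← this]
    field_simp
  obtain ⟨c₂, hc₂, z₂, hz₂, hz₂0, hz₂w⟩ :=
    (eventually_eq_or_exists_gt hD hC (hKball hz.1) m hzw fun h => absurd h hz0).resolve_left
      (hno m (by linarith) z (hKball hz.1))
  obtain ⟨h1, h2⟩ := hmemK' c₂ (by linarith) z₂ hz₂ hz₂0 hz₂w
  have h3 : (w z₂ / z₂).re ≤ m := hmax h1
  rw [h2, Complex.ofReal_re] at h3
  linarith

end

lemma isoForm_eq_smul (q : ℂ) : isoForm q =
    (1 - q ^ 2 * conj q ^ 2)⁻¹ • ContinuousLinearMap.id ℝ ℂ +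
      ((1 - q ^ 2 * conj q ^ 2)⁻¹ * conj q ^ 2) • Complex.conjCLE.toContinuousLinearMap := by
  ext v
  rw [isoForm_apply, Complex.ofReal_sub, ofReal_norm_pow_four]
  simp
  ring

lemma one_sub_sq_mul_conj_sq_ne_zero {q : ℂ} (hq : ‖q‖ < 1) : 1 - q ^ 2 * conj q ^ 2 ≠ 0 := by
  rw [← ofReal_norm_pow_four]
  exact_mod_cast (one_sub_norm_pow_four_pos hq).ne'

/-- A map with `dq = Q Λ_q` has an isothermal coordinate. -/
lemma exists_isothermalData {q Q : ℂ → ℂ} (hq : ∀ z ∈ Metric.ball (0:ℂ) 1, ‖q z‖ < 1)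
    (hdq : ∀ z ∈ Metric.ball (0:ℂ) 1,
      HasFDerivAt q ((ContinuousLinearMap.mul ℝ ℂ (Q z)).comp (isoForm (q z))) z) :
    ∃ h, IsothermalData q h Q := by
  suffices ∃ h, ∀ z ∈ Metric.ball (0:ℂ) 1, HasFDerivAt h (isoForm (q z)) z by
    obtain ⟨h, hh⟩ := this
    exact ⟨h, hq, hh, hdq⟩
  have hconj : ∀ z ∈ Metric.ball (0:ℂ) 1, HasFDerivAt (fun z => conj (q z))
      (Complex.conjCLE.toContinuousLinearMap.comp
        ((ContinuousLinearMap.mul ℝ ℂ (Q z)).comp (isoForm (q z)))) z := fun z hz =>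
    Complex.conjCLE.toContinuousLinearMap.hasFDerivAt.comp z (hdq z hz)
  have hdiff : DifferentiableOn ℝ (fun z => isoForm (q z)) (Metric.ball (0:ℂ) 1) := by
    intro z hz
    have h1 := (hdq z hz).differentiableAt
    have h2 := (hconj z hz).differentiableAt
    have h3 : DifferentiableAt ℝ (fun z => (1 - q z ^ 2 * conj (q z) ^ 2)⁻¹) z :=
      DifferentiableAt.inv (by fun_prop) (one_sub_sq_mul_conj_sq_ne_zero (hq z hz))
    simp only [isoForm_eq_smul]
    exact ((h3.smul_const _).add ((h3.mul (h2.pow 2)).smul_const _)).differentiableWithinAt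
  refine (convex_ball (0:ℂ) 1).exists_forall_hasFDerivAt_of_fderiv_symmetric
    Metric.isOpen_ball hdiff ?_
  intro z hz
  have hz1 := one_sub_sq_mul_conj_sq_ne_zero (hq z hz)
  have hω := (hdiff z hz).differentiableAt (Metric.isOpen_ball.mem_nhds hz)
  have key : ∀ X Y : ℂ, fderiv ℝ (fun z => isoForm (q z)) z (isoInv (q z) X) (isoInv (q z) Y) =
      (2 * conj (q z) * conj (Q z) * conj X * conj Y
        + 2 * q z * conj (q z) ^ 2 * Q z * X * Y) / (1 - q z ^ 2 * conj (q z) ^ 2) := by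
    intro X Y
    set y := isoInv (q z) Y with hy
    set x := isoInv (q z) X with hx
    have h1 : HasFDerivAt (fun z => isoForm (q z) y)
        ((ContinuousLinearMap.apply ℝ ℂ y).comp (fderiv ℝ (fun z => isoForm (q z)) z)) z :=
      (ContinuousLinearMap.apply ℝ ℂ y).hasFDerivAt.comp z hω.hasFDerivAt
    have hden : HasFDerivAt (𝕜 := ℝ) (fun z => 1 - q z ^ 2 * conj (q z) ^ 2) _ z :=
      (((hdq z hz).pow 2).mul ((hconj z hz).pow 2)).const_sub 1
    have hnum : HasFDerivAt (𝕜 := ℝ) (fun z => y + conj (q z) ^ 2 * conj y) _ z :=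
      (((hconj z hz).pow 2).mul_const (conj y)).const_add y
    have hquot : HasFDerivAt (𝕜 := ℝ)
        (fun z => (y + conj (q z) ^ 2 * conj y) * (1 - q z ^ 2 * conj (q z) ^ 2)⁻¹) _ z :=
      hnum.mul ((hasDerivAt_inv hz1).hasFDerivAt.restrictScalars ℝ |>.comp z hden)
    have hform : (fun z => isoForm (q z) y) =
        fun z => (y + conj (q z) ^ 2 * conj y) * (1 - q z ^ 2 * conj (q z) ^ 2)⁻¹ := by
      funext z
      rw [isoForm_apply, Complex.ofReal_sub, ofReal_norm_pow_four, mul_comm]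
      simp
    rw [hform] at h1
    have h3 := congrArg (fun L : ℂ →L[ℝ] ℂ => L x) (h1.unique hquot)
    simp only [ContinuousLinearMap.comp_apply, ContinuousLinearMap.apply_apply] at h3
    rw [h3]
    have hX : isoForm (q z) x = X := isoForm_isoInv (hq z hz) X
    simp [hX]
    rw [hy, isoInv_apply]
    simp
    generalize hden_eq : 1 - q z ^ 2 * conj (q z) ^ 2 = k at hz1 ⊢
    field_simp
    rw [← hden_eq]
    ring
  intro x y
  have h1 := key (isoForm (q z) x) (isoForm (q z) y)
  have h2 := key (isoForm (q z) y) (isoForm (q z) x)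
  rw [isoInv_isoForm (hq z hz), isoInv_isoForm (hq z hz)] at h1 h2
  rw [h1, h2]
  ring

/-- The (stereographically projected) Gauss map, as a function of the complex gradient
`c = f_u - i f_v`. -/
noncomputable def gaussOfGrad (c : ℂ) : ℂ := c / (1 + √(1 + c.re ^ 2 + c.im ^ 2) : ℝ)

lemma one_le_sqrt_grad (c : ℂ) : 1 ≤ √(1 + c.re ^ 2 + c.im ^ 2) :=
  Real.one_le_sqrt.2 (by nlinarith [sq_nonneg c.re, sq_nonneg c.im])

lemma norm_gaussOfGrad_sq (c : ℂ) :
    ‖gaussOfGrad c‖ ^ 2 = (√(1 + c.re ^ 2 + c.im ^ 2) - 1) / (√(1 + c.re ^ 2 + c.im ^ 2) + 1) := by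
  have h1 := one_le_sqrt_grad c
  have h2 : √(1 + c.re ^ 2 + c.im ^ 2) ^ 2 = 1 + c.re ^ 2 + c.im ^ 2 :=
    Real.sq_sqrt (by positivity)
  have h3 : ‖c‖ ^ 2 = c.re ^ 2 + c.im ^ 2 := by
    rw [← Complex.normSq_eq_norm_sq, Complex.normSq_apply]; ring
  rw [gaussOfGrad, norm_div, Complex.norm_real, Real.norm_eq_abs, abs_of_pos (by linarith), div_pow,
    h3]
  generalize √(1 + c.re ^ 2 + c.im ^ 2) = W at *
  have : c.re ^ 2 + c.im ^ 2 = W ^ 2 - 1 := by linarith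
  rw [this]
  have : (1 + W) ≠ 0 := by linarith
  field_simp
  ring

lemma norm_gaussOfGrad_lt_one (c : ℂ) : ‖gaussOfGrad c‖ < 1 := by
  have h1 := one_le_sqrt_grad c
  have h2 : ‖gaussOfGrad c‖ ^ 2 < 1 := by
    rw [norm_gaussOfGrad_sq, div_lt_one (by linarith)]
    linarith
  nlinarith [norm_nonneg (gaussOfGrad c)]

/-- The differential of the Gauss map of a minimal graph is complex linear in the isothermal
coordinate. -/
lemma hasFDerivAt_gaussOfGrad {c : ℂ → ℂ} {z A : ℂ} {B : ℝ}
    (hc : HasFDerivAt c (A • ContinuousLinearMap.id ℝ ℂ +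
      (B : ℂ) • Complex.conjCLE.toContinuousLinearMap) z)
    (hB : (2 + (c z).re ^ 2 + (c z).im ^ 2) * B = (conj (c z) ^ 2 * A).re) :
    HasFDerivAt (fun z => gaussOfGrad (c z))
      ((ContinuousLinearMap.mul ℝ ℂ
        ((1 - ‖gaussOfGrad (c z)‖ ^ 2) / (2 * (1 + ‖gaussOfGrad (c z)‖ ^ 2)) *
          (A - 2 * B * gaussOfGrad (c z) ^ 2 + gaussOfGrad (c z) ^ 4 * conj A))).comp
        (isoForm (gaussOfGrad (c z)))) z := by
  set q := gaussOfGrad (c z) with hq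
  have hq1 : ‖q‖ < 1 := norm_gaussOfGrad_lt_one _
  have hre := Complex.reCLM.hasFDerivAt.comp z hc
  have him := Complex.imCLM.hasFDerivAt.comp z hc
  have hW1 := one_le_sqrt_grad (c z)
  have hWsq : √(1 + (c z).re ^ 2 + (c z).im ^ 2) ^ 2 = 1 + (c z).re ^ 2 + (c z).im ^ 2 :=
    Real.sq_sqrt (by positivity)
  have hρ := norm_gaussOfGrad_sq (c z)
  rw [← hq] at hρ
  have hW : HasFDerivAt (𝕜 := ℝ) (fun z => √(1 + (c z).re ^ 2 + (c z).im ^ 2)) _ z :=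
    (((hre.pow 2).const_add 1).add (him.pow 2)).sqrt
      (by
        have : 0 < 1 + (c z).re ^ 2 + (c z).im ^ 2 := by positivity
        exact this.ne')
  have hden : HasFDerivAt (𝕜 := ℝ)
      (fun z => ((1 + √(1 + (c z).re ^ 2 + (c z).im ^ 2) : ℝ) : ℂ)) _ z :=
    Complex.ofRealCLM.hasFDerivAt.comp z (hW.const_add 1)
  have hden0 : ((1 + √(1 + (c z).re ^ 2 + (c z).im ^ 2) : ℝ) : ℂ) ≠ 0 := by
    exact_mod_cast (by linarith : 1 + √(1 + (c z).re ^ 2 + (c z).im ^ 2) ≠ 0)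
  have hquot : HasFDerivAt (𝕜 := ℝ) (fun z => c z *
      ((1 + √(1 + (c z).re ^ 2 + (c z).im ^ 2) : ℝ) : ℂ)⁻¹) _ z :=
    hc.mul ((hasDerivAt_inv hden0).hasFDerivAt.restrictScalars ℝ |>.comp z hden)
  have hfun : (fun z => gaussOfGrad (c z)) = fun z => c z *
      ((1 + √(1 + (c z).re ^ 2 + (c z).im ^ 2) : ℝ) : ℂ)⁻¹ := by
    funext z
    rw [gaussOfGrad, div_eq_mul_inv]
  rw [hfun]
  convert hquot using 1
  ext v
  set W := √(1 + (c z).re ^ 2 + (c z).im ^ 2) with hWdef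
  -- everything in terms of `q`
  set u := isoForm q v with hu
  have hv : v = u - conj q ^ 2 * conj u := by
    rw [← isoInv_apply, hu, isoInv_isoForm hq1]
  have hρ1 : ‖q‖ ^ 2 < 1 := by nlinarith [norm_nonneg q]
  have hW' : W = (1 + ‖q‖ ^ 2) / (1 - ‖q‖ ^ 2) := by
    rw [eq_div_iff (by linarith)]
    rw [eq_div_iff (by linarith)] at hρ
    nlinarith
  have hWq : 1 + W = 2 / (1 - ‖q‖ ^ 2) := by
    rw [hW', eq_div_iff (by linarith)]
    have : 1 - ‖q‖ ^ 2 ≠ 0 := by linarith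
    field_simp
    ring
  have hρc : ((‖q‖ ^ 2 : ℝ) : ℂ) = q * conj q := by
    rw [Complex.mul_conj, Complex.normSq_eq_norm_sq]
  have hk0 : (1 - q * conj q : ℂ) ≠ 0 := by
    rw [← hρc]; exact_mod_cast (by linarith : 1 - ‖q‖ ^ 2 ≠ 0)
  have hk1 : (1 + q * conj q : ℂ) ≠ 0 := by
    rw [← hρc]; exact_mod_cast (by positivity : 1 + ‖q‖ ^ 2 ≠ 0)
  have hcq : c z = 2 * q / (1 - q * conj q) := by
    have : c z = q * ((1 + W : ℝ) : ℂ) := by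
      rw [hq, gaussOfGrad, ← hWdef, div_mul_cancel₀ _ hden0]
    rw [this, hWq]
    push_cast
    rw [← hρc]
    push_cast
    ring
  have hcqc : conj (c z) = 2 * conj q / (1 - q * conj q) := by
    rw [hcq]
    simp only [map_div₀, map_mul, map_sub, map_one, map_ofNat, Complex.conj_conj]
    rw [mul_comm (conj q) q]
  have hWc : (W : ℂ) = (1 + q * conj q) / (1 - q * conj q) := by
    rw [hW', ← hρc]; push_cast; ring
  have hWqc : ((1 + W : ℝ) : ℂ) = 2 / (1 - q * conj q) := by
    rw [hWq, ← hρc]; push_cast; ring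
  have hre2 : ∀ x : ℂ, ((x.re : ℝ) : ℂ) = (x + conj x) / 2 := fun x => by
    rw [Complex.add_conj]; push_cast; ring
  have hMSE : (1 + q ^ 2 * conj q ^ 2) * (B : ℂ) = conj q ^ 2 * A + q ^ 2 * conj A := by
    have h1 : (((2 + (c z).re ^ 2 + (c z).im ^ 2) * B : ℝ) : ℂ) = ((conj (c z) ^ 2 * A).re : ℝ) := by
      rw [hB]
    have h2 : (((c z).re ^ 2 + (c z).im ^ 2 : ℝ) : ℂ) = c z * conj (c z) := by
      rw [Complex.mul_conj, Complex.normSq_apply]; push_cast; ring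
    rw [hre2, add_assoc] at h1
    push_cast at h1 h2
    rw [h2, map_mul, map_pow, Complex.conj_conj, hcq, map_div₀] at h1
    simp only [map_mul, map_sub, map_one, Complex.conj_conj, map_ofNat] at h1
    rw [mul_comm (conj q) q] at h1
    field_simp at h1
    linear_combination h1
  -- the real part appearing in the differential of `W`
  have hReal : ∀ x : ℂ, ((2 * (c z).re * x.re + 2 * (c z).im * x.im : ℝ) : ℂ) =
      conj (c z) * x + c z * conj x := by
    intro x
    apply Complex.ext <;> simp <;> ring
  set x : ℂ := A * v + B * conj v with hx
  have hval : (1 - ‖q‖ ^ 2) / (2 * (1 + ‖q‖ ^ 2)) *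
      (A - 2 * B * q ^ 2 + q ^ 4 * conj A) * u = c z * ((((1 / (2 * W)) *
        (2 * (c z).re * x.re + 2 * (c z).im * x.im) : ℝ) : ℂ) * -(((1 + W : ℝ) : ℂ) ^ 2)⁻¹) +
      ((1 + W : ℝ) : ℂ)⁻¹ * x := by
    have hxc : conj x = conj A * conj v + B * v := by simp [hx]
    rw [Complex.ofReal_mul, hReal, hWqc, hxc]
    push_cast
    rw [hWc, hcqc, hcq]
    rw [Complex.ofReal_pow] at hρc
    rw [hρc, hx, hv]
    simp only [map_sub, map_mul, map_pow, Complex.conj_conj]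
    generalize conj q = r at *
    generalize conj u = w at *
    generalize conj A = Z at *
    linear_combination (norm := (field_simp; ring))
      (-(w * (1 - q * r) / (2 * (1 + q * r)))) * hMSE
  refine Eq.trans ?_ (hval.trans ?_)
  · simp [hu]
  · simp [hx]
    rw [← hWdef]
    ring

lemma isOpen_unitDisk : IsOpen unitDisk :=
  isOpen_lt (by fun_prop) continuous_const

lemma mem_unitDisk_iff (z : ℂ) : (z.re, z.im) ∈ unitDisk ↔ z ∈ Metric.ball (0:ℂ) 1 := by
  rw [mem_ball_zero_iff, ← sq_lt_one_iff₀ (norm_nonneg z), ← Complex.normSq_eq_norm_sq,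
    Complex.normSq_apply]
  simp [unitDisk, sq]

section SecondDerivatives

variable {f : ℝ × ℝ → ℝ} {U : Set (ℝ × ℝ)} {x : ℝ × ℝ}

lemma hasFDerivAt_lineDeriv (hU : IsOpen U) (hf : ContDiffOn ℝ 2 f U) (hx : x ∈ U)
    (w : ℝ × ℝ) :
    HasFDerivAt (fun y => lineDeriv ℝ f y w) ((fderiv ℝ (fderiv ℝ f) x).flip w) x := by
  have h1 : ∀ y ∈ U, ContDiffAt ℝ 2 f y := fun y hy => hf.contDiffAt (hU.mem_nhds hy)
  have h2 : DifferentiableAt ℝ (fderiv ℝ f) x :=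
    ((h1 x hx).fderiv_right (m := 1) (by norm_num)).differentiableAt (by norm_num)
  have h3 : HasFDerivAt (fun y => fderiv ℝ f y w) ((fderiv ℝ (fderiv ℝ f) x).flip w) x := by
    refine (h2.hasFDerivAt.clm_apply (hasFDerivAt_const w x)).congr_fderiv ?_
    ext <;> simp
  refine h3.congr_of_eventuallyEq ?_
  filter_upwards [hU.mem_nhds hx] with y hy
  exact ((h1 y hy).differentiableAt (by norm_num)).lineDeriv_eq_fderiv

lemma lineDeriv_lineDeriv (hU : IsOpen U) (hf : ContDiffOn ℝ 2 f U) (hx : x ∈ U)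
    (v w : ℝ × ℝ) :
    lineDeriv ℝ (fun y => lineDeriv ℝ f y w) x v = fderiv ℝ (fderiv ℝ f) x v w := by
  rw [(hasFDerivAt_lineDeriv hU hf hx w).differentiableAt.lineDeriv_eq_fderiv,
    (hasFDerivAt_lineDeriv hU hf hx w).fderiv]
  simp

lemma fderiv_fderiv_comm (hU : IsOpen U) (hf : ContDiffOn ℝ 2 f U) (hx : x ∈ U)
    (v w : ℝ × ℝ) :
    fderiv ℝ (fderiv ℝ f) x v w = fderiv ℝ (fderiv ℝ f) x w v :=
  ((hf.contDiffAt (hU.mem_nhds hx)).isSymmSndFDerivAt (by simp)).eq v w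

/-- The Hessian as a bilinear form, in terms of the second partial derivatives. -/
lemma fderiv_fderiv_apply (hU : IsOpen U) (hf : ContDiffOn ℝ 2 f U) (hx : x ∈ U)
    (v w : ℝ × ℝ) :
    fderiv ℝ (fderiv ℝ f) x v w = pdu (pdu f) x * (v.1 * w.1) +
      pdv (pdu f) x * (v.1 * w.2 + v.2 * w.1) + pdv (pdv f) x * (v.2 * w.2) := by
  have e1 : pdu (pdu f) x = fderiv ℝ (fderiv ℝ f) x (1, 0) (1, 0) :=
    lineDeriv_lineDeriv hU hf hx _ _
  have e2 : pdv (pdu f) x = fderiv ℝ (fderiv ℝ f) x (0, 1) (1, 0) :=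
    lineDeriv_lineDeriv hU hf hx _ _
  have e3 : pdv (pdv f) x = fderiv ℝ (fderiv ℝ f) x (0, 1) (0, 1) :=
    lineDeriv_lineDeriv hU hf hx _ _
  have e4 := fderiv_fderiv_comm hU hf hx (1, 0) (0, 1)
  have hv : v = v.1 • ((1:ℝ), (0:ℝ)) + v.2 • ((0:ℝ), (1:ℝ)) := by ext <;> simp
  have hw : w = w.1 • ((1:ℝ), (0:ℝ)) + w.2 • ((0:ℝ), (1:ℝ)) := by ext <;> simp
  rw [e1, e2, e3]
  conv_lhs => rw [hv, hw]
  simp only [map_add, map_smul, add_apply, smul_apply,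
    smul_eq_mul, e4]
  ring

end SecondDerivatives

/-- The complex gradient `f_u - i f_v`. -/
noncomputable def complexGrad (f : ℝ × ℝ → ℝ) (z : ℂ) : ℂ :=
  ⟨pdu f (z.re, z.im), -pdv f (z.re, z.im)⟩

lemma hasFDerivAt_complexGrad {f : ℝ × ℝ → ℝ} (hf : ContDiffOn ℝ 2 f unitDisk) {z : ℂ}
    (hz : z ∈ Metric.ball (0:ℂ) 1) :
    HasFDerivAt (complexGrad f)
      ((⟨(pdu (pdu f) (z.re, z.im) - pdv (pdv f) (z.re, z.im)) / 2,
          -pdv (pdu f) (z.re, z.im)⟩ : ℂ) • ContinuousLinearMap.id ℝ ℂ +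
        (((pdu (pdu f) (z.re, z.im) + pdv (pdv f) (z.re, z.im)) / 2 : ℝ) : ℂ) •
          Complex.conjCLE.toContinuousLinearMap) z := by
  have hx := (mem_unitDisk_iff z).2 hz
  have hpair : HasFDerivAt (fun z : ℂ => (z.re, z.im))
      (Complex.reCLM.prod Complex.imCLM) z :=
    (Complex.reCLM.prod Complex.imCLM).hasFDerivAt
  have hu := (hasFDerivAt_lineDeriv isOpen_unitDisk hf hx (1, 0)).comp z hpair
  have hv := (hasFDerivAt_lineDeriv isOpen_unitDisk hf hx (0, 1)).comp z hpair
  have hc := (Complex.ofRealCLM.hasFDerivAt.comp z hu).sub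
    ((Complex.ofRealCLM.hasFDerivAt.comp z hv).const_mul Complex.I)
  refine (hc.congr_of_eventuallyEq (Eventually.of_forall fun y => ?_)).congr_fderiv ?_
  · apply Complex.ext <;> simp [complexGrad, pdu, pdv]
  · ext v
    apply Complex.ext <;>
      simp [fderiv_fderiv_apply isOpen_unitDisk hf hx, -Complex.ofReal_add, -Complex.ofReal_div] <;>
      ring

lemma exists_isothermalData_of_minimal {f : ℝ × ℝ → ℝ} (hf : ContDiffOn ℝ 2 f unitDisk)
    (hM : MinimalSurfaceEq f unitDisk) :
    ∃ h Q, IsothermalData (fun z => gaussOfGrad (complexGrad f z)) h Q ∧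
      Q 0 = (1 - ‖gaussOfGrad (complexGrad f 0)‖ ^ 2) /
          (2 * (1 + ‖gaussOfGrad (complexGrad f 0)‖ ^ 2)) *
        ((⟨(pdu (pdu f) (0, 0) - pdv (pdv f) (0, 0)) / 2, -pdv (pdu f) (0, 0)⟩ : ℂ) -
          2 * ((pdu (pdu f) (0, 0) + pdv (pdv f) (0, 0)) / 2 : ℝ) *
            gaussOfGrad (complexGrad f 0) ^ 2 +
          gaussOfGrad (complexGrad f 0) ^ 4 *
            conj (⟨(pdu (pdu f) (0, 0) - pdv (pdv f) (0, 0)) / 2, -pdv (pdu f) (0, 0)⟩ : ℂ)) := by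
  obtain ⟨h, hh⟩ := exists_isothermalData (fun z _ => norm_gaussOfGrad_lt_one (complexGrad f z))
    (fun z hz => hasFDerivAt_gaussOfGrad (hasFDerivAt_complexGrad hf hz) (by
      have := hM _ ((mem_unitDisk_iff z).2 hz)
      simp [complexGrad, pow_two] at this ⊢
      linear_combination this))
  exact ⟨h, _, hh, by simp only [Complex.zero_re, Complex.zero_im]⟩

namespace ComparisonMap

variable {H N p : ℂ → ℂ} {q₀ : ℂ}

lemma neg (hC : ComparisonMap H N p q₀) :
    ComparisonMap (fun x => -H x) (fun x => -N x) (fun x => -p x) q₀ where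
  hasDerivAt_left x hx := (hC.hasDerivAt_left x hx).neg
  hasDerivAt_right x hx := (hC.hasDerivAt_right x hx).neg.congr_deriv (by ring)
  norm_le x hx := by
    rw [map_neg, sub_neg_eq_add, neg_add_eq_sub, norm_sub_rev]
    exact hC.norm_le x hx
  eq_zero := by
    rw [map_neg, sub_neg_eq_add, neg_add_eq_sub, ← neg_sub, hC.eq_zero, neg_zero]
  exists_not_mem := by
    obtain ⟨y, hy, hy'⟩ := hC.exists_not_mem
    refine ⟨-y, by simpa using hy, fun x hx h => hy' x hx ?_⟩
    rw [← neg_eq_iff_eq_neg] at h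
    rw [← h, map_neg]
    ring

lemma rotate (hC : ComparisonMap H N p q₀) {E : ℂ} (hE : ‖E‖ = 1) :
    ComparisonMap (fun x => E * H (E * x)) (fun x => conj E * N (E * x))
      (fun x => E ^ 2 * p (E * x)) (conj E * q₀) := by
  have hEE : E * conj E = 1 := by
    rw [Complex.mul_conj, Complex.normSq_eq_norm_sq, hE]; simp
  have hmem : ∀ x ∈ Metric.ball (0:ℂ) 1, E * x ∈ Metric.ball (0:ℂ) 1 := fun x hx => by
    simpa [hE] using hx
  have hfac : ∀ x, E * H x - conj (conj E * N x) = E * (H x - conj (N x)) := fun x => by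
    simp; ring
  have hmul : ∀ x : ℂ, HasDerivAt (fun x => E * x) E x := fun x => by
    simpa using (hasDerivAt_id x).const_mul E
  refine ⟨fun x hx => ?_, fun x hx => ?_, fun x hx => ?_, ?_, ?_⟩
  · have := (((hC.hasDerivAt_left _ (hmem x hx)).comp x (hmul x)).const_mul E)
    exact this.congr_deriv (by ring)
  · have := (((hC.hasDerivAt_right _ (hmem x hx)).comp x (hmul x)).const_mul (conj E))
    exact this.congr_deriv (by linear_combination (E ^ 2 * x ^ 2 * p (E * x)) * hEE)
  · rw [hfac, norm_mul, hE, one_mul]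
    exact hC.norm_le _ (hmem x hx)
  · rw [hfac, ← mul_assoc, hEE, one_mul, hC.eq_zero, mul_zero]
  · obtain ⟨y, hy, hy'⟩ := hC.exists_not_mem
    refine ⟨E * y, hmem y hy, fun x hx h => hy' _ (hmem x hx) ?_⟩
    rw [hfac] at h
    exact mul_left_cancel₀ (left_ne_zero_of_mul_eq_one hEE) h

end ComparisonMap

/-- A comparison map gives an upper bound for the curvature at a symmetric point. -/
lemma abs_gaussCurv_lt_of_comparison {f : ℝ × ℝ → ℝ} (hf : ContDiffOn ℝ 2 f unitDisk)
    (hM : MinimalSurfaceEq f unitDisk) {h : ℝ × ℝ} (hsym : IsSymmetricPt f (0, 0) h)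
    {τ P : ℝ} (hτ0 : 0 ≤ τ) (hτ1 : τ < 1)
    (hW : (1 + τ ^ 2) / (1 - τ ^ 2) = √(1 + (pdu f (0, 0)) ^ 2 + (pdv f (0, 0)) ^ 2))
    {H N p : ℂ → ℂ} (hC : ComparisonMap H N p τ) (hp : p τ = P) (hP : 0 < P) :
    |gaussCurv f (0, 0)| < (2 / (P * (1 + τ ^ 2) ^ 2)) ^ 2 := by
  obtain ⟨hh, hsym1, hsym2⟩ := hsym
  have h0 : ((0:ℝ), (0:ℝ)) ∈ unitDisk := by simp [unitDisk]
  have hdf : DifferentiableAt ℝ f (0, 0) :=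
    (hf.contDiffAt (isOpen_unitDisk.mem_nhds h0)).differentiableAt (by norm_num)
  rw [lineDeriv_lineDeriv isOpen_unitDisk hf h0,
    fderiv_fderiv_apply isOpen_unitDisk hf h0] at hsym2
  have hsym1' : h.1 * pdu f (0, 0) + h.2 * pdv f (0, 0) = 0 := by
    rw [hdf.lineDeriv_eq_fderiv] at hsym1
    rw [pdu, pdv, hdf.lineDeriv_eq_fderiv, hdf.lineDeriv_eq_fderiv, ← smul_eq_mul, ← smul_eq_mul,
      ← map_smul, ← map_smul, ← map_add]
    convert hsym1 using 2
    ext <;> simp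
  have hMSE := hM _ h0
  obtain ⟨c, Q, hD, hQ⟩ := exists_isothermalData_of_minimal hf hM
  rw [gaussCurv]
  have hgrad : complexGrad f 0 = ⟨pdu f (0, 0), -pdv f (0, 0)⟩ := rfl
  generalize pdu (pdu f) (0, 0) = r at *
  generalize pdv (pdu f) (0, 0) = s at *
  generalize pdv (pdv f) (0, 0) = t at *
  generalize pdu f (0, 0) = a at *
  generalize pdv f (0, 0) = b at *
  obtain ⟨x, y⟩ := h
  simp only at hh hsym1' hsym2
  -- the gradient is `g` times a unit vector `E`, with `g` nonnegative
  obtain ⟨e₁, e₂, g, hg, hee, ha, hb, hs⟩ : ∃ e₁ e₂ g : ℝ, 0 ≤ g ∧ e₁ ^ 2 + e₂ ^ 2 = 1 ∧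
      a = g * e₁ ∧ b = g * e₂ ∧ (r - t) * (e₁ * e₂) = s * (e₁ ^ 2 - e₂ ^ 2) := by
    have ha : a = (b * x - a * y) * (-y) := by linear_combination (-a) * hh + x * hsym1'
    have hb : b = (b * x - a * y) * x := by linear_combination (-b) * hh + y * hsym1'
    rcases le_total 0 (b * x - a * y) with hg | hg
    · exact ⟨-y, x, b * x - a * y, hg, by linear_combination hh, ha, hb,
        by linear_combination hsym2⟩
    · exact ⟨y, -x, -(b * x - a * y), by linarith, by linear_combination hh,
        by linear_combination ha, by linear_combination hb, by linear_combination hsym2⟩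
  have hτ2 : 0 < 1 - τ ^ 2 := by nlinarith
  have hgτ : g = 2 * τ / (1 - τ ^ 2) := by
    have h1 : ((1 + τ ^ 2) / (1 - τ ^ 2)) ^ 2 = 1 + g ^ 2 := by
      rw [hW, Real.sq_sqrt (by positivity), ha, hb]
      linear_combination g ^ 2 * hee
    have h2 : g ^ 2 = (2 * τ / (1 - τ ^ 2)) ^ 2 := by
      field_simp at h1 ⊢
      linarith
    exact (pow_left_inj₀ hg (by positivity) two_ne_zero).1 h2
  set E : ℂ := ⟨e₁, e₂⟩ with hE
  have hEE : E * conj E = 1 := by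
    apply Complex.ext <;> simp [hE]
    · linear_combination hee
    · ring
  have hEn : ‖E‖ = 1 := by
    have : ‖E‖ ^ 2 = 1 := by
      rw [← Complex.normSq_eq_norm_sq, Complex.normSq_apply]; linear_combination hee
    nlinarith [norm_nonneg E]
  have hq0 : gaussOfGrad (complexGrad f 0) = conj E * τ := by
    have hc : complexGrad f 0 = g * conj E := by
      rw [hgrad, ha, hb]
      apply Complex.ext <;> simp [hE]
    have hW' : √(1 + (complexGrad f 0).re ^ 2 + (complexGrad f 0).im ^ 2) =
        (1 + τ ^ 2) / (1 - τ ^ 2) := by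
      rw [hW, hgrad]
      simp
    rw [gaussOfGrad, hW', hc, hgτ]
    have : (1 - τ ^ 2 : ℂ) ≠ 0 := by exact_mod_cast hτ2.ne'
    have h2 : (1 + (1 + τ ^ 2) / (1 - τ ^ 2) : ℂ) = 2 / (1 - τ ^ 2) := by
      field_simp
      ring
    push_cast
    rw [h2]
    field_simp
  -- the second derivative in the direction orthogonal to the gradient
  set F : ℝ := r * e₂ ^ 2 - 2 * s * (e₁ * e₂) + t * e₁ ^ 2 with hF
  set G : ℝ := r * e₁ ^ 2 + 2 * s * (e₁ * e₂) + t * e₂ ^ 2 with hG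
  have hA : (⟨(r - t) / 2, -s⟩ : ℂ) = ((G - F) / 2 : ℝ) * conj E ^ 2 := by
    apply Complex.ext <;> simp [hE, hF, hG, pow_two, -Complex.ofReal_div, -Complex.ofReal_sub]
    · linear_combination 2 * e₁ * e₂ * hs - (r - t) / 2 * (e₁ ^ 2 + e₂ ^ 2 + 1) * hee
    · linear_combination (e₁ ^ 2 - e₂ ^ 2) * hs + s * (e₁ ^ 2 + e₂ ^ 2 + 1) * hee
  have hB : (r + t) / 2 = (F + G) / 2 := by
    rw [hF, hG]
    linear_combination (-(r + t) / 2) * hee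
  have hFG : (1 + g ^ 2) * F + G = 0 := by
    rw [hF, hG]
    rw [ha, hb] at hMSE
    linear_combination hMSE + (r + t) * hee
  have hdet : r * t - s ^ 2 = F * G := by
    rw [hF, hG]
    linear_combination (-(r * t - s ^ 2) * (e₁ ^ 2 + e₂ ^ 2 + 1)) * hee -
      ((r - t) * (e₁ * e₂) - s * (e₁ ^ 2 - e₂ ^ 2)) * hs
  have hGF : G = -F * (1 + τ ^ 2) ^ 2 / (1 - τ ^ 2) ^ 2 := by
    rw [hgτ] at hFG
    field_simp at hFG ⊢
    linear_combination hFG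
  clear_value E F G
  have hQ0 : Q 0 = (-(1 - τ ^ 4) * F / 2 : ℝ) * conj E ^ 2 := by
    have hn : ‖conj E * (τ : ℂ)‖ = τ := by
      rw [norm_mul, RCLike.norm_conj, hEn, one_mul, Complex.norm_real, Real.norm_of_nonneg hτ0]
    rw [hQ, hq0, hn, hA, hB, hGF]
    have h1 : (1 - τ ^ 2 : ℂ) ≠ 0 := by exact_mod_cast hτ2.ne'
    have h2 : (1 + τ ^ 2 : ℂ) ≠ 0 := by exact_mod_cast (by positivity : 1 + τ ^ 2 ≠ 0)
    push_cast
    simp only [map_mul, map_div₀, map_pow, map_sub, map_add, map_neg, Complex.conj_ofReal,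
      Complex.conj_conj, map_ofNat, map_one]
    have h4 : conj E ^ 4 * E ^ 2 = conj E ^ 2 := by
      linear_combination (conj E ^ 2) * (E * conj E + 1) * hEE
    generalize conj E = w at *
    linear_combination (norm := (field_simp; ring)) (1 - τ ^ 2 : ℂ) / (2 * (1 + τ ^ 2)) * τ ^ 4 *
      ((-F * (1 + τ ^ 2) ^ 2 / (1 - τ ^ 2) ^ 2 - F) / 2 : ℂ) * h4
  have hpE : E ^ 2 * p (E * (conj E * τ)) * ((-(1 - τ ^ 4) * F / 2 : ℝ) * conj E ^ 2) =
      ((P * (-(1 - τ ^ 4) * F / 2) : ℝ) : ℂ) := by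
    rw [← mul_assoc E, hEE, one_mul, hp]
    push_cast
    linear_combination (P * (-(1 - τ ^ 4) * F / 2) : ℂ) * (E * conj E + 1) * hEE
  have hlt : P * (-(1 - τ ^ 4) * F / 2) < 1 := by
    refine not_one_le_of_comparison hD (H := fun x => E * H (E * x))
      (N := fun x => conj E * N (E * x)) (p := fun x => E ^ 2 * p (E * x)) ?_ ?_
    · rw [hq0]
      exact hC.rotate hEn
    · rw [hq0, hQ0, hpE]
  have hgt : -(P * (-(1 - τ ^ 4) * F / 2)) < 1 := by
    refine not_one_le_of_comparison hD (H := fun x => -(E * H (E * x)))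
      (N := fun x => -(conj E * N (E * x))) (p := fun x => -(E ^ 2 * p (E * x))) ?_ ?_
    · rw [hq0]
      exact (hC.rotate hEn).neg
    · rw [hq0, hQ0, neg_mul, hpE, Complex.ofReal_neg]
  have hsq : (P * (-(1 - τ ^ 4) * F / 2)) ^ 2 < 1 := by nlinarith
  have hK : (r * t - s ^ 2) / (1 + a ^ 2 + b ^ 2) ^ 2 =
      -(F ^ 2 * (1 - τ ^ 2) ^ 2 / (1 + τ ^ 2) ^ 2) := by
    have h1 : 1 + a ^ 2 + b ^ 2 = (1 + τ ^ 2) ^ 2 / (1 - τ ^ 2) ^ 2 := by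
      rw [← div_pow, hW, Real.sq_sqrt (by positivity)]
    rw [hdet, h1, hGF]
    field_simp
  rw [hK, abs_neg, abs_of_nonneg (by positivity), div_pow, lt_div_iff₀ (by positivity)]
  calc F ^ 2 * (1 - τ ^ 2) ^ 2 / (1 + τ ^ 2) ^ 2 * (P * (1 + τ ^ 2) ^ 2) ^ 2
      = 4 * (P * (-(1 - τ ^ 4) * F / 2)) ^ 2 := by
        field_simp
        ring
    _ < 2 ^ 2 := by linarith

/-- The unit complex number `exp (-iφ)`. -/
noncomputable def expNeg (φ : ℝ) : ℂ := Complex.exp (-(φ * Complex.I))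

lemma norm_expNeg (φ : ℝ) : ‖expNeg φ‖ = 1 := by
  rw [expNeg, ← neg_mul, ← Complex.ofReal_neg, Complex.norm_exp_ofReal_mul_I]

lemma expNeg_ne_zero (φ : ℝ) : expNeg φ ≠ 0 := Complex.exp_ne_zero _

lemma expNeg_eq (φ : ℝ) : expNeg φ = cos φ - sin φ * Complex.I := by
  rw [expNeg, ← neg_mul, Complex.exp_mul_I]
  simp [sub_eq_add_neg]

lemma conj_expNeg (φ : ℝ) : conj (expNeg φ) = expNeg (-φ) := by
  simp only [expNeg, ← Complex.exp_conj, map_neg, map_mul, Complex.conj_I, Complex.conj_ofReal,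
    Complex.ofReal_neg]
  ring_nf

lemma expNeg_mul_conj (φ : ℝ) : expNeg φ * conj (expNeg φ) = 1 := by
  rw [Complex.mul_conj, Complex.normSq_eq_norm_sq, norm_expNeg]; simp

lemma expNeg_add (φ ψ : ℝ) : expNeg (φ + ψ) = expNeg φ * expNeg ψ := by
  simp only [expNeg, ← Complex.exp_add]
  push_cast
  ring_nf

lemma hasDerivAt_expNeg (φ : ℝ) : HasDerivAt expNeg (-Complex.I * expNeg φ) φ := by
  have h : HasDerivAt (fun x : ℝ => -((x : ℂ) * Complex.I)) (-(1 * Complex.I)) φ :=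
    ((Complex.ofRealCLM.hasDerivAt (x := φ)).mul_const Complex.I).neg
  exact h.cexp.congr_deriv (by rw [expNeg]; ring)

lemma one_sub_expNeg_mul_re_pos {q : ℂ} (hq : ‖q‖ < 1) (φ : ℝ) : 0 < (1 - expNeg φ * q).re := by
  have : (expNeg φ * q).re ≤ ‖q‖ := by
    simpa [norm_expNeg] using Complex.re_le_norm (expNeg φ * q)
  rw [Complex.sub_re, Complex.one_re]
  linarith

lemma one_sub_expNeg_mul_mem_slitPlane {q : ℂ} (hq : ‖q‖ < 1) (φ : ℝ) :
    1 - expNeg φ * q ∈ Complex.slitPlane :=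
  Or.inl (one_sub_expNeg_mul_re_pos hq φ)

lemma one_sub_expNeg_mul_ne_zero {q : ℂ} (hq : ‖q‖ < 1) (φ : ℝ) : 1 - expNeg φ * q ≠ 0 :=
  Complex.slitPlane_ne_zero (one_sub_expNeg_mul_mem_slitPlane hq φ)

/-- `π` times the harmonic measure, up to normalisation, of the arc ending at angle `φ`. -/
noncomputable def harmAngle (φ : ℝ) (q : ℂ) : ℝ := (1 - expNeg φ * q).arg + φ / 2

lemma hasDerivAt_log_one_sub {q : ℂ} (hq : ‖q‖ < 1) (φ : ℝ) :
    HasDerivAt (fun q => Complex.log (1 - expNeg φ * q))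
      (-expNeg φ / (1 - expNeg φ * q)) q := by
  have h : HasDerivAt (fun q => 1 - expNeg φ * q) (-expNeg φ) q := by
    simpa using ((hasDerivAt_id q).const_mul (expNeg φ)).const_sub 1
  exact h.clog (one_sub_expNeg_mul_mem_slitPlane hq φ)

lemma hasDerivAt_harmAngle {q : ℂ} (hq : ‖q‖ < 1) (φ : ℝ) :
    HasDerivAt (fun φ => harmAngle φ q)
      ((1 - ‖q‖ ^ 2) / (2 * ‖1 - expNeg φ * q‖ ^ 2)) φ := by
  have h1 : HasDerivAt (fun φ => Complex.log (1 - expNeg φ * q))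
      (Complex.I * expNeg φ * q / (1 - expNeg φ * q)) φ := by
    have h : HasDerivAt (fun φ => 1 - expNeg φ * q) (Complex.I * expNeg φ * q) φ :=
      (((hasDerivAt_expNeg φ).mul_const q).const_sub 1).congr_deriv (by ring)
    exact h.clog_real (one_sub_expNeg_mul_mem_slitPlane hq φ)
  have h2 := (Complex.imCLM.hasFDerivAt.comp_hasDerivAt φ h1).add
    ((hasDerivAt_id φ).div_const 2)
  refine (h2.congr_deriv ?_).congr_of_eventuallyEq (Eventually.of_forall fun x => ?_)
  · have h0 := one_sub_expNeg_mul_ne_zero hq φ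
    have hx : ‖q‖ = ‖expNeg φ * q‖ := by simp [norm_expNeg]
    rw [mul_assoc, hx]
    generalize expNeg φ * q = x at *
    have h4 : ((1 - x).re ^ 2 + (1 - x).im ^ 2) ≠ 0 := by
      rw [← Complex.sq_norm_sub_sq_re]
      simpa using h0
    rw [← Complex.normSq_eq_norm_sq, ← Complex.normSq_eq_norm_sq, Complex.normSq_apply,
      Complex.normSq_apply]
    simp [Complex.div_im, Complex.normSq_apply] at h4 ⊢
    field_simp
    ring
  · simp [harmAngle, Complex.log_im]

lemma strictMono_harmAngle {q : ℂ} (hq : ‖q‖ < 1) : StrictMono (fun φ => harmAngle φ q) := by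
  refine strictMono_of_hasDerivAt_pos (fun φ => hasDerivAt_harmAngle hq φ) fun φ => ?_
  have : 0 < ‖1 - expNeg φ * q‖ := norm_pos_iff.2 (one_sub_expNeg_mul_ne_zero hq φ)
  have : 0 < 1 - ‖q‖ ^ 2 := by nlinarith [norm_nonneg q]
  positivity

lemma expNeg_add_two_pi (φ : ℝ) : expNeg (φ + 2 * π) = expNeg φ := by
  simp [expNeg_eq]

lemma harmAngle_add_two_pi (φ : ℝ) (q : ℂ) : harmAngle (φ + 2 * π) q = harmAngle φ q + π := by
  rw [harmAngle, harmAngle, expNeg_add_two_pi]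
  ring

lemma cos_eq_one_sub_two_mul_sin_half_sq (χ : ℝ) : cos χ = 1 - 2 * sin (χ / 2) ^ 2 := by
  have h := Real.cos_two_mul (χ / 2)
  rw [mul_div_cancel₀ χ two_ne_zero] at h
  linarith [Real.sin_sq_add_cos_sq (χ / 2)]

lemma one_sub_expNeg_neg (χ : ℝ) :
    1 - expNeg (-χ) = ((2 * sin (χ / 2) : ℝ) : ℂ) *
      (cos ((χ - π) / 2) + sin ((χ - π) / 2) * Complex.I) := by
  have h1 : cos ((χ - π) / 2) = sin (χ / 2) := by rw [sub_div, Real.cos_sub_pi_div_two]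
  have h2 : sin ((χ - π) / 2) = -cos (χ / 2) := by rw [sub_div, Real.sin_sub_pi_div_two]
  have h3 := cos_eq_one_sub_two_mul_sin_half_sq χ
  have h4 : sin χ = 2 * sin (χ / 2) * cos (χ / 2) := by rw [← Real.sin_two_mul]; ring_nf
  rw [expNeg_eq, Real.cos_neg, Real.sin_neg, h1, h2, h3, h4]
  push_cast
  ring

lemma arg_one_sub_expNeg_neg {χ : ℝ} (h0 : 0 < χ) (h1 : χ < 2 * π) :
    (1 - expNeg (-χ)).arg = (χ - π) / 2 := by
  rw [one_sub_expNeg_neg, Complex.ofReal_cos, Complex.ofReal_sin]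
  refine Complex.arg_mul_cos_add_sin_mul_I ?_ ⟨by linarith, by linarith⟩
  have := Real.sin_pos_of_pos_of_lt_pi (x := χ / 2) (by linarith) (by linarith)
  linarith

lemma one_sub_expNeg_neg_re_pos {χ : ℝ} (h0 : 0 < χ) (h1 : χ < 2 * π) :
    0 < (1 - expNeg (-χ)).re := by
  have h2 := Real.sin_pos_of_pos_of_lt_pi (x := χ / 2) (by linarith) (by linarith)
  have h3 := cos_eq_one_sub_two_mul_sin_half_sq χ
  rw [expNeg_eq, Complex.sub_re, Complex.sub_re, Real.cos_neg, Complex.ofReal_re, h3]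
  simp
  positivity

/-- Boundary values of `harmAngle`. -/
lemma tendsto_harmAngle {φ ψ : ℝ} (h0 : φ < ψ) (h1 : ψ < φ + 2 * π) :
    Tendsto (harmAngle φ) (𝓝 (expNeg (-ψ))) (𝓝 ((ψ - π) / 2)) := by
  have h2 : expNeg φ * expNeg (-ψ) = expNeg (-(ψ - φ)) := by
    rw [← expNeg_add]; congr 1; ring
  have h3 : ContinuousAt (harmAngle φ) (expNeg (-ψ)) := by
    refine ContinuousAt.add (ContinuousAt.comp' (Complex.continuousAt_arg ?_) (by fun_prop))
      continuousAt_const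
    rw [h2]
    exact Or.inl (one_sub_expNeg_neg_re_pos (by linarith) (by linarith))
  have h4 : harmAngle φ (expNeg (-ψ)) = (ψ - π) / 2 := by
    rw [harmAngle, h2, arg_one_sub_expNeg_neg (by linarith) (by linarith)]
    ring
  rw [← h4]
  exact h3

/-- A closed polygon with vertices `v 0, …, v n = v 0` whose sides `v (k + 1) - v k` have signed
length `ℓ k` and direction `i exp (-i φ k)`, the angles `φ k` increasing and winding once, and with
vanishing total signed length. -/
structure PolygonData (n : ℕ) (φ ℓ : ℕ → ℝ) (v : ℕ → ℂ) : Prop where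
  lt_succ : ∀ k < n, φ k < φ (k + 1)
  period : φ n = φ 0 + 2 * π
  closed : v n = v 0
  side : ∀ k < n, v (k + 1) - v k = Complex.I * ℓ k * expNeg (φ k)
  sum_eq_zero : ∑ k ∈ Finset.range n, ℓ k = 0

/-- The harmonic extension to the unit disk of the step function with value `v (k + 1)` on the arc
between the angles `φ k` and `φ (k + 1)`. -/
noncomputable def polyMap (n : ℕ) (φ : ℕ → ℝ) (v : ℕ → ℂ) (q : ℂ) : ℂ :=
  ∑ k ∈ Finset.range n, v (k + 1) * (((harmAngle (φ (k + 1)) q - harmAngle (φ k) q) / π : ℝ) : ℂ)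

/-- The holomorphic derivative of `polyMap`. -/
noncomputable def polyDensity (n : ℕ) (φ ℓ : ℕ → ℝ) (q : ℂ) : ℂ :=
  1 / (2 * π) * ∑ k ∈ Finset.range n, ℓ k * expNeg (φ k) ^ 2 / (1 - expNeg (φ k) * q)

/-- The holomorphic part of `polyMap`. -/
noncomputable def polyLeft (n : ℕ) (φ ℓ : ℕ → ℝ) (c q : ℂ) : ℂ :=
  c - 1 / (2 * π) * ∑ k ∈ Finset.range n, ℓ k * expNeg (φ k) * (Complex.log (1 - expNeg (φ k) * q) +
    Complex.I * φ k)

/-- The conjugate of the antiholomorphic part of `polyMap`, up to sign. -/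
noncomputable def polyRight (n : ℕ) (φ ℓ : ℕ → ℝ) (q : ℂ) : ℂ :=
  -(1 / (2 * π) * ∑ k ∈ Finset.range n, ℓ k * conj (expNeg (φ k)) *
    Complex.log (1 - expNeg (φ k) * q))

/-- The height function of the minimal surface with boundary values `±∞` on the sides. -/
noncomputable def polyHeight (n : ℕ) (φ ℓ : ℕ → ℝ) (q : ℂ) : ℝ :=
  -(1 / π * ∑ k ∈ Finset.range n, ℓ k * (Complex.log (1 - expNeg (φ k) * q)).re)

namespace PolygonData

variable {n : ℕ} {φ ℓ : ℕ → ℝ} {v : ℕ → ℂ} {q : ℂ}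

lemma sum_mul_expNeg_eq_zero (hP : PolygonData n φ ℓ v) :
    ∑ k ∈ Finset.range n, ℓ k * expNeg (φ k) = 0 := by
  have h : ∑ k ∈ Finset.range n, (v (k + 1) - v k) =
      Complex.I * ∑ k ∈ Finset.range n, ℓ k * expNeg (φ k) := by
    rw [Finset.mul_sum]
    refine Finset.sum_congr rfl fun k hk => ?_
    rw [hP.side k (Finset.mem_range.1 hk), mul_assoc]
  rw [Finset.sum_range_sub, hP.closed, sub_self] at h
  simpa using h.symm

lemma polyMap_eq_sub_sum (hP : PolygonData n φ ℓ v) (q : ℂ) :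
    polyMap n φ v q = v 0 - Complex.I / π *
      ∑ k ∈ Finset.range n, ℓ k * expNeg (φ k) * harmAngle (φ k) q := by
  have hπ : (π : ℂ) ≠ 0 := by exact_mod_cast Real.pi_ne_zero
  have h1 : ∀ k ∈ Finset.range n,
      v (k + 1) * (((harmAngle (φ (k + 1)) q - harmAngle (φ k) q) / π : ℝ) : ℂ) =
        (v (k + 1) * (harmAngle (φ (k + 1)) q / π) - v k * (harmAngle (φ k) q / π)) -
          Complex.I / π * (ℓ k * expNeg (φ k) * harmAngle (φ k) q) := by
    intro k hk
    have := hP.side k (Finset.mem_range.1 hk)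
    push_cast
    linear_combination (-(harmAngle (φ k) q / π : ℂ)) * this
  rw [polyMap, Finset.sum_congr rfl h1, Finset.sum_sub_distrib, ← Finset.mul_sum,
    Finset.sum_range_sub (fun k => v k * (harmAngle (φ k) q / π : ℂ)), hP.closed, hP.period,
    harmAngle_add_two_pi]
  push_cast
  field_simp
  ring

lemma polyMap_eq (hP : PolygonData n φ ℓ v) (q : ℂ) :
    polyMap n φ v q = polyLeft n φ ℓ (v 0) q - conj (polyRight n φ ℓ q) := by
  have h : polyLeft n φ ℓ (v 0) q - conj (polyRight n φ ℓ q) = v 0 - Complex.I / π *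
      ∑ k ∈ Finset.range n, ℓ k * expNeg (φ k) * harmAngle (φ k) q := by
    simp only [polyLeft, polyRight, map_neg, map_mul, map_div₀, map_one, map_sum, map_ofNat,
      Complex.conj_ofReal, Complex.conj_conj, sub_neg_eq_add]
    rw [sub_add, ← mul_sub, ← Finset.sum_sub_distrib, Finset.mul_sum, Finset.mul_sum]
    congr 1
    refine Finset.sum_congr rfl fun k _ => ?_
    have h1 : Complex.log (1 - expNeg (φ k) * q) - conj (Complex.log (1 - expNeg (φ k) * q)) =
        2 * Complex.I * (1 - expNeg (φ k) * q).arg := by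
      rw [Complex.sub_conj, Complex.log_im]
      push_cast
      ring
    rw [harmAngle]
    push_cast
    linear_combination (1 / (2 * π) * (ℓ k * expNeg (φ k)) : ℂ) * h1
  rw [hP.polyMap_eq_sub_sum, h]

lemma hasDerivAt_polyLeft (hq : ‖q‖ < 1) (c : ℂ) :
    HasDerivAt (polyLeft n φ ℓ c) (polyDensity n φ ℓ q) q := by
  have h := ((HasDerivAt.fun_sum (u := Finset.range n) fun k _ =>
    ((hasDerivAt_log_one_sub hq (φ k)).add_const (Complex.I * φ k)).const_mul
      (ℓ k * expNeg (φ k) : ℂ)).const_mul (1 / (2 * π) : ℂ)).const_sub c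
  refine h.congr_deriv ?_
  rw [polyDensity, ← mul_neg, ← Finset.sum_neg_distrib]
  congr 1
  refine Finset.sum_congr rfl fun k _ => ?_
  ring

lemma sq_mul_polyDensity (hP : PolygonData n φ ℓ v) (hq : ∀ k < n, 1 - expNeg (φ k) * q ≠ 0) :
    q ^ 2 * polyDensity n φ ℓ q =
      1 / (2 * π) * ∑ k ∈ Finset.range n, ℓ k / (1 - expNeg (φ k) * q) := by
  have h : ∀ k ∈ Finset.range n, q ^ 2 * (ℓ k * expNeg (φ k) ^ 2 / (1 - expNeg (φ k) * q)) =
      ℓ k / (1 - expNeg (φ k) * q) - ℓ k - q * (ℓ k * expNeg (φ k)) := by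
    intro k hk
    have h0 := hq k (Finset.mem_range.1 hk)
    rw [mul_comm (expNeg (φ k)) q] at h0 ⊢
    field_simp
    ring
  rw [polyDensity, mul_left_comm, Finset.mul_sum, Finset.sum_congr rfl h, Finset.sum_sub_distrib,
    Finset.sum_sub_distrib, ← Finset.mul_sum, hP.sum_mul_expNeg_eq_zero, ← Complex.ofReal_sum,
    hP.sum_eq_zero]
  simp

lemma mul_polyDensity (hP : PolygonData n φ ℓ v) (hq : ∀ k < n, 1 - expNeg (φ k) * q ≠ 0) :
    q * polyDensity n φ ℓ q =
      1 / (2 * π) * ∑ k ∈ Finset.range n, ℓ k * expNeg (φ k) / (1 - expNeg (φ k) * q) := by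
  have h : ∀ k ∈ Finset.range n, q * (ℓ k * expNeg (φ k) ^ 2 / (1 - expNeg (φ k) * q)) =
      ℓ k * expNeg (φ k) / (1 - expNeg (φ k) * q) - ℓ k * expNeg (φ k) := by
    intro k hk
    have h0 := hq k (Finset.mem_range.1 hk)
    rw [mul_comm (expNeg (φ k)) q] at h0 ⊢
    field_simp
    ring
  rw [polyDensity, mul_left_comm, Finset.mul_sum, Finset.sum_congr rfl h, Finset.sum_sub_distrib,
    hP.sum_mul_expNeg_eq_zero, sub_zero]

lemma hasDerivAt_polyRight (hP : PolygonData n φ ℓ v) (hq : ‖q‖ < 1) :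
    HasDerivAt (polyRight n φ ℓ) (q ^ 2 * polyDensity n φ ℓ q) q := by
  have h := ((HasDerivAt.fun_sum (u := Finset.range n) fun k _ =>
    (hasDerivAt_log_one_sub hq (φ k)).const_mul
      (ℓ k * conj (expNeg (φ k)) : ℂ)).const_mul (1 / (2 * π) : ℂ)).neg
  refine h.congr_deriv ?_
  rw [hP.sq_mul_polyDensity fun k _ => one_sub_expNeg_mul_ne_zero hq _, ← mul_neg,
    ← Finset.sum_neg_distrib]
  congr 1
  refine Finset.sum_congr rfl fun k _ => ?_
  linear_combination (ℓ k / (1 - expNeg (φ k) * q)) * expNeg_mul_conj (φ k)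

lemma hasFDerivAt_polyHeight (hP : PolygonData n φ ℓ v) (hq : ‖q‖ < 1) :
    HasFDerivAt (polyHeight n φ ℓ)
      ((2:ℝ) • Complex.reCLM.comp (ContinuousLinearMap.mul ℝ ℂ (q * polyDensity n φ ℓ q))) q := by
  have h := ((HasFDerivAt.fun_sum (u := Finset.range n) fun k _ =>
    (Complex.reCLM.hasFDerivAt.comp q
      ((hasDerivAt_log_one_sub hq (φ k)).hasFDerivAt.restrictScalars ℝ)).const_mul
        (ℓ k)).const_mul (1 / π)).neg
  refine h.congr_fderiv ?_
  rw [hP.mul_polyDensity fun k _ => one_sub_expNeg_mul_ne_zero hq _]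
  ext x
  have h1 : ∀ k ∈ Finset.range n,
      (ℓ k * expNeg (φ k) / (1 - expNeg (φ k) * q) * x : ℂ).re =
        -(ℓ k * (x * (-expNeg (φ k) / (1 - expNeg (φ k) * q))).re) := by
    intro k _
    rw [← Complex.re_ofReal_mul, ← Complex.neg_re]
    congr 1
    ring
  have h2 : (1 / (2 * π) : ℂ) = ((1 / (2 * π) : ℝ) : ℂ) := by push_cast; rfl
  have h3 : (2 * (1 / (2 * π) * (∑ k ∈ Finset.range n,
      ℓ k * expNeg (φ k) / (1 - expNeg (φ k) * q)) * x : ℂ).re : ℝ) = -(1 / π *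
      ∑ k ∈ Finset.range n, ℓ k * (x * (-expNeg (φ k) / (1 - expNeg (φ k) * q))).re) := by
    rw [mul_assoc, h2, Complex.re_ofReal_mul, Finset.sum_mul, Complex.re_sum,
      Finset.sum_congr rfl h1, Finset.sum_neg_distrib]
    generalize ∑ k ∈ Finset.range n, ℓ k * (x * (-expNeg (φ k) / (1 - expNeg (φ k) * q))).re = S
    field_simp
  refine Eq.trans ?_ (h3.symm.trans ?_)
  · simp [Finset.mul_sum]
  · simp

/-- The harmonic measure of the arc between the angles `φ k` and `φ (k + 1)`. -/
lemma arc_pos (hP : PolygonData n φ ℓ v) (hq : ‖q‖ < 1) {k : ℕ} (hk : k < n) :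
    0 < (harmAngle (φ (k + 1)) q - harmAngle (φ k) q) / π :=
  div_pos (sub_pos.2 (strictMono_harmAngle hq (hP.lt_succ k hk))) Real.pi_pos

lemma sum_arc (hP : PolygonData n φ ℓ v) (q : ℂ) :
    ∑ k ∈ Finset.range n, (harmAngle (φ (k + 1)) q - harmAngle (φ k) q) / π = 1 := by
  rw [← Finset.sum_div, Finset.sum_range_sub (fun k => harmAngle (φ k) q), hP.period,
    harmAngle_add_two_pi, add_sub_cancel_left, div_self Real.pi_ne_zero]

lemma norm_polyMap_le (hP : PolygonData n φ ℓ v) (hq : ‖q‖ < 1)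
    (hv : ∀ k < n, ‖v (k + 1)‖ ≤ 1) : ‖polyMap n φ v q‖ ≤ 1 := by
  rw [← hP.sum_arc q]
  refine norm_sum_le_of_le _ fun k hk => ?_
  have hk := Finset.mem_range.1 hk
  rw [norm_mul, Complex.norm_real, Real.norm_of_nonneg (hP.arc_pos hq hk).le]
  exact mul_le_of_le_one_left (hP.arc_pos hq hk).le (hv k hk)

lemma re_polyMap_le (hP : PolygonData n φ ℓ v) (hq : ‖q‖ < 1) {u : ℝ}
    (hv : ∀ k < n, (v (k + 1)).re ≤ u) : (polyMap n φ v q).re ≤ u := by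
  rw [polyMap, Complex.re_sum, ← mul_one u, ← hP.sum_arc q, Finset.mul_sum]
  refine Finset.sum_le_sum fun k hk => ?_
  have hk := Finset.mem_range.1 hk
  rw [Complex.re_mul_ofReal]
  exact mul_le_mul_of_nonneg_right (hv k hk) (hP.arc_pos hq hk).le

/-- The harmonic map of a polygon inscribed in the unit circle is a comparison map. -/
lemma comparisonMap (hP : PolygonData n φ ℓ v) (hv : ∀ k < n, ‖v (k + 1)‖ ≤ 1) {u : ℝ}
    (hu0 : -1 < u) (hu : u < 1) (hvu : ∀ k < n, (v (k + 1)).re ≤ u) {q₀ : ℂ}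
    (h0 : polyMap n φ v q₀ = 0) :
    ComparisonMap (polyLeft n φ ℓ (v 0)) (polyRight n φ ℓ) (polyDensity n φ ℓ) q₀ where
  hasDerivAt_left x hx := hasDerivAt_polyLeft (by simpa using hx) _
  hasDerivAt_right x hx := hP.hasDerivAt_polyRight (by simpa using hx)
  norm_le x hx := by
    rw [← hP.polyMap_eq]
    exact hP.norm_polyMap_le (by simpa using hx) hv
  eq_zero := by rw [← hP.polyMap_eq, h0]
  exists_not_mem := by
    refine ⟨((1 + u) / 2 : ℝ), ?_, fun x hx h => ?_⟩
    · rw [mem_ball_zero_iff, Complex.norm_real, Real.norm_eq_abs, abs_lt]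
      constructor <;> linarith
    · rw [← hP.polyMap_eq] at h
      have := hP.re_polyMap_le (by simpa using hx) hvu
      rw [h, Complex.ofReal_re] at this
      linarith

end PolygonData

/-- The scale of the inscribed trapezoid with parameter `s`. -/
noncomputable def scherkScale (s : ℝ) : ℝ := √((1 - s ^ 2) / (2 - s ^ 2))

/-- The angles of the sides of the inscribed trapezoid with parameter `s`. -/
noncomputable def scherkAngles (s : ℝ) : ℕ → ℝ
  | 0 => -arccos s
  | 1 => 0
  | 2 => arccos s
  | 3 => π
  | _ => -arccos s + 2 * π

/-- The signed lengths of the sides of the inscribed trapezoid with parameter `s`. -/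
noncomputable def scherkLengths (s : ℝ) : ℕ → ℝ
  | 0 => -(2 * scherkScale s)
  | 1 => 2 * scherkScale s * (1 + s)
  | 2 => -(2 * scherkScale s)
  | _ => 2 * scherkScale s * (1 - s)

/-- The vertices of the inscribed trapezoid with parameter `s`. -/
noncomputable def scherkVertices (s : ℝ) : ℕ → ℂ
  | 1 => ⟨scherkScale s * (√(1 - s ^ 2) - s / √(1 - s ^ 2)), -(scherkScale s * (1 + s))⟩
  | 2 => ⟨scherkScale s * (√(1 - s ^ 2) - s / √(1 - s ^ 2)), scherkScale s * (1 + s)⟩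
  | 3 => ⟨-(scherkScale s * (√(1 - s ^ 2) + s / √(1 - s ^ 2))), scherkScale s * (1 - s)⟩
  | _ => ⟨-(scherkScale s * (√(1 - s ^ 2) + s / √(1 - s ^ 2))), -(scherkScale s * (1 - s))⟩

section Scherk

variable {s : ℝ}

lemma expNeg_arccos (h0 : 0 ≤ s) (h1 : s < 1 - s ^ 2) :
    expNeg (arccos s) = s - √(1 - s ^ 2) * Complex.I := by
  rw [expNeg_eq, Real.cos_arccos (by linarith) (by nlinarith), Real.sin_arccos]

lemma expNeg_neg_arccos (h0 : 0 ≤ s) (h1 : s < 1 - s ^ 2) :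
    expNeg (-arccos s) = s + √(1 - s ^ 2) * Complex.I := by
  rw [← conj_expNeg, expNeg_arccos h0 h1]
  simp

lemma expNeg_zero : expNeg 0 = 1 := by simp [expNeg]

lemma expNeg_pi : expNeg π = -1 := by simp [expNeg_eq]

lemma scherk_polygonData (h0 : 0 ≤ s) (h1 : s < 1 - s ^ 2) :
    PolygonData 4 (scherkAngles s) (scherkLengths s) (scherkVertices s) where
  lt_succ k hk := by
    have h2 : 0 < arccos s := Real.arccos_pos.2 (by nlinarith)
    have h3 : arccos s ≤ π / 2 := Real.arccos_le_pi_div_two.2 h0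
    have := Real.pi_pos
    interval_cases k <;> simp only [scherkAngles] <;> linarith
  period := rfl
  closed := rfl
  side k hk := by
    have h3 : √(1 - s ^ 2) ^ 2 = 1 - s ^ 2 := Real.sq_sqrt (by linarith)
    have h4 : 0 < √(1 - s ^ 2) := Real.sqrt_pos.2 (by linarith)
    interval_cases k <;> simp only [scherkAngles, scherkLengths, scherkVertices,
      expNeg_arccos h0 h1, expNeg_neg_arccos h0 h1, expNeg_zero, expNeg_pi] <;>
      generalize √(1 - s ^ 2) = c at * <;>
      apply Complex.ext <;> simp <;> ring
  sum_eq_zero := by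
    simp [Finset.sum_range_succ, scherkLengths]
    ring

lemma scherkScale_sq (h0 : 0 ≤ s) (h1 : s < 1 - s ^ 2) :
    scherkScale s ^ 2 = (1 - s ^ 2) / (2 - s ^ 2) :=
  Real.sq_sqrt (div_nonneg (by linarith) (by linarith))

lemma scherkScale_pos (h0 : 0 ≤ s) (h1 : s < 1 - s ^ 2) : 0 < scherkScale s :=
  Real.sqrt_pos.2 (div_pos (by linarith) (by linarith))

lemma norm_scherkVertices (h0 : 0 ≤ s) (h1 : s < 1 - s ^ 2) (k : ℕ) :
    ‖scherkVertices s k‖ = 1 := by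
  have h2 := scherkScale_sq h0 h1
  have h3 : √(1 - s ^ 2) ^ 2 = 1 - s ^ 2 := Real.sq_sqrt (by linarith)
  have h4 : 0 < √(1 - s ^ 2) := Real.sqrt_pos.2 (by linarith)
  have h5 : (scherkScale s) ^ 2 * (√(1 - s ^ 2) ^ 2 + s ^ 2 / √(1 - s ^ 2) ^ 2 + 1 + s ^ 2) = 1 := by
    rw [h2, h3]
    have : 1 - s ^ 2 ≠ 0 := by linarith
    have : 2 - s ^ 2 ≠ 0 := by linarith
    field_simp
    ring
  have h6 : ‖scherkVertices s k‖ ^ 2 = 1 := by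
    rw [← h5, ← Complex.normSq_eq_norm_sq, Complex.normSq_apply]
    match k with
    | 0 | 1 | 2 | 3 | _ + 4 =>
      simp only [scherkVertices]
      generalize √(1 - s ^ 2) = c at *
      field_simp
      ring
  nlinarith [norm_nonneg (scherkVertices s k)]

lemma scherkVertices_right_re_pos (h0 : 0 ≤ s) (h1 : s < 1 - s ^ 2) :
    0 < scherkScale s * (√(1 - s ^ 2) - s / √(1 - s ^ 2)) := by
  have h4 : 0 < √(1 - s ^ 2) := Real.sqrt_pos.2 (by linarith)
  have h3 : √(1 - s ^ 2) ^ 2 = 1 - s ^ 2 := Real.sq_sqrt (by linarith)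
  refine mul_pos (scherkScale_pos h0 h1) (sub_pos.2 ?_)
  rw [div_lt_iff₀ h4]
  nlinarith

lemma scherk_comparisonMap (h0 : 0 ≤ s) (h1 : s < 1 - s ^ 2) {q₀ : ℂ}
    (hq₀ : polyMap 4 (scherkAngles s) (scherkVertices s) q₀ = 0) :
    ComparisonMap (polyLeft 4 (scherkAngles s) (scherkLengths s) (scherkVertices s 0))
      (polyRight 4 (scherkAngles s) (scherkLengths s))
      (polyDensity 4 (scherkAngles s) (scherkLengths s)) q₀ := by
  have h4 : 0 < √(1 - s ^ 2) := Real.sqrt_pos.2 (by linarith)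
  have hm := scherkScale_pos h0 h1
  have hu := scherkVertices_right_re_pos h0 h1
  refine (scherk_polygonData h0 h1).comparisonMap (fun k _ => (norm_scherkVertices h0 h1 _).le)
    (u := scherkScale s * (√(1 - s ^ 2) - s / √(1 - s ^ 2))) (by linarith) ?_ ?_ hq₀
  · have h5 := norm_scherkVertices h0 h1 1
    have h6 : ‖scherkVertices s 1‖ ^ 2 = 1 := by rw [h5]; norm_num
    rw [← Complex.normSq_eq_norm_sq, Complex.normSq_apply] at h6
    simp only [scherkVertices] at h6
    have : 0 < scherkScale s * (1 + s) := by positivity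
    nlinarith
  · intro k hk
    have : 0 ≤ scherkScale s * (√(1 - s ^ 2) + s / √(1 - s ^ 2)) := by positivity
    interval_cases k <;> simp only [scherkVertices] <;> linarith

end Scherk

section Scherk

variable {s τ : ℝ}

lemma scherkAngle_mem_Ico (h0 : 0 ≤ s) (h1 : s < 1 - s ^ 2) : scherkAngle s ∈ Ico 0 (π / 2) := by
  have h2 : 0 < 1 - s ^ 2 := by linarith
  have := Real.pi_pos
  refine ⟨by unfold scherkAngle; positivity, ?_⟩
  rw [scherkAngle, div_lt_iff₀ (by positivity)]
  nlinarith

lemma one_add_sq_sub_pos (h0 : 0 ≤ s) (h1 : s < 1 - s ^ 2) : 0 < 1 + τ ^ 2 - 2 * τ * s := by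
  nlinarith [sq_nonneg (τ - s)]

lemma sin_scherkAngle_eq (h0 : 0 ≤ s) (h1 : s < 1 - s ^ 2)
    (hs : 2 * τ / (1 + τ ^ 2) = scherkSlope s) :
    sin (scherkAngle s) = (2 * τ - s * (1 + τ ^ 2)) / (1 + τ ^ 2 - 2 * τ * s) := by
  have h2 := scherkAngle_mem_Ico h0 h1
  have h3 : 0 ≤ sin (scherkAngle s) := sin_nonneg_of_nonneg_of_le_pi h2.1 (by linarith [h2.2, Real.pi_pos])
  have h4 : 0 < 1 + s * sin (scherkAngle s) := by positivity
  rw [scherkSlope, div_eq_div_iff (by positivity) h4.ne'] at hs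
  rw [eq_div_iff (one_add_sq_sub_pos h0 h1).ne']
  linarith

lemma cos_scherkAngle_eq (h0 : 0 ≤ s) (h1 : s < 1 - s ^ 2) (hτ0 : 0 ≤ τ) (hτ : τ < 1)
    (hs : 2 * τ / (1 + τ ^ 2) = scherkSlope s) :
    cos (scherkAngle s) = (1 - τ ^ 2) * √(1 - s ^ 2) / (1 + τ ^ 2 - 2 * τ * s) := by
  have hD : 0 < 1 + τ ^ 2 - 2 * τ * s := one_add_sq_sub_pos h0 h1
  have h2 := scherkAngle_mem_Ico h0 h1
  have h3 : 0 ≤ cos (scherkAngle s) :=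
    cos_nonneg_of_mem_Icc ⟨by linarith [h2.1, Real.pi_pos], h2.2.le⟩
  have h4 : √(1 - s ^ 2) ^ 2 = 1 - s ^ 2 := Real.sq_sqrt (by linarith)
  have h5 : 0 ≤ 1 - τ ^ 2 := by nlinarith
  refine (sq_eq_sq₀ h3 (by positivity)).1 ?_
  rw [Real.cos_sq', sin_scherkAngle_eq h0 h1 hs, div_pow, div_pow, mul_pow, h4]
  field_simp
  ring

lemma arg_scherk (h0 : 0 ≤ s) (h1 : s < 1 - s ^ 2) (hτ0 : 0 ≤ τ) (hτ : τ < 1)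
    (hs : 2 * τ / (1 + τ ^ 2) = scherkSlope s) :
    harmAngle (arccos s) τ = π / 4 + scherkAngle s / 2 := by
  have hD : 0 < 1 + τ ^ 2 - 2 * τ * s := one_add_sq_sub_pos h0 h1
  have hκ := scherkAngle_mem_Ico h0 h1
  have ha0 : 0 < arccos s := Real.arccos_pos.2 (by nlinarith)
  have ha1 : arccos s ≤ π / 2 := Real.arccos_le_pi_div_two.2 h0
  have h4 : √(1 - s ^ 2) ^ 2 = 1 - s ^ 2 := Real.sq_sqrt (by linarith)
  set z : ℂ := 1 - expNeg (arccos s) * τ with hz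
  have hre : z.re = 1 - s * τ := by simp [hz, expNeg_arccos h0 h1]
  have him : z.im = √(1 - s ^ 2) * τ := by simp [hz, expNeg_arccos h0 h1]
  have hzre : 0 < z.re := by rw [hre]; nlinarith
  have hz0 : z ≠ 0 := fun h => by simp [h] at hzre
  have hA0 : 0 ≤ z.arg := Complex.arg_nonneg_iff.2 (by rw [him]; positivity)
  have hA1 : z.arg ≤ π / 2 := (abs_le.1 (Complex.abs_arg_le_pi_div_two_iff.2 hzre.le)).2
  have hn : ‖z‖ ^ 2 = 1 + τ ^ 2 - 2 * τ * s := by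
    rw [← Complex.normSq_eq_norm_sq, Complex.normSq_apply, hre, him]
    linear_combination τ ^ 2 * h4
  have hcos : cos (2 * z.arg) = cos (π / 2 + (scherkAngle s - arccos s)) := by
    rw [Real.cos_two_mul, Complex.cos_arg hz0, div_pow, hn, hre, add_comm (π / 2),
      Real.cos_add_pi_div_two, Real.sin_sub, Real.cos_arccos (by linarith) (by nlinarith),
      Real.sin_arccos, sin_scherkAngle_eq h0 h1 hs, cos_scherkAngle_eq h0 h1 hτ0 hτ hs]
    generalize hDD : 1 + τ ^ 2 - 2 * τ * s = D at *
    field_simp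
    rw [h4, ← hDD]
    ring
  have := Real.injOn_cos ⟨by linarith, by linarith⟩
    ⟨by linarith [hκ.1], by linarith [hκ.2]⟩ hcos
  rw [harmAngle, ← hz]
  linarith

lemma harmAngle_neg_ofReal (hτ : |τ| < 1) (φ : ℝ) : harmAngle (-φ) τ = -harmAngle φ τ := by
  have hq : ‖(τ : ℂ)‖ < 1 := by simpa using hτ
  have h : 1 - expNeg (-φ) * τ = conj (1 - expNeg φ * τ) := by simp [conj_expNeg]
  have h1 := one_sub_expNeg_mul_re_pos hq φ
  rw [harmAngle, harmAngle, h, Complex.arg_conj, if_neg]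
  · ring
  · intro h2
    have := (abs_le.1 (Complex.abs_arg_le_pi_div_two_iff.2 h1.le)).2
    linarith [Real.pi_pos]

lemma polyMap_scherk (h0 : 0 ≤ s) (h1 : s < 1 - s ^ 2) (hτ0 : 0 ≤ τ) (hτ : τ < 1)
    (hs : 2 * τ / (1 + τ ^ 2) = scherkSlope s) :
    polyMap 4 (scherkAngles s) (scherkVertices s) τ = 0 := by
  have hτ' : |τ| < 1 := abs_lt.2 ⟨by linarith, hτ⟩
  have e0 := harmAngle_neg_ofReal hτ' (arccos s)
  have e1 : harmAngle 0 τ = 0 := by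
    have h := harmAngle_neg_ofReal hτ' 0
    rw [neg_zero] at h
    linarith
  have e3 : harmAngle π τ = π / 2 := by
    have h := harmAngle_neg_ofReal hτ' π
    have h' := harmAngle_add_two_pi (-π) (τ : ℂ)
    rw [show -π + 2 * π = π by ring] at h'
    linarith
  have e4 := harmAngle_add_two_pi (-arccos s) (τ : ℂ)
  have hc : 0 < √(1 - s ^ 2) := Real.sqrt_pos.2 (by linarith)
  have hc2 : √(1 - s ^ 2) ^ 2 = 1 - s ^ 2 := Real.sq_sqrt (by linarith)
  have hX := arg_scherk h0 h1 hτ0 hτ hs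
  rw [scherkAngle, ← hc2] at hX
  simp only [polyMap, Finset.sum_range_succ, Finset.sum_range_zero, zero_add, scherkAngles,
    Nat.reduceAdd, e4, e0, e1, e3, hX]
  have := Real.pi_pos
  simp only [scherkVertices]
  generalize √(1 - s ^ 2) = c at *
  apply Complex.ext
  · simp only [Complex.add_re, Complex.re_mul_ofReal, Complex.zero_re]
    field_simp
    ring
  · simp only [Complex.add_im, Complex.im_mul_ofReal, Complex.zero_im]
    ring

/-- The value of the density of the trapezoid at the point over the origin. -/
noncomputable def scherkDensity (s τ : ℝ) : ℝ :=
  4 * scherkScale s * (1 - s ^ 2) / (π * ((1 - τ ^ 2) * (1 + τ ^ 2 - 2 * τ * s)))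

lemma scherkDensity_pos (h0 : 0 ≤ s) (h1 : s < 1 - s ^ 2) (hτ0 : 0 ≤ τ) (hτ : τ < 1) :
    0 < scherkDensity s τ := by
  have hD : 0 < 1 + τ ^ 2 - 2 * τ * s := one_add_sq_sub_pos h0 h1
  have hm := scherkScale_pos h0 h1
  have := Real.pi_pos
  have : 0 < 1 - τ ^ 2 := by nlinarith
  have : 0 < 1 - s ^ 2 := by linarith
  unfold scherkDensity
  positivity

lemma polyDensity_scherk (h0 : 0 ≤ s) (h1 : s < 1 - s ^ 2) (hτ0 : 0 ≤ τ) (hτ : τ < 1) :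
    polyDensity 4 (scherkAngles s) (scherkLengths s) τ = scherkDensity s τ := by
  have hD : 0 < 1 + τ ^ 2 - 2 * τ * s := one_add_sq_sub_pos h0 h1
  have hc2 : √(1 - s ^ 2) ^ 2 = 1 - s ^ 2 := Real.sq_sqrt (by linarith)
  have hq : ‖(τ : ℂ)‖ < 1 := by simpa using abs_lt.2 ⟨by linarith, hτ⟩
  have n0 := one_sub_expNeg_mul_ne_zero hq (-arccos s)
  have n2 := one_sub_expNeg_mul_ne_zero hq (arccos s)
  have n1 := one_sub_expNeg_mul_ne_zero hq 0
  have n3 := one_sub_expNeg_mul_ne_zero hq π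
  simp only [polyDensity, scherkDensity, Finset.sum_range_succ, Finset.sum_range_zero, zero_add,
    scherkAngles, scherkLengths, expNeg_arccos h0 h1, expNeg_neg_arccos h0 h1, expNeg_zero,
    expNeg_pi] at *
  generalize √(1 - s ^ 2) = c at *
  generalize scherkScale s = m at *
  have hcC : (c : ℂ) ^ 2 = 1 - s ^ 2 := by exact_mod_cast hc2
  have hDC : (1 + τ ^ 2 - 2 * τ * s : ℂ) ≠ 0 := by exact_mod_cast hD.ne'
  have e : (1 - (s + c * Complex.I) * τ : ℂ) * (1 - (s - c * Complex.I) * τ) =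
      1 + τ ^ 2 - 2 * τ * s := by
    linear_combination (τ : ℂ) ^ 2 * hcC - (c : ℂ) ^ 2 * τ ^ 2 * Complex.I_sq
  have e1 : ((s + c * Complex.I) ^ 2 / (1 - (s + c * Complex.I) * τ) +
      (s - c * Complex.I) ^ 2 / (1 - (s - c * Complex.I) * τ) : ℂ) =
      2 * (2 * s ^ 2 - 1 - s * τ) / (1 + τ ^ 2 - 2 * τ * s) := by
    rw [div_add_div _ _ n0 n2, e]
    congr 1
    linear_combination (2 * c ^ 2 + 2 * s * τ * c ^ 2 : ℂ) * Complex.I_sq -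
      (2 + 2 * s * τ : ℂ) * hcC
  have n1' : (1 - τ : ℂ) ≠ 0 := by simpa using n1
  have n3' : (1 + τ : ℂ) ≠ 0 := by simpa using n3
  have hπ : (π : ℂ) ≠ 0 := by exact_mod_cast Real.pi_ne_zero
  have e2 : (1 - τ ^ 2 : ℂ) = (1 - τ) * (1 + τ) := by ring
  push_cast
  rw [e2, show (1 - 1 * τ : ℂ) = 1 - τ by ring, show (1 - -1 * τ : ℂ) = 1 + τ by ring]
  trans 1 / (2 * π) * (2 * m * ((1 + s) / (1 - τ) + (1 - s) / (1 + τ) -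
    2 * (2 * s ^ 2 - 1 - s * τ) / (1 + τ ^ 2 - 2 * τ * s)))
  · rw [← e1]; ring
  · generalize hDD : (1 + τ ^ 2 - 2 * τ * s : ℂ) = D at *
    field_simp
    rw [← hDD]
    ring

lemma scherkCurv_eq (h0 : 0 ≤ s) (h1 : s < 1 - s ^ 2) (hτ0 : 0 ≤ τ) (hτ : τ < 1)
    (hs : 2 * τ / (1 + τ ^ 2) = scherkSlope s) :
    (2 / (scherkDensity s τ * (1 + τ ^ 2) ^ 2)) ^ 2 = scherkCurv s := by
  have hD : 0 < 1 + τ ^ 2 - 2 * τ * s := one_add_sq_sub_pos h0 h1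
  have hm := scherkScale_pos h0 h1
  have hm2 := scherkScale_sq h0 h1
  have hc2 : √(1 - s ^ 2) ^ 2 = 1 - s ^ 2 := Real.sq_sqrt (by linarith)
  have h2 : 0 < 1 - s ^ 2 := by linarith
  have h3 : 0 < 1 - τ ^ 2 := by nlinarith
  have h5 : 0 < 2 - s ^ 2 := by linarith
  have h4 : 1 + s * sin (scherkAngle s) = (1 + τ ^ 2) * (1 - s ^ 2) / (1 + τ ^ 2 - 2 * τ * s) := by
    rw [sin_scherkAngle_eq h0 h1 hs, mul_div_assoc', eq_div_iff hD.ne', add_mul,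
      div_mul_cancel₀ _ hD.ne']
    ring
  rw [scherkCurv, h4, cos_scherkAngle_eq h0 h1 hτ0 hτ hs, scherkDensity]
  have := Real.pi_pos
  simp only [div_pow, mul_pow, hc2, hm2]
  field_simp
  norm_num

end Scherk

/-- The half-angle parameter `tan (θ / 2)` of an acute angle. -/
lemma exists_half_tangent {θ : ℝ} (hθ : θ ∈ Ico 0 (π / 2)) :
    ∃ τ : ℝ, 0 ≤ τ ∧ τ < 1 ∧ 2 * τ / (1 + τ ^ 2) = sin θ ∧
      cos θ = (1 - τ ^ 2) / (1 + τ ^ 2) := by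
  have hπ := Real.pi_pos
  have hc : 0 < cos (θ / 2) := cos_pos_of_mem_Ioo ⟨by linarith [hθ.1], by linarith [hθ.2]⟩
  have hs : 0 ≤ sin (θ / 2) := sin_nonneg_of_nonneg_of_le_pi (by linarith [hθ.1])
    (by linarith [hθ.2])
  have hcθ : 0 < cos θ := cos_pos_of_mem_Ioo ⟨by linarith [hθ.1], hθ.2⟩
  have hsc := sin_sq_add_cos_sq (θ / 2)
  have e1 : sin θ = 2 * sin (θ / 2) * cos (θ / 2) := by
    rw [← sin_two_mul]; ring_nf
  have e2 : cos θ = 2 * cos (θ / 2) ^ 2 - 1 := by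
    rw [← cos_two_mul]; ring_nf
  have e3 : 1 + (sin (θ / 2) / cos (θ / 2)) ^ 2 = 1 / cos (θ / 2) ^ 2 := by
    field_simp
    linarith
  refine ⟨sin (θ / 2) / cos (θ / 2), by positivity, ?_, ?_, ?_⟩
  · rw [div_lt_one hc]
    nlinarith
  · rw [e3, e1]
    field_simp
  · rw [e3, e2]
    field_simp
    linarith

lemma abs_gaussCurv_lt_scherkCurv {f : ℝ × ℝ → ℝ} (hf : ContDiffOn ℝ 2 f unitDisk)
    (hM : MinimalSurfaceEq f unitDisk) {h : ℝ × ℝ} (hsym : IsSymmetricPt f (0, 0) h) {θ s : ℝ}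
    (hθ : θ ∈ Ico 0 (π / 2))
    (hcos : cos θ = 1 / √(1 + (pdu f (0, 0)) ^ 2 + (pdv f (0, 0)) ^ 2))
    (h0 : 0 ≤ s) (h1 : s < 1 - s ^ 2) (hs : sin θ = scherkSlope s) :
    |gaussCurv f (0, 0)| < scherkCurv s := by
  obtain ⟨τ, hτ0, hτ, hsin, hcosτ⟩ := exists_half_tangent hθ
  rw [hs] at hsin
  rw [← scherkCurv_eq h0 h1 hτ0 hτ hsin]
  refine abs_gaussCurv_lt_of_comparison hf hM hsym hτ0 hτ ?_
    (scherk_comparisonMap h0 h1 (polyMap_scherk h0 h1 hτ0 hτ hsin))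
    (polyDensity_scherk h0 h1 hτ0 hτ) (scherkDensity_pos h0 h1 hτ0 hτ)
  rw [hcosτ] at hcos
  rw [← inv_div, hcos, one_div, inv_inv]

section Numerator

open Polynomial

/-- The polynomial `∑ c k ∏_{j ≠ k} (1 - w j X)`, the numerator of `∑ c k / (1 - w k X)`. -/
noncomputable def fracNumer (n : ℕ) (w c : ℕ → ℂ) : ℂ[X] :=
  ∑ k ∈ Finset.range n, C (c k) * ∏ j ∈ (Finset.range n).erase k, (1 - C (w j) * X)

variable {n : ℕ} {w c : ℕ → ℂ}

lemma eval_fracNumer {q : ℂ} (hq : ∀ k < n, 1 - w k * q ≠ 0) :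
    (fracNumer n w c).eval q =
      (∑ k ∈ Finset.range n, c k / (1 - w k * q)) * ∏ k ∈ Finset.range n, (1 - w k * q) := by
  rw [fracNumer, eval_finsetSum, Finset.sum_mul]
  refine Finset.sum_congr rfl fun k hk => ?_
  rw [eval_mul, eval_C, eval_prod, ← Finset.mul_prod_erase _ _ hk]
  have := hq k (Finset.mem_range.1 hk)
  simp only [eval_sub, eval_one, eval_mul, eval_C, eval_X]
  rw [← mul_assoc, div_mul_cancel₀ _ this]

lemma X_sq_mul_fracNumer (h0 : ∑ k ∈ Finset.range n, c k = 0)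
    (h1 : ∑ k ∈ Finset.range n, c k * w k = 0) :
    X ^ 2 * fracNumer n w (fun k => c k * w k ^ 2) = fracNumer n w c := by
  have h : ∀ k ∈ Finset.range n, X ^ 2 * (C (c k * w k ^ 2) *
      ∏ j ∈ (Finset.range n).erase k, (1 - C (w j) * X)) =
      C (c k) * ∏ j ∈ (Finset.range n).erase k, (1 - C (w j) * X) -
        (C (c k) * ∏ j ∈ Finset.range n, (1 - C (w j) * X) +
          C (c k * w k) * (X * ∏ j ∈ Finset.range n, (1 - C (w j) * X))) := by
    intro k hk
    rw [← Finset.mul_prod_erase _ _ hk]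
    simp only [C_mul, C_pow]
    ring
  rw [fracNumer, fracNumer, Finset.mul_sum, Finset.sum_congr rfl h, Finset.sum_sub_distrib,
    Finset.sum_add_distrib, ← Finset.sum_mul, ← Finset.sum_mul, ← map_sum, ← map_sum, h0, h1]
  simp

lemma natDegree_one_sub_C_mul_X_le (a : ℂ) : (1 - C a * X).natDegree ≤ 1 := by
  compute_degree

lemma natDegree_prod_erase_le {k : ℕ} (hk : k < n) :
    (∏ j ∈ (Finset.range n).erase k, (1 - C (w j) * X)).natDegree ≤ n - 1 := by
  refine (natDegree_prod_le _ _).trans ?_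
  refine (Finset.sum_le_card_nsmul _ _ 1 fun j _ => natDegree_one_sub_C_mul_X_le _).trans ?_
  rw [Finset.card_erase_of_mem (Finset.mem_range.2 hk), Finset.card_range]
  simp

lemma natDegree_fracNumer_le (hn : 2 ≤ n) (hw : ∀ k < n, w k ≠ 0)
    (h : ∑ k ∈ Finset.range n, c k * (w k)⁻¹ = 0) : (fracNumer n w c).natDegree ≤ n - 2 := by
  rw [natDegree_le_iff_coeff_eq_zero]
  intro N hN
  rw [fracNumer, finsetSum_coeff]
  rcases (show n - 1 ≤ N by omega).eq_or_lt with rfl | hN'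
  · have : ∀ k ∈ Finset.range n,
        (C (c k) * ∏ j ∈ (Finset.range n).erase k, (1 - C (w j) * X)).coeff (n - 1) =
          c k * (w k)⁻¹ * ((-1) ^ (n - 1) * ∏ j ∈ Finset.range n, w j) := by
      intro k hk
      have hcard : ((Finset.range n).erase k).card = n - 1 := by
        rw [Finset.card_erase_of_mem hk, Finset.card_range]
      have h1 := coeff_prod_of_natDegree_le ((Finset.range n).erase k)
        (fun j => (1 - C (w j) * X : ℂ[X])) 1 fun j _ => natDegree_one_sub_C_mul_X_le _
      rw [hcard, mul_one] at h1
      rw [coeff_C_mul, h1, ← Finset.mul_prod_erase _ _ hk]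
      have h2 : ∀ j, (1 - C (w j) * X : ℂ[X]).coeff 1 = -w j := by simp [coeff_one]
      simp only [h2]
      rw [Finset.prod_neg, hcard]
      have := hw k (Finset.mem_range.1 hk)
      field_simp
    rw [Finset.sum_congr rfl this, ← Finset.sum_mul, h, zero_mul]
  · refine Finset.sum_eq_zero fun k hk => ?_
    rw [coeff_C_mul, coeff_eq_zero_of_natDegree_lt, mul_zero]
    exact (natDegree_prod_erase_le (Finset.mem_range.1 hk)).trans_lt hN'

end Numerator

namespace PolygonData

variable {n : ℕ} {φ ℓ : ℕ → ℝ} {v : ℕ → ℂ} {q q₁ : ℂ}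

lemma sum_mul_inv_expNeg_eq_zero (hP : PolygonData n φ ℓ v) :
    ∑ k ∈ Finset.range n, (ℓ k : ℂ) * (expNeg (φ k))⁻¹ = 0 := by
  have h := congrArg conj hP.sum_mul_expNeg_eq_zero
  rw [map_sum, map_zero] at h
  rw [← h]
  refine Finset.sum_congr rfl fun k _ => ?_
  rw [map_mul, Complex.conj_ofReal, inv_eq_of_mul_eq_one_right (expNeg_mul_conj _)]

/-- If the density has `n - 4` zeros on the unit circle, it has none in the open disk. -/
lemma polyDensity_ne_zero (hP : PolygonData n φ ℓ v) (hn : 4 ≤ n) {Z : Finset ℂ}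
    (hcard : n - 4 ≤ Z.card) (hnorm : ∀ z ∈ Z, ‖z‖ = 1)
    (hatom : ∀ z ∈ Z, ∀ k < n, 1 - expNeg (φ k) * z ≠ 0)
    (hzero : ∀ z ∈ Z, ∑ k ∈ Finset.range n, (ℓ k : ℂ) / (1 - expNeg (φ k) * z) = 0)
    (hq₁ : ‖q₁‖ < 1) (h₁ : polyDensity n φ ℓ q₁ ≠ 0) (hq : ‖q‖ < 1) :
    polyDensity n φ ℓ q ≠ 0 := by
  intro h0
  set w : ℕ → ℂ := fun k => expNeg (φ k) with hw
  set P := fracNumer n w (fun k => ℓ k * w k ^ 2) with hPdef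
  have hX : Polynomial.X ^ 2 * P = fracNumer n w (fun k => ℓ k) :=
    X_sq_mul_fracNumer (by exact_mod_cast hP.sum_eq_zero) hP.sum_mul_expNeg_eq_zero
  have hdeg : (fracNumer n w (fun k => (ℓ k : ℂ))).natDegree ≤ n - 2 :=
    natDegree_fracNumer_le (by omega) (fun k _ => expNeg_ne_zero _) hP.sum_mul_inv_expNeg_eq_zero
  have hp : ∀ {x : ℂ}, ‖x‖ < 1 → P.eval x = 2 * π * polyDensity n φ ℓ x *
      ∏ k ∈ Finset.range n, (1 - w k * x) := by
    intro x hx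
    rw [hPdef, eval_fracNumer fun k _ => one_sub_expNeg_mul_ne_zero hx _, polyDensity]
    have hπ : (π : ℂ) ≠ 0 := by exact_mod_cast Real.pi_ne_zero
    rw [← mul_assoc, mul_one_div_cancel (mul_ne_zero two_ne_zero hπ), one_mul]
  have hP0 : P ≠ 0 := by
    intro h
    have h2 := hp hq₁
    rw [h, Polynomial.eval_zero] at h2
    have hπ : (π : ℂ) ≠ 0 := by exact_mod_cast Real.pi_ne_zero
    refine mul_ne_zero (mul_ne_zero (mul_ne_zero two_ne_zero hπ) h₁) ?_ h2.symm
    exact Finset.prod_ne_zero_iff.2 fun k _ => one_sub_expNeg_mul_ne_zero hq₁ _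
  rw [← hX, Polynomial.natDegree_X_pow_mul _ hP0] at hdeg
  have hqZ : q ∉ Z := fun h => (hnorm q h).not_lt hq
  refine hP0 (Polynomial.eq_zero_of_natDegree_lt_card_of_eval_eq_zero' P (insert q Z) ?_ ?_)
  · intro z hz
    rcases Finset.mem_insert.1 hz with rfl | hz
    · rw [hp hq, h0]
      simp
    · have h3 := congrArg (Polynomial.eval z) hX
      rw [eval_fracNumer (hatom z hz), hzero z hz, zero_mul, Polynomial.eval_mul,
        Polynomial.eval_pow, Polynomial.eval_X] at h3
      have hz0 : z ≠ 0 := fun h => by simpa [h] using hnorm z hz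
      exact (mul_eq_zero.1 h3).resolve_left (pow_ne_zero 2 hz0)
  · rw [Finset.card_insert_of_notMem hqZ]
    omega

end PolygonData

section Section

variable {G : ℂ → ℂ} {r : ℝ}

lemma isCompact_preimage_closedBall_of_boundary (hG : ContinuousOn G (Metric.ball 0 1))
    (hbd : ∀ ζ : ℂ, ‖ζ‖ = 1 → ∀ᶠ q in 𝓝[Metric.ball 0 1] ζ, r < ‖G q‖) :
    IsCompact {q : ℂ | ‖q‖ < 1 ∧ ‖G q‖ ≤ r} := by
  have hsub : {q : ℂ | ‖q‖ < 1 ∧ ‖G q‖ ≤ r} ⊆ Metric.closedBall 0 1 := fun q hq => by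
    simpa using hq.1.le
  refine Metric.isCompact_of_isClosed_isBounded ?_ (Metric.isBounded_closedBall.subset hsub)
  refine isClosed_of_closure_subset fun ζ hζ => ?_
  have hfreq := mem_closure_iff_frequently.1 hζ
  have hle : ‖ζ‖ ≤ 1 := by
    simpa using (Metric.isClosed_closedBall.closure_subset_iff.2 hsub) hζ
  rcases hle.lt_or_eq with hlt | heq
  · refine ⟨hlt, not_lt.1 fun hr => ?_⟩
    have hc : ContinuousAt G ζ := hG.continuousAt (Metric.isOpen_ball.mem_nhds (by simpa using hlt))
    obtain ⟨q, hq, hq'⟩ := (hfreq.and_eventually (hc.norm.eventually (lt_mem_nhds hr))).exists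
    exact hq.2.not_gt hq'
  · obtain ⟨q, hq, hq'⟩ :=
      (hfreq.and_eventually (eventually_nhdsWithin_iff.1 (hbd ζ heq))).exists
    exact absurd (hq' (by simpa using hq.1)) hq.2.not_gt

lemma isLocalHomeomorphOn_preimage_ball (hG : ContinuousOn G (Metric.ball 0 1))
    (hloc : ∀ q ∈ Metric.ball (0 : ℂ) 1, ∃ e : OpenPartialHomeomorph ℂ ℂ, q ∈ e.source ∧ e = G) :
    IsLocalHomeomorphOn (fun q : {q : ℂ | ‖q‖ < 1 ∧ ‖G q‖ ≤ r} => G q)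
      ((fun q : {q : ℂ | ‖q‖ < 1 ∧ ‖G q‖ ≤ r} => G q) ⁻¹' Metric.ball 0 r) := by
  rw [isLocalHomeomorphOn_iff_isOpenEmbedding_restrict]
  intro x hx
  obtain ⟨e, hxe, he⟩ := hloc x (by simpa using x.2.1)
  set W : Set ℂ := (Metric.ball 0 1 ∩ G ⁻¹' Metric.ball 0 r) ∩ e.source with hW
  have hWo : IsOpen W := (hG.isOpen_inter_preimage Metric.isOpen_ball Metric.isOpen_ball).inter
    e.open_source
  have hxW : (x : ℂ) ∈ W := ⟨⟨by simpa using x.2.1, hx⟩, hxe⟩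
  refine ⟨Subtype.val ⁻¹' W, (hWo.preimage continuous_subtype_val).mem_nhds hxW, ?_⟩
  have hGW : ContinuousOn G W := hG.mono fun q hq => hq.1.1
  refine Topology.IsOpenEmbedding.of_continuous_injective_isOpenMap ?_ ?_ ?_
  · exact hGW.comp_continuous (continuous_subtype_val.comp continuous_subtype_val) fun y => y.2
  · intro a b hab
    refine Subtype.ext (Subtype.ext (e.injOn a.2.2 b.2.2 ?_))
    rw [he]
    exact hab
  · intro V hV
    obtain ⟨V', hV', rfl⟩ := isOpen_induced_iff.1 hV
    obtain ⟨O, hO, rfl⟩ := isOpen_induced_iff.1 hV'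
    have himg := e.isOpen_image_of_subset_source (hO.inter hWo) fun q hq => hq.2.2
    rw [he] at himg
    convert himg using 1
    ext z
    constructor
    · rintro ⟨y, hy, rfl⟩
      exact ⟨y, ⟨hy, y.2⟩, rfl⟩
    · rintro ⟨q, hq, rfl⟩
      have hqr : ‖G q‖ < r := by simpa using hq.2.1.2
      exact ⟨⟨⟨q, by simpa using hq.2.1.1, hqr.le⟩, hq.2⟩, hq.1, rfl⟩

/-- A local homeomorphism of the unit disk that leaves the ball of radius `r` at the boundary has
a continuous section over that ball. -/
lemma exists_section_of_boundary (hG : ContinuousOn G (Metric.ball 0 1)) (hr : 0 < r)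
    (hloc : ∀ q ∈ Metric.ball (0 : ℂ) 1, ∃ e : OpenPartialHomeomorph ℂ ℂ, q ∈ e.source ∧ e = G)
    (hbd : ∀ ζ : ℂ, ‖ζ‖ = 1 → ∀ᶠ q in 𝓝[Metric.ball 0 1] ζ, r < ‖G q‖) {q₀ : ℂ}
    (hq₀ : ‖q₀‖ < 1) (h0 : G q₀ = 0) :
    ∃ σ : ℂ → ℂ, σ 0 = q₀ ∧ ContinuousOn σ (Metric.ball 0 r) ∧
      ∀ z ∈ Metric.ball 0 r, ‖σ z‖ < 1 ∧ G (σ z) = z := by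
  have hcpt := isCompact_preimage_closedBall_of_boundary hG hbd
  have : CompactSpace {q : ℂ | ‖q‖ < 1 ∧ ‖G q‖ ≤ r} := isCompact_iff_compactSpace.1 hcpt
  have hGE : Continuous (fun q : {q : ℂ | ‖q‖ < 1 ∧ ‖G q‖ ≤ r} => G q) :=
    hG.comp_continuous continuous_subtype_val fun q => by simpa using q.2.1
  have hcov := IsCoveringMapOn.of_isLocalHomeomorphOn hGE
    (isLocalHomeomorphOn_preimage_ball (r := r) hG hloc)
  have h0mem : (0 : ℂ) ∈ Metric.ball (0 : ℂ) r := Metric.mem_ball_self hr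
  have : ContractibleSpace (Metric.ball (0 : ℂ) r) :=
    (convex_ball (0 : ℂ) r).contractibleSpace ⟨0, h0mem⟩
  have : LocallyPathConnectedSpace (Metric.ball (0 : ℂ) r) :=
    Metric.isOpen_ball.locallyPathConnectedSpace
  obtain ⟨F, ⟨hF0, hF⟩, -⟩ := hcov.existsUnique_continuousMap_lifts
    (⟨Subtype.val, continuous_subtype_val⟩ : C(Metric.ball (0 : ℂ) r, ℂ)) (a₀ := ⟨0, h0mem⟩)
    (e₀ := ⟨q₀, hq₀, by simpa [h0] using hr.le⟩) h0 fun a => a.2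
  classical
  have hσ : ∀ (z : ℂ) (hz : z ∈ Metric.ball 0 r),
      (if hz : z ∈ Metric.ball (0 : ℂ) r then (F ⟨z, hz⟩ : ℂ) else 0) = F ⟨z, hz⟩ :=
    fun z hz => dif_pos hz
  refine ⟨fun z => if hz : z ∈ Metric.ball (0 : ℂ) r then F ⟨z, hz⟩ else 0, ?_, ?_, ?_⟩
  · exact (hσ 0 h0mem).trans (congrArg Subtype.val hF0)
  · rw [continuousOn_iff_continuous_domRestrict]
    exact (continuous_subtype_val.comp F.continuous).congr fun z => (hσ z z.2).symm
  · intro z hz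
    simp only [hσ z hz]
    exact ⟨(F ⟨z, hz⟩).2.1, congrFun hF ⟨z, hz⟩⟩

end Section

section MinimalGraph

/-- The derivative of `x ↦ Q x` when `Q` has derivative `ζ ↦ β * isoForm q ζ`. -/
noncomputable def gaussDeriv (q β : ℂ) : ℝ × ℝ →L[ℝ] ℂ :=
  (ContinuousLinearMap.mul ℝ ℂ β).comp
    ((isoForm q).comp (Complex.equivRealProdCLM.symm : ℝ × ℝ →L[ℝ] ℂ))

/-- The differential of a function whose graph has stereographic Gauss map `q`. -/
noncomputable def graphDeriv (q : ℂ) : ℝ × ℝ →L[ℝ] ℝ :=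
  (2 * q.re / (1 - Complex.normSq q)) • ContinuousLinearMap.fst ℝ ℝ ℝ -
    (2 * q.im / (1 - Complex.normSq q)) • ContinuousLinearMap.snd ℝ ℝ ℝ

lemma gaussDeriv_apply (q β : ℂ) (x : ℝ × ℝ) : gaussDeriv q β x =
    β * (((1 - ‖q‖ ^ 4 : ℝ) : ℂ)⁻¹ * (⟨x.1, x.2⟩ + conj q ^ 2 * conj (⟨x.1, x.2⟩ : ℂ))) := by
  have : (Complex.equivRealProdCLM.symm : ℝ × ℝ →L[ℝ] ℂ) x = ⟨x.1, x.2⟩ := rfl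
  rw [gaussDeriv, ContinuousLinearMap.comp_apply, ContinuousLinearMap.comp_apply, this,
    isoForm_apply]
  rfl

lemma gaussDeriv_re (q β : ℂ) (x : ℝ × ℝ) : (gaussDeriv q β x).re =
    (1 - Complex.normSq q ^ 2)⁻¹ *
      (β.re * (x.1 + ((q.re ^ 2 - q.im ^ 2) * x.1 - 2 * q.re * q.im * x.2)) -
        β.im * (x.2 - ((q.re ^ 2 - q.im ^ 2) * x.2 + 2 * q.re * q.im * x.1))) := by
  have : ‖q‖ ^ 4 = Complex.normSq q ^ 2 := by rw [Complex.normSq_eq_norm_sq]; ring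
  rw [gaussDeriv_apply, this, ← Complex.ofReal_inv, mul_left_comm, Complex.re_ofReal_mul]
  simp [pow_two]
  left
  ring

lemma gaussDeriv_im (q β : ℂ) (x : ℝ × ℝ) : (gaussDeriv q β x).im =
    (1 - Complex.normSq q ^ 2)⁻¹ *
      (β.im * (x.1 + ((q.re ^ 2 - q.im ^ 2) * x.1 - 2 * q.re * q.im * x.2)) +
        β.re * (x.2 - ((q.re ^ 2 - q.im ^ 2) * x.2 + 2 * q.re * q.im * x.1))) := by
  have : ‖q‖ ^ 4 = Complex.normSq q ^ 2 := by rw [Complex.normSq_eq_norm_sq]; ring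
  rw [gaussDeriv_apply, this, ← Complex.ofReal_inv, mul_left_comm, Complex.im_ofReal_mul]
  simp [pow_two]
  left
  ring

lemma hasDerivAt_two_mul_re_div {q : ℝ → ℂ} {q' : ℂ} {t : ℝ} (h : HasDerivAt q q' t)
    (hq : 1 - Complex.normSq (q t) ≠ 0) :
    HasDerivAt (fun t => 2 * (q t).re / (1 - Complex.normSq (q t)))
      ((2 * q'.re * (1 - Complex.normSq (q t)) +
        2 * (q t).re * (2 * ((q t).re * q'.re + (q t).im * q'.im))) /
          (1 - Complex.normSq (q t)) ^ 2) t := by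
  have hre : HasDerivAt (fun t => (q t).re) q'.re t := Complex.reCLM.hasFDerivAt.comp_hasDerivAt t h
  have him : HasDerivAt (fun t => (q t).im) q'.im t := Complex.imCLM.hasFDerivAt.comp_hasDerivAt t h
  simp only [Complex.normSq_apply] at hq ⊢
  refine ((hre.const_mul 2).fun_div (((hre.mul hre).add (him.mul him)).const_sub 1) hq).congr_deriv ?_
  simp only [Pi.mul_apply, Pi.add_apply]
  congr 1
  ring

lemma hasDerivAt_two_mul_im_div {q : ℝ → ℂ} {q' : ℂ} {t : ℝ} (h : HasDerivAt q q' t)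
    (hq : 1 - Complex.normSq (q t) ≠ 0) :
    HasDerivAt (fun t => 2 * (q t).im / (1 - Complex.normSq (q t)))
      ((2 * q'.im * (1 - Complex.normSq (q t)) +
        2 * (q t).im * (2 * ((q t).re * q'.re + (q t).im * q'.im))) /
          (1 - Complex.normSq (q t)) ^ 2) t := by
  have hre : HasDerivAt (fun t => (q t).re) q'.re t := Complex.reCLM.hasFDerivAt.comp_hasDerivAt t h
  have him : HasDerivAt (fun t => (q t).im) q'.im t := Complex.imCLM.hasFDerivAt.comp_hasDerivAt t h
  simp only [Complex.normSq_apply] at hq ⊢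
  refine ((him.const_mul 2).fun_div (((hre.mul hre).add (him.mul him)).const_sub 1) hq).congr_deriv ?_
  simp only [Pi.mul_apply, Pi.add_apply]
  congr 1
  ring

variable {Q β : ℝ × ℝ → ℂ} {f : ℝ × ℝ → ℝ} {x : ℝ × ℝ}

lemma one_sub_normSq_pos {q : ℂ} (hq : ‖q‖ < 1) : 0 < 1 - Complex.normSq q := by
  rw [Complex.normSq_eq_norm_sq]
  nlinarith [norm_nonneg q]

lemma pdu_eq_of_graphDeriv (hf : HasFDerivAt f (graphDeriv (Q x)) x) :
    pdu f x = 2 * (Q x).re / (1 - Complex.normSq (Q x)) := by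
  rw [pdu, hf.hasLineDerivAt (1, 0) |>.lineDeriv]
  simp [graphDeriv]

lemma pdv_eq_of_graphDeriv (hf : HasFDerivAt f (graphDeriv (Q x)) x) :
    pdv f x = -(2 * (Q x).im / (1 - Complex.normSq (Q x))) := by
  rw [pdv, hf.hasLineDerivAt (0, 1) |>.lineDeriv]
  simp [graphDeriv]

lemma lineDeriv_pdu_of_graphDeriv (hQ : ∀ x ∈ unitDisk, ‖Q x‖ < 1)
    (hQ' : ∀ x ∈ unitDisk, HasFDerivAt Q (gaussDeriv (Q x) (β x)) x)
    (hf : ∀ x ∈ unitDisk, HasFDerivAt f (graphDeriv (Q x)) x) (hx : x ∈ unitDisk) (v : ℝ × ℝ) :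
    lineDeriv ℝ (pdu f) x v =
      (2 * (gaussDeriv (Q x) (β x) v).re * (1 - Complex.normSq (Q x)) +
        2 * (Q x).re * (2 * ((Q x).re * (gaussDeriv (Q x) (β x) v).re +
          (Q x).im * (gaussDeriv (Q x) (β x) v).im))) / (1 - Complex.normSq (Q x)) ^ 2 := by
  have h : (pdu f) =ᶠ[𝓝 x] fun x => 2 * (Q x).re / (1 - Complex.normSq (Q x)) := by
    filter_upwards [isOpen_unitDisk.mem_nhds hx] with y hy
    exact pdu_eq_of_graphDeriv (hf y hy)
  have h0 := one_sub_normSq_pos (hQ x hx)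
  have h1 : HasDerivAt (fun t : ℝ => Q (x + t • v)) (gaussDeriv (Q x) (β x) v) 0 :=
    (hQ' x hx).hasLineDerivAt v
  have h2 := hasDerivAt_two_mul_re_div h1 (by simpa using h0.ne')
  simp only [zero_smul, add_zero] at h2
  rw [h.lineDeriv_eq]
  exact HasLineDerivAt.lineDeriv h2

lemma lineDeriv_pdv_of_graphDeriv (hQ : ∀ x ∈ unitDisk, ‖Q x‖ < 1)
    (hQ' : ∀ x ∈ unitDisk, HasFDerivAt Q (gaussDeriv (Q x) (β x)) x)
    (hf : ∀ x ∈ unitDisk, HasFDerivAt f (graphDeriv (Q x)) x) (hx : x ∈ unitDisk) (v : ℝ × ℝ) :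
    lineDeriv ℝ (pdv f) x v =
      -((2 * (gaussDeriv (Q x) (β x) v).im * (1 - Complex.normSq (Q x)) +
        2 * (Q x).im * (2 * ((Q x).re * (gaussDeriv (Q x) (β x) v).re +
          (Q x).im * (gaussDeriv (Q x) (β x) v).im))) / (1 - Complex.normSq (Q x)) ^ 2) := by
  have h : (pdv f) =ᶠ[𝓝 x] fun x => -(2 * (Q x).im / (1 - Complex.normSq (Q x))) := by
    filter_upwards [isOpen_unitDisk.mem_nhds hx] with y hy
    exact pdv_eq_of_graphDeriv (hf y hy)
  have h0 := one_sub_normSq_pos (hQ x hx)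
  have h1 : HasDerivAt (fun t : ℝ => Q (x + t • v)) (gaussDeriv (Q x) (β x) v) 0 :=
    (hQ' x hx).hasLineDerivAt v
  have h2 := (hasDerivAt_two_mul_im_div h1 (by simpa using h0.ne')).fun_neg
  simp only [zero_smul, add_zero] at h2
  rw [h.lineDeriv_eq]
  exact HasLineDerivAt.lineDeriv h2

lemma minimalSurfaceEq_of_graphDeriv (hQ : ∀ x ∈ unitDisk, ‖Q x‖ < 1)
    (hQ' : ∀ x ∈ unitDisk, HasFDerivAt Q (gaussDeriv (Q x) (β x)) x)
    (hf : ∀ x ∈ unitDisk, HasFDerivAt f (graphDeriv (Q x)) x) : MinimalSurfaceEq f unitDisk := by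
  intro x hx
  have h0 := one_sub_normSq_pos (hQ x hx)
  have h1 : 0 < 1 - Complex.normSq (Q x) ^ 2 := by nlinarith [Complex.normSq_nonneg (Q x)]
  have e1 : pdu (pdu f) x = _ := lineDeriv_pdu_of_graphDeriv hQ hQ' hf hx (1, 0)
  have e2 : pdv (pdu f) x = _ := lineDeriv_pdu_of_graphDeriv hQ hQ' hf hx (0, 1)
  have e3 : pdv (pdv f) x = _ := lineDeriv_pdv_of_graphDeriv hQ hQ' hf hx (0, 1)
  rw [e1, e2, e3, pdu_eq_of_graphDeriv (hf x hx), pdv_eq_of_graphDeriv (hf x hx)]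
  simp only [gaussDeriv_re, gaussDeriv_im]
  have e : Complex.normSq (Q x) = (Q x).re ^ 2 + (Q x).im ^ 2 := by
    rw [Complex.normSq_apply]; ring
  generalize Complex.normSq (Q x) = N at *
  generalize (Q x).re = a at *
  generalize (Q x).im = b at *
  generalize hM : 1 - N = M at *
  generalize hM' : 1 - N ^ 2 = M' at *
  field_simp
  subst hM e
  ring

lemma contDiffOn_of_graphDeriv (hQ : ∀ x ∈ unitDisk, ‖Q x‖ < 1)
    (hQ' : ∀ x ∈ unitDisk, HasFDerivAt Q (gaussDeriv (Q x) (β x)) x)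
    (hβ : ContinuousOn β unitDisk)
    (hf : ∀ x ∈ unitDisk, HasFDerivAt f (graphDeriv (Q x)) x) : ContDiffOn ℝ 2 f unitDisk := by
  have hQc : ContinuousOn Q unitDisk := fun x hx => (hQ' x hx).continuousAt.continuousWithinAt
  have hQ1 : ContDiffOn ℝ 1 Q unitDisk := by
    rw [show (1 : WithTop ℕ∞) = 0 + 1 by norm_num,
      contDiffOn_succ_iff_fderiv_of_isOpen isOpen_unitDisk]
    refine ⟨fun x hx => (hQ' x hx).differentiableAt.differentiableWithinAt, by simp, ?_⟩
    rw [contDiffOn_zero]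
    refine ContinuousOn.congr ?_ fun x hx => (hQ' x hx).fderiv
    refine ContinuousOn.clm_comp (ContinuousLinearMap.continuous _ |>.comp_continuousOn hβ)
      (ContinuousOn.clm_comp (fun x hx => ?_) continuousOn_const)
    exact (continuousAt_isoForm (hQ x hx)).comp_continuousWithinAt (hQc x hx)
  have hre : ContDiffOn ℝ 1 (fun x => (Q x).re) unitDisk := Complex.reCLM.contDiff.comp_contDiffOn hQ1
  have him : ContDiffOn ℝ 1 (fun x => (Q x).im) unitDisk := Complex.imCLM.contDiff.comp_contDiffOn hQ1
  have hN : ContDiffOn ℝ 1 (fun x => 1 - Complex.normSq (Q x)) unitDisk := by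
    simp only [Complex.normSq_apply]
    exact contDiffOn_const.sub ((hre.mul hre).add (him.mul him))
  have hN0 : ∀ x ∈ unitDisk, 1 - Complex.normSq (Q x) ≠ 0 :=
    fun x hx => (one_sub_normSq_pos (hQ x hx)).ne'
  rw [show (2 : WithTop ℕ∞) = 1 + 1 by norm_num,
    contDiffOn_succ_iff_fderiv_of_isOpen isOpen_unitDisk]
  refine ⟨fun x hx => (hf x hx).differentiableAt.differentiableWithinAt, by simp, ?_⟩
  refine ContDiffOn.congr ?_ fun x hx => (hf x hx).fderiv
  exact (((contDiffOn_const.mul hre).div hN hN0).smul contDiffOn_const).sub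
    (((contDiffOn_const.mul him).div hN hN0).smul contDiffOn_const)

lemma sqrt_one_add_sq_eq {τ : ℝ} (hτ : |τ| < 1) :
    √(1 + (2 * τ / (1 - τ ^ 2)) ^ 2 + 0 ^ 2) = (1 + τ ^ 2) / (1 - τ ^ 2) := by
  have h : 0 < 1 - τ ^ 2 := by nlinarith [abs_lt.1 hτ]
  rw [Real.sqrt_eq_iff_mul_self_eq_of_pos (by positivity)]
  field_simp
  ring

lemma gaussCurv_of_graphDeriv (hQ : ∀ x ∈ unitDisk, ‖Q x‖ < 1)
    (hQ' : ∀ x ∈ unitDisk, HasFDerivAt Q (gaussDeriv (Q x) (β x)) x)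
    (hf : ∀ x ∈ unitDisk, HasFDerivAt f (graphDeriv (Q x)) x) {τ b : ℝ} (hQ0 : Q (0, 0) = τ)
    (hβ0 : β (0, 0) = b) :
    IsSymmetricPt f (0, 0) (0, 1) ∧
      √(1 + (pdu f (0, 0)) ^ 2 + (pdv f (0, 0)) ^ 2) = (1 + τ ^ 2) / (1 - τ ^ 2) ∧
      |gaussCurv f (0, 0)| = (2 * b / (1 + τ ^ 2) ^ 2) ^ 2 := by
  have hx : ((0 : ℝ), (0 : ℝ)) ∈ unitDisk := by simp [unitDisk]
  have hτ : |τ| < 1 := by simpa [hQ0] using hQ _ hx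
  have h : 0 < 1 - τ ^ 2 := by nlinarith [abs_lt.1 hτ]
  have hN : Complex.normSq (τ : ℂ) = τ ^ 2 := by rw [Complex.normSq_ofReal]; ring
  have h4 : 1 - (τ ^ 2) ^ 2 = (1 - τ ^ 2) * (1 + τ ^ 2) := by ring
  have e1 : pdu (pdu f) (0, 0) = _ := lineDeriv_pdu_of_graphDeriv hQ hQ' hf hx (1, 0)
  have e2 : pdv (pdu f) (0, 0) = _ := lineDeriv_pdu_of_graphDeriv hQ hQ' hf hx (0, 1)
  have e3 : pdv (pdv f) (0, 0) = _ := lineDeriv_pdv_of_graphDeriv hQ hQ' hf hx (0, 1)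
  have e4 := lineDeriv_pdv_of_graphDeriv hQ hQ' hf hx (-1, 0)
  have e5 := pdu_eq_of_graphDeriv (hf _ hx)
  have e6 := pdv_eq_of_graphDeriv (hf _ hx)
  simp only [gaussDeriv_re, gaussDeriv_im, hQ0, hβ0, Complex.ofReal_re, Complex.ofReal_im, hN, h4,
    mul_zero, zero_mul, zero_div, neg_zero, sub_zero, add_zero, zero_add, mul_one] at e1 e2 e3 e4 e5 e6
  refine ⟨⟨by norm_num, e6, ?_⟩, by rw [e5, e6, sqrt_one_add_sq_eq hτ], ?_⟩
  · refine Eq.trans ?_ (e4.trans ?_)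
    · simp only; rfl
    · norm_num
  · have : gaussCurv f (0, 0) = -(2 * b / (1 + τ ^ 2) ^ 2) ^ 2 := by
      rw [gaussCurv, e1, e2, e3, e5, e6]
      have h5 : 1 + (2 * τ / (1 - τ ^ 2)) ^ 2 + 0 ^ 2 = ((1 + τ ^ 2) / (1 - τ ^ 2)) ^ 2 := by
        field_simp
        ring
      rw [h5]
      field_simp
      ring
    rw [this, abs_neg, abs_of_nonneg (sq_nonneg _)]

end MinimalGraph

/-- The differential `x ↦ isoInv q (p x)` of a harmonic map with dilatation `q ^ 2`. -/
noncomputable def harmonicEquiv {q p : ℂ} (hq : ‖q‖ < 1) (hp : p ≠ 0) : ℂ ≃L[ℝ] ℂ :=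
  ContinuousLinearEquiv.equivOfInverse ((isoInv q).comp (ContinuousLinearMap.mul ℝ ℂ p))
    ((ContinuousLinearMap.mul ℝ ℂ p⁻¹).comp (isoForm q))
    (fun x => by simp [isoForm_isoInv hq, hp])
    (fun x => by simp [isoInv_isoForm hq, hp])

namespace PolygonData

variable {n : ℕ} {φ ℓ : ℕ → ℝ} {v : ℕ → ℂ} {q : ℂ}

lemma differentiableOn_polyLeft (c : ℂ) :
    DifferentiableOn ℂ (polyLeft n φ ℓ c) (Metric.ball 0 1) := fun q hq =>
  (hasDerivAt_polyLeft (by simpa using hq) c).differentiableAt.differentiableWithinAt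

lemma differentiableOn_polyRight (hP : PolygonData n φ ℓ v) :
    DifferentiableOn ℂ (polyRight n φ ℓ) (Metric.ball 0 1) := fun q hq =>
  (hP.hasDerivAt_polyRight (by simpa using hq)).differentiableAt.differentiableWithinAt

lemma hasStrictFDerivAt_polyMap (hP : PolygonData n φ ℓ v) (hq : ‖q‖ < 1)
    (hp : polyDensity n φ ℓ q ≠ 0) :
    HasStrictFDerivAt (polyMap n φ v) (harmonicEquiv hq hp : ℂ →L[ℝ] ℂ) q := by
  have hmem : Metric.ball (0 : ℂ) 1 ∈ 𝓝 q := Metric.isOpen_ball.mem_nhds (by simpa using hq)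
  have hL := ((differentiableOn_polyLeft (n := n) (φ := φ) (ℓ := ℓ) (v 0)).analyticAt
    hmem).hasStrictDerivAt
  have hR := (hP.differentiableOn_polyRight.analyticAt hmem).hasStrictDerivAt
  rw [(hasDerivAt_polyLeft hq _).deriv] at hL
  rw [(hP.hasDerivAt_polyRight hq).deriv] at hR
  have h := (hL.hasStrictFDerivAt.restrictScalars ℝ).sub
    (Complex.conjCLE.toContinuousLinearMap.hasStrictFDerivAt.comp q
      (hR.hasStrictFDerivAt.restrictScalars ℝ))
  have hG : polyMap n φ v = fun q => polyLeft n φ ℓ (v 0) q - conj (polyRight n φ ℓ q) :=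
    funext hP.polyMap_eq
  rw [hG]
  refine h.congr_fderiv ?_
  ext x
  have hx : (harmonicEquiv hq hp : ℂ →L[ℝ] ℂ) x = isoInv q (polyDensity n φ ℓ q * x) := rfl
  rw [hx, isoInv_apply]
  simp
  ring

lemma continuousOn_polyDensity :
    ContinuousOn (polyDensity n φ ℓ) (Metric.ball 0 1) := by
  refine continuousOn_const.mul (continuousOn_finsetSum _ fun k _ => ?_)
  refine continuousOn_const.div (by fun_prop) fun q hq => ?_
  exact one_sub_expNeg_mul_ne_zero (by simpa using hq) _

/-- A polygon whose harmonic map is a local diffeomorphism and leaves the disk of radius `r` at the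
boundary gives a minimal graph over the disk. -/
lemma exists_minimal_graph (hP : PolygonData n φ ℓ v)
    (hp : ∀ q, ‖q‖ < 1 → polyDensity n φ ℓ q ≠ 0) {r : ℝ} (hr : 0 < r)
    (hbd : ∀ ζ : ℂ, ‖ζ‖ = 1 → ∀ᶠ q in 𝓝[Metric.ball 0 1] ζ, r < ‖polyMap n φ v q‖) {τ P : ℝ}
    (hτ : |τ| < 1) (h0 : polyMap n φ v τ = 0) (hPτ : polyDensity n φ ℓ τ = P) :
    ∃ f : ℝ × ℝ → ℝ, ContDiffOn ℝ 2 f unitDisk ∧ MinimalSurfaceEq f unitDisk ∧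
      IsSymmetricPt f (0, 0) (0, 1) ∧
      √(1 + (pdu f (0, 0)) ^ 2 + (pdv f (0, 0)) ^ 2) = (1 + τ ^ 2) / (1 - τ ^ 2) ∧
      |gaussCurv f (0, 0)| = (2 * (r / P) / (1 + τ ^ 2) ^ 2) ^ 2 := by
  have hτ' : ‖(τ : ℂ)‖ < 1 := by simpa using hτ
  have hG : ∀ q, (hq : ‖q‖ < 1) → HasStrictFDerivAt (polyMap n φ v)
      (harmonicEquiv hq (hp q hq) : ℂ →L[ℝ] ℂ) q :=
    fun q hq => hP.hasStrictFDerivAt_polyMap hq (hp q hq)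
  obtain ⟨σ, hσ0, hσc, hσ⟩ := exists_section_of_boundary (G := polyMap n φ v) (r := r)
    (fun q hq => (hG q (by simpa using hq)).hasFDerivAt.continuousAt.continuousWithinAt) hr
    (fun q hq => ⟨(hG q (by simpa using hq)).toOpenPartialHomeomorph _,
      HasStrictFDerivAt.mem_toOpenPartialHomeomorph_source _, rfl⟩) hbd hτ' h0
  have hσ' : ∀ z, (hz : z ∈ Metric.ball (0 : ℂ) r) → HasFDerivAt σ
      ((harmonicEquiv (hσ z hz).1 (hp _ (hσ z hz).1)).symm : ℂ →L[ℝ] ℂ) z := fun z hz =>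
    HasFDerivAt.of_local_left_inverse (hσc.continuousAt (Metric.isOpen_ball.mem_nhds hz))
      (hG _ (hσ z hz).1).hasFDerivAt
      (eventually_of_mem (Metric.isOpen_ball.mem_nhds hz) fun y hy => (hσ y hy).2)
  let L : ℝ × ℝ →L[ℝ] ℂ := r • (Complex.equivRealProdCLM.symm : ℝ × ℝ →L[ℝ] ℂ)
  have hL : ∀ x ∈ unitDisk, L x ∈ Metric.ball (0 : ℂ) r := by
    intro x hx
    have h1 : Complex.equivRealProdCLM.symm x ∈ Metric.ball (0 : ℂ) 1 := by
      rw [← mem_unitDisk_iff]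
      simpa using hx
    rw [mem_ball_zero_iff] at h1 ⊢
    have h2 : ‖L x‖ = r * ‖Complex.equivRealProdCLM.symm x‖ := by
      rw [show L x = r • Complex.equivRealProdCLM.symm x from rfl, norm_smul,
        Real.norm_of_nonneg hr.le]
    rw [h2]
    exact mul_lt_of_lt_one_right hr h1
  have hQ : ∀ x ∈ unitDisk, ‖σ (L x)‖ < 1 := fun x hx => (hσ _ (hL x hx)).1
  have hQ' : ∀ x ∈ unitDisk, HasFDerivAt (fun x => σ (L x))
      (gaussDeriv (σ (L x)) (r / polyDensity n φ ℓ (σ (L x)))) x := by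
    intro x hx
    refine ((hσ' _ (hL x hx)).comp x L.hasFDerivAt).congr_fderiv ?_
    refine ContinuousLinearMap.ext fun y => ?_
    change (polyDensity n φ ℓ (σ (L x)))⁻¹ *
      isoForm (σ (L x)) (r • Complex.equivRealProdCLM.symm y) =
        r / polyDensity n φ ℓ (σ (L x)) * isoForm (σ (L x)) (Complex.equivRealProdCLM.symm y)
    rw [map_smul, Complex.real_smul]
    ring
  have hf : ∀ x ∈ unitDisk, HasFDerivAt (fun x => r⁻¹ * polyHeight n φ ℓ (σ (L x)))
      (graphDeriv (σ (L x))) x := by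
    intro x hx
    have hq := hQ x hx
    refine (((hP.hasFDerivAt_polyHeight hq).comp x (hQ' x hx)).const_mul r⁻¹).congr_fderiv ?_
    refine ContinuousLinearMap.ext fun y => ?_
    generalize σ (L x) = q at *
    change r⁻¹ * (2 * (q * polyDensity n φ ℓ q *
      gaussDeriv q (r / polyDensity n φ ℓ q) y).re) = _
    have hpq := hp q hq
    have e1 : q * polyDensity n φ ℓ q * gaussDeriv q (r / polyDensity n φ ℓ q) y =
        r * (q * gaussDeriv q 1 y) := by
      rw [gaussDeriv_apply, gaussDeriv_apply]
      generalize (⟨y.1, y.2⟩ + conj q ^ 2 * conj (⟨y.1, y.2⟩ : ℂ)) = w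
      field_simp
    rw [e1, Complex.re_ofReal_mul, Complex.mul_re, gaussDeriv_re, gaussDeriv_im]
    have h1 := one_sub_normSq_pos hq
    have h2 : 1 - Complex.normSq q ^ 2 = (1 - Complex.normSq q) * (1 + Complex.normSq q) := by ring
    have h3 : 0 < 1 + Complex.normSq q := by linarith [Complex.normSq_nonneg q]
    have h4 : Complex.normSq q = q.re ^ 2 + q.im ^ 2 := by rw [Complex.normSq_apply]; ring
    simp only [graphDeriv, sub_apply, smul_apply, ContinuousLinearMap.coe_fst',
      ContinuousLinearMap.coe_snd', smul_eq_mul, h2, Complex.one_re, Complex.one_im]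
    generalize Complex.normSq q = N at *
    generalize hM : 1 - N = M at *
    generalize hM' : 1 + N = M' at *
    field_simp
    subst hM' h4
    ring
  have hβ : ContinuousOn (fun x => (r : ℂ) / polyDensity n φ ℓ (σ (L x))) unitDisk := by
    have hcQ : ContinuousOn (fun x => σ (L x)) unitDisk :=
      fun x hx => (hQ' x hx).continuousAt.continuousWithinAt
    exact continuousOn_const.div (continuousOn_polyDensity.comp hcQ
      fun x hx => by simpa using hQ x hx) fun x hx => hp _ (hQ x hx)
  have hL0 : σ (L (0, 0)) = τ := by
    rw [show L (0, 0) = 0 from map_zero L, hσ0]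
  obtain ⟨h1, h2, h3⟩ := gaussCurv_of_graphDeriv (Q := fun x => σ (L x))
    (β := fun x => (r : ℂ) / polyDensity n φ ℓ (σ (L x))) hQ hQ' hf hL0 (b := r / P)
    (by simp only [hL0, hPτ]; push_cast; rfl)
  exact ⟨_, contDiffOn_of_graphDeriv hQ hQ' hβ hf, minimalSurfaceEq_of_graphDeriv hQ hQ' hf, h1, h2, h3⟩

end PolygonData

lemma exists_expNeg_neg_eq (a : ℝ) {ζ : ℂ} (hζ : ‖ζ‖ = 1) :
    ∃ ψ ∈ Ico a (a + 2 * π), ζ = expNeg (-ψ) := by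
  obtain ⟨ψ, hψ, h⟩ : ∃ ψ ∈ Ico a (a + 2 * π), (ζ.arg : Angle) = ψ :=
    ⟨toIcoMod Real.two_pi_pos a ζ.arg, toIcoMod_mem_Ico _ _ _, by
      rw [Real.Angle.angle_eq_iff_two_pi_dvd_sub]
      refine ⟨toIcoDiv Real.two_pi_pos a ζ.arg, ?_⟩
      rw [self_sub_toIcoMod, zsmul_eq_mul, mul_comm]⟩
  refine ⟨ψ, hψ, ?_⟩
  have h1 := Complex.norm_mul_exp_arg_mul_I ζ
  rw [hζ, Complex.ofReal_one, one_mul] at h1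
  have h2 : Real.cos ζ.arg = Real.cos ψ := by
    rw [← Real.Angle.cos_coe, h, Real.Angle.cos_coe]
  have h3 : Real.sin ζ.arg = Real.sin ψ := by
    rw [← Real.Angle.sin_coe, h, Real.Angle.sin_coe]
  rw [← h1, expNeg_eq, Complex.exp_mul_I, ← Complex.ofReal_cos, ← Complex.ofReal_sin, h2, h3]
  simp

lemma exists_le_lt_succ {n : ℕ} {φ : ℕ → ℝ} {ψ : ℝ} (hψ : ψ ∈ Ico (φ 0) (φ n)) :
    ∃ k < n, φ k ≤ ψ ∧ ψ < φ (k + 1) := by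
  have h : ∃ k, ψ < φ k := ⟨n, hψ.2⟩
  classical
  have h1 := Nat.find_spec h
  have h2 : Nat.find h ≠ 0 := fun h0 => by
    rw [h0] at h1
    linarith [hψ.1]
  obtain ⟨m, hm⟩ := Nat.exists_eq_succ_of_ne_zero h2
  refine ⟨m, ?_, ?_, ?_⟩
  · have := Nat.find_min' h hψ.2
    omega
  · exact not_lt.1 (Nat.find_min h (by omega))
  · rw [hm] at h1
    exact h1

namespace PolygonData

variable {n : ℕ} {φ ℓ : ℕ → ℝ} {v : ℕ → ℂ} {q : ℂ}

lemma angle_lt (hP : PolygonData n φ ℓ v) {j k : ℕ} (hjk : j < k) (hk : k ≤ n) : φ j < φ k := by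
  induction k, hjk using Nat.le_induction with
  | base => exact hP.lt_succ j hk
  | succ m hm ih => exact (ih (by omega)).trans (hP.lt_succ m hk)

lemma angle_le (hP : PolygonData n φ ℓ v) {j k : ℕ} (hjk : j ≤ k) (hk : k ≤ n) : φ j ≤ φ k := by
  rcases hjk.eq_or_lt with rfl | h
  · exact le_rfl
  · exact (hP.angle_lt h hk).le

lemma tendsto_arc (hP : PolygonData n φ ℓ v) {ψ : ℝ} {j k : ℕ} (hk : k < n) (hj : j < n)
    (h1 : φ k ≤ ψ) (h2 : ψ < φ (k + 1)) (hjk : j ≠ k) (hsucc : j + 1 ≠ k)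
    (hlast : ¬(k = 0 ∧ j + 1 = n)) :
    Tendsto (fun q => (harmAngle (φ (j + 1)) q - harmAngle (φ j) q) / π)
      (𝓝 (expNeg (-ψ))) (𝓝 0) := by
  have hper := hP.period
  have key : ∀ χ, φ (j + 1) < χ → χ < φ j + 2 * π → Tendsto
      (fun q => (harmAngle (φ (j + 1)) q - harmAngle (φ j) q) / π) (𝓝 (expNeg (-χ))) (𝓝 0) := by
    intro χ h3 h4
    have h5 := hP.lt_succ j hj
    have := ((tendsto_harmAngle h3 (by linarith)).sub
      (tendsto_harmAngle (h5.trans h3) h4)).div_const π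
    simpa using this
  rcases lt_or_gt_of_ne hjk with h | h
  · have h3 := hP.angle_lt (show j + 1 < k by omega) hk.le
    have h4 := hP.angle_le (show k + 1 ≤ n from hk) le_rfl
    have h5 := hP.angle_le (Nat.zero_le j) hj.le
    exact key ψ (by linarith) (by linarith)
  · have h3 := hP.angle_le (show k + 1 ≤ j from h) hj.le
    have h4 : φ (j + 1) < ψ + 2 * π := by
      rcases Nat.eq_zero_or_pos k with hk0 | hk0
      · have := hP.angle_lt (show j + 1 < n by omega) le_rfl
        have := hP.angle_le (Nat.zero_le k) hk.le
        linarith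
      · have := hP.angle_le (show j + 1 ≤ n from hj) le_rfl
        have := hP.angle_lt hk0 hk.le
        linarith
    have h5 : expNeg (-ψ) = expNeg (-(ψ + 2 * π)) := by
      rw [← expNeg_add_two_pi (-(ψ + 2 * π))]
      congr 1
      ring
    rw [h5]
    exact key _ h4 (by linarith)

/-- If each side lies in a half plane at distance `ρ` from the origin, the harmonic map leaves every
smaller disk at the boundary. -/
lemma eventually_lt_norm_polyMap (hP : PolygonData n φ ℓ v) {N : ℕ → ℂ} {r ρ : ℝ} (hr : r < ρ)
    (hN : ∀ k < n, ‖N k‖ = 1) (hleft : ∀ k < n, ρ ≤ (conj (N k) * v k).re)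
    (hright : ∀ k < n, ρ ≤ (conj (N k) * v (k + 1)).re) {ζ : ℂ} (hζ : ‖ζ‖ = 1) :
    ∀ᶠ q in 𝓝[Metric.ball 0 1] ζ, r < ‖polyMap n φ v q‖ := by
  obtain ⟨ψ, hψ, rfl⟩ := exists_expNeg_neg_eq (φ 0) hζ
  rw [← hP.period] at hψ
  obtain ⟨k, hk, h1, h2⟩ := exists_le_lt_succ hψ
  have hlim : Tendsto (fun q => ∑ j ∈ Finset.range n, min ((conj (N k) * v (j + 1)).re - ρ) 0 *
      ((harmAngle (φ (j + 1)) q - harmAngle (φ j) q) / π)) (𝓝 (expNeg (-ψ))) (𝓝 0) := by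
    rw [show (𝓝 (0 : ℝ)) = 𝓝 (∑ j ∈ Finset.range n, 0) by simp]
    refine tendsto_finsetSum _ fun j hj => ?_
    rw [Finset.mem_range] at hj
    by_cases hle : ρ ≤ (conj (N k) * v (j + 1)).re
    · rw [min_eq_right (by linarith)]
      simp
    · have h := (hP.tendsto_arc hk hj h1 h2 (by rintro rfl; exact hle (hright j hj))
        (by rintro rfl; exact hle (hleft _ hk))
        (by rintro ⟨rfl, hjn⟩; rw [hjn, hP.closed] at hle; exact hle (hleft _ hk))).const_mul
          (min ((conj (N k) * v (j + 1)).re - ρ) 0)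
      rwa [mul_zero] at h
  have hev := hlim.eventually (lt_mem_nhds (show r - ρ < 0 by linarith))
  filter_upwards [nhdsWithin_le_nhds hev, self_mem_nhdsWithin] with q hq hq1
  have hq1 : ‖q‖ < 1 := by simpa using hq1
  have hre : (conj (N k) * polyMap n φ v q).re = ∑ j ∈ Finset.range n,
      (conj (N k) * v (j + 1)).re * ((harmAngle (φ (j + 1)) q - harmAngle (φ j) q) / π) := by
    rw [polyMap, Finset.mul_sum, Complex.re_sum]
    refine Finset.sum_congr rfl fun j _ => ?_
    rw [← mul_assoc, Complex.re_mul_ofReal]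
  have hsum : (conj (N k) * polyMap n φ v q).re - ρ = ∑ j ∈ Finset.range n,
      ((conj (N k) * v (j + 1)).re - ρ) *
        ((harmAngle (φ (j + 1)) q - harmAngle (φ j) q) / π) := by
    simp only [sub_mul, Finset.sum_sub_distrib]
    rw [hre, ← Finset.mul_sum, hP.sum_arc q, mul_one]
  have hmono : ∑ j ∈ Finset.range n, min ((conj (N k) * v (j + 1)).re - ρ) 0 *
      ((harmAngle (φ (j + 1)) q - harmAngle (φ j) q) / π) ≤
        (conj (N k) * polyMap n φ v q).re - ρ := by
    rw [hsum]
    refine Finset.sum_le_sum fun j hj => ?_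
    exact mul_le_mul_of_nonneg_right (min_le_left _ _) (hP.arc_pos hq1 (Finset.mem_range.1 hj)).le
  have hnorm : (conj (N k) * polyMap n φ v q).re ≤ ‖polyMap n φ v q‖ := by
    simpa [hN k hk] using Complex.re_le_norm (conj (N k) * polyMap n φ v q)
  linarith

lemma sub_const (hP : PolygonData n φ ℓ v) (c : ℂ) :
    PolygonData n φ ℓ (fun k => v k - c) where
  lt_succ := hP.lt_succ
  period := hP.period
  closed := by simp [hP.closed]
  side k hk := by simpa using hP.side k hk
  sum_eq_zero := hP.sum_eq_zero

lemma polyMap_sub_const (hP : PolygonData n φ ℓ v) (c q : ℂ) :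
    polyMap n φ (fun k => v k - c) q = polyMap n φ v q - c := by
  rw [(hP.sub_const c).polyMap_eq_sub_sum, hP.polyMap_eq_sub_sum]
  ring

end PolygonData

/-- The boundary values of `q ^ 2 * polyDensity`, up to a constant factor. -/
noncomputable def cotSum (n : ℕ) (φ ℓ : ℕ → ℝ) (ψ : ℝ) : ℝ :=
  ∑ k ∈ Finset.range n, ℓ k * (cos ((ψ - φ k) / 2) / sin ((ψ - φ k) / 2))

lemma one_sub_expNeg_mul_expNeg_neg (φ ψ : ℝ) :
    1 - expNeg φ * expNeg (-ψ) = -2 * Complex.I * sin ((ψ - φ) / 2) *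
      (cos ((ψ - φ) / 2) + sin ((ψ - φ) / 2) * Complex.I) := by
  have h1 : expNeg φ * expNeg (-ψ) = expNeg (-(ψ - φ) / 2) * expNeg (-(ψ - φ) / 2) := by
    rw [← expNeg_add, ← expNeg_add]
    congr 1
    ring
  have h2 : expNeg (-(ψ - φ) / 2) = cos ((ψ - φ) / 2) + sin ((ψ - φ) / 2) * Complex.I := by
    rw [neg_div, expNeg_eq, Real.cos_neg, Real.sin_neg]
    push_cast
    ring
  have h3 : (cos ((ψ - φ) / 2) : ℂ) ^ 2 + (sin ((ψ - φ) / 2) : ℂ) ^ 2 = 1 := by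
    exact_mod_cast Real.cos_sq_add_sin_sq _
  rw [h1, h2]
  generalize (cos ((ψ - φ) / 2) : ℂ) = c at *
  generalize (sin ((ψ - φ) / 2) : ℂ) = d at *
  linear_combination -h3 + (d ^ 2) * Complex.I_sq

lemma one_sub_expNeg_mul_expNeg_neg_ne_zero {φ ψ : ℝ} (h : sin ((ψ - φ) / 2) ≠ 0) :
    1 - expNeg φ * expNeg (-ψ) ≠ 0 := by
  rw [one_sub_expNeg_mul_expNeg_neg]
  generalize cos ((ψ - φ) / 2) = c at *
  generalize sin ((ψ - φ) / 2) = d at *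
  have h3 : (c + d * Complex.I : ℂ) ≠ 0 := fun h0 => h (by simpa using congrArg Complex.im h0)
  simp [h3, h]

lemma inv_one_sub_expNeg_mul_expNeg_neg {φ ψ : ℝ} (h : sin ((ψ - φ) / 2) ≠ 0) :
    1 / (1 - expNeg φ * expNeg (-ψ)) =
      1 / 2 + Complex.I / 2 * ((cos ((ψ - φ) / 2) / sin ((ψ - φ) / 2) : ℝ) : ℂ) := by
  rw [div_eq_iff (one_sub_expNeg_mul_expNeg_neg_ne_zero h), one_sub_expNeg_mul_expNeg_neg]
  have h3 : (cos ((ψ - φ) / 2) : ℂ) ^ 2 + (sin ((ψ - φ) / 2) : ℂ) ^ 2 = 1 := by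
    exact_mod_cast Real.cos_sq_add_sin_sq _
  have h4 : (sin ((ψ - φ) / 2) : ℂ) ≠ 0 := by exact_mod_cast h
  rw [Complex.ofReal_div]
  generalize (cos ((ψ - φ) / 2) : ℂ) = c at *
  generalize (sin ((ψ - φ) / 2) : ℂ) = d at *
  field_simp
  linear_combination -h3 + (c ^ 2 + d ^ 2 + c * d * Complex.I) * Complex.I_sq

lemma sum_div_one_sub_eq_cotSum {n : ℕ} {φ ℓ : ℕ → ℝ} {ψ : ℝ}
    (hsum : ∑ k ∈ Finset.range n, ℓ k = 0) (h : ∀ k < n, sin ((ψ - φ k) / 2) ≠ 0) :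
    ∑ k ∈ Finset.range n, (ℓ k : ℂ) / (1 - expNeg (φ k) * expNeg (-ψ)) =
      Complex.I / 2 * cotSum n φ ℓ ψ := by
  have h1 : ∀ k ∈ Finset.range n, (ℓ k : ℂ) / (1 - expNeg (φ k) * expNeg (-ψ)) =
      (ℓ k : ℂ) * (1 / 2) + Complex.I / 2 *
        ((ℓ k * (cos ((ψ - φ k) / 2) / sin ((ψ - φ k) / 2)) : ℝ) : ℂ) := by
    intro k hk
    rw [div_eq_mul_one_div, inv_one_sub_expNeg_mul_expNeg_neg (h k (Finset.mem_range.1 hk)),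
      Complex.ofReal_mul]
    ring
  rw [Finset.sum_congr rfl h1, Finset.sum_add_distrib, ← Finset.sum_mul, ← Finset.mul_sum,
    ← Complex.ofReal_sum, ← Complex.ofReal_sum, hsum, cotSum]
  simp

lemma continuousAt_cotSum {n : ℕ} {φ ℓ : ℕ → ℝ} {ψ : ℝ}
    (h : ∀ k < n, sin ((ψ - φ k) / 2) ≠ 0) : ContinuousAt (cotSum n φ ℓ) ψ := by
  refine tendsto_finsetSum _ fun k hk => ?_
  have hk := h k (Finset.mem_range.1 hk)
  exact (show ContinuousAt (fun ψ => ℓ k * (cos ((ψ - φ k) / 2) / sin ((ψ - φ k) / 2))) ψ from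
    continuousAt_const.mul (ContinuousAt.div (by fun_prop) (by fun_prop) hk))

lemma sin_mul_cos_half_sub {φ a : ℝ} (h0 : sin ((a - φ) / 2) = 0) (ψ : ℝ) :
    sin ((ψ - φ) / 2) * cos ((ψ - φ) / 2) = sin (ψ - a) / 2 := by
  have h1 : cos ((a - φ) / 2) ^ 2 = 1 := by
    have := Real.sin_sq_add_cos_sq ((a - φ) / 2)
    rw [h0] at this
    linarith
  have h2 : (ψ - φ) / 2 = (ψ - a) / 2 + (a - φ) / 2 := by ring
  have h3 : sin (ψ - a) = 2 * sin ((ψ - a) / 2) * cos ((ψ - a) / 2) := by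
    rw [← Real.sin_two_mul]
    congr 1
    ring
  rw [h2, Real.sin_add, Real.cos_add, h0, h3]
  linear_combination (sin ((ψ - a) / 2) * cos ((ψ - a) / 2)) * h1

/-- Near a pole, the cotangent sum has the sign of its residue to the right and the opposite sign
to the left. -/
lemma eventually_sin_mul_cotSum_pos {n : ℕ} {φ ℓ : ℕ → ℝ} {a : ℝ} {i : ℕ} (hi : i < n)
    (h0 : sin ((a - φ i) / 2) = 0) (h : ∀ k < n, k ≠ i → sin ((a - φ k) / 2) ≠ 0)
    (hℓ : ℓ i ≠ 0) : ∀ᶠ ψ in 𝓝[≠] a, 0 < ℓ i * (sin (ψ - a) * cotSum n φ ℓ ψ) := by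
  set R : ℝ → ℝ := fun ψ => ∑ k ∈ (Finset.range n).erase i,
    ℓ k * (cos ((ψ - φ k) / 2) / sin ((ψ - φ k) / 2)) with hR
  have hRc : ContinuousAt R a := by
    refine tendsto_finsetSum _ fun k hk => ?_
    rw [Finset.mem_erase, Finset.mem_range] at hk
    exact (show ContinuousAt (fun ψ => ℓ k * (cos ((ψ - φ k) / 2) / sin ((ψ - φ k) / 2))) a from
      continuousAt_const.mul (ContinuousAt.div (by fun_prop) (by fun_prop) (h k hk.2 hk.1)))
  have hsplit : ∀ ψ, cotSum n φ ℓ ψ =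
      ℓ i * (cos ((ψ - φ i) / 2) / sin ((ψ - φ i) / 2)) + R ψ := fun ψ =>
    (Finset.add_sum_erase _ _ (Finset.mem_range.2 hi)).symm
  have hcont : ContinuousAt (fun ψ => ℓ i * (2 * ℓ i * cos ((ψ - φ i) / 2) ^ 2 +
      sin (ψ - a) * R ψ)) a := by fun_prop
  have hval : 0 < ℓ i * (2 * ℓ i * cos ((a - φ i) / 2) ^ 2 + sin (a - a) * R a) := by
    have h1 := Real.sin_sq_add_cos_sq ((a - φ i) / 2)
    rw [h0] at h1
    have h2 : cos ((a - φ i) / 2) ^ 2 = 1 := by linarith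
    rw [h2, sub_self, Real.sin_zero]
    have := mul_self_pos.2 hℓ
    nlinarith
  have hlt : ∀ᶠ ψ in 𝓝[≠] a, sin (ψ - a) ≠ 0 := by
    have h1 : HasDerivAt (fun ψ => sin (ψ - a)) (cos (a - a) * 1) a :=
      ((hasDerivAt_id a).sub_const a).sin
    have := h1.eventually_ne (c := 0) (by simp)
    exact this
  filter_upwards [nhdsWithin_le_nhds (hcont.eventually (lt_mem_nhds hval)), hlt] with ψ h1 h2
  have h3 := sin_mul_cos_half_sub h0 ψ
  have h4 : sin ((ψ - φ i) / 2) ≠ 0 := fun h5 => by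
    rw [h5] at h3
    exact h2 (by linarith)
  have h5 : sin (ψ - a) * cotSum n φ ℓ ψ = 2 * ℓ i * cos ((ψ - φ i) / 2) ^ 2 +
      sin (ψ - a) * R ψ := by
    rw [hsplit, mul_add]
    congr 1
    rw [show sin (ψ - a) = 2 * (sin ((ψ - φ i) / 2) * cos ((ψ - φ i) / 2)) by linarith]
    field_simp
  rwa [h5]

lemma eventually_cotSum_pos_right {n : ℕ} {φ ℓ : ℕ → ℝ} {a : ℝ} {i : ℕ} (hi : i < n)
    (h0 : sin ((a - φ i) / 2) = 0) (h : ∀ k < n, k ≠ i → sin ((a - φ k) / 2) ≠ 0)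
    (hℓ : ℓ i ≠ 0) : ∀ᶠ ψ in 𝓝[>] a, 0 < ℓ i * cotSum n φ ℓ ψ := by
  filter_upwards [nhdsGT_le_nhdsNE a (eventually_sin_mul_cotSum_pos hi h0 h hℓ),
    Ioo_mem_nhdsGT (show a < a + π by linarith [Real.pi_pos])] with ψ h1 h2
  have h3 : 0 < sin (ψ - a) :=
    Real.sin_pos_of_pos_of_lt_pi (by linarith [h2.1]) (by linarith [h2.2])
  rw [mul_left_comm] at h1
  exact pos_of_mul_pos_right h1 h3.le

lemma eventually_cotSum_neg_left {n : ℕ} {φ ℓ : ℕ → ℝ} {a : ℝ} {i : ℕ} (hi : i < n)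
    (h0 : sin ((a - φ i) / 2) = 0) (h : ∀ k < n, k ≠ i → sin ((a - φ k) / 2) ≠ 0)
    (hℓ : ℓ i ≠ 0) : ∀ᶠ ψ in 𝓝[<] a, ℓ i * cotSum n φ ℓ ψ < 0 := by
  filter_upwards [nhdsLT_le_nhdsNE a (eventually_sin_mul_cotSum_pos hi h0 h hℓ),
    Ioo_mem_nhdsLT (show a - π < a by linarith [Real.pi_pos])] with ψ h1 h2
  have h3 : sin (ψ - a) < 0 :=
    Real.sin_neg_of_neg_of_neg_pi_lt (by linarith [h2.2]) (by linarith [h2.1])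
  rw [mul_left_comm] at h1
  exact neg_of_mul_pos_right h1 h3.le

lemma sin_half_ne_zero {x : ℝ} (h0 : x ≠ 0) (h1 : -(2 * π) < x) (h2 : x < 2 * π) :
    sin (x / 2) ≠ 0 := by
  rw [Ne, Real.sin_eq_zero_iff_of_lt_of_lt (by linarith) (by linarith)]
  intro h
  exact h0 (by linarith)

namespace PolygonData

variable {n : ℕ} {φ ℓ : ℕ → ℝ} {v : ℕ → ℂ} {q : ℂ}

lemma sin_half_sub_ne_zero (hP : PolygonData n φ ℓ v) {k j : ℕ} (hk : k < n) (hj : j < n) {ψ : ℝ}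
    (hψ : ψ ∈ Ioo (φ k) (φ (k + 1))) : sin ((ψ - φ j) / 2) ≠ 0 := by
  have h1 := hP.angle_le (Nat.zero_le k) hk.le
  have h2 := hP.angle_le (Nat.zero_le j) hj.le
  have h3 := hP.angle_le (show k + 1 ≤ n from hk) le_rfl
  have h4 := hP.angle_lt hj le_rfl
  have h5 := hP.period
  refine sin_half_ne_zero (fun h => ?_) (by linarith [hψ.1]) (by linarith [hψ.2])
  rcases Nat.lt_or_ge k j with h6 | h6
  · have := hP.angle_le (show k + 1 ≤ j from h6) hj.le
    linarith [hψ.2]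
  · have := hP.angle_le h6 hk.le
    linarith [hψ.1]

lemma sin_half_angle_sub_ne_zero (hP : PolygonData n φ ℓ v) {k j : ℕ} (hk : k < n) (hj : j < n)
    (hjk : j ≠ k) : sin ((φ k - φ j) / 2) ≠ 0 := by
  have h1 := hP.angle_le (Nat.zero_le k) hk.le
  have h2 := hP.angle_le (Nat.zero_le j) hj.le
  have h3 := hP.angle_lt hk le_rfl
  have h4 := hP.angle_lt hj le_rfl
  have h5 := hP.period
  refine sin_half_ne_zero (fun h => ?_) (by linarith) (by linarith)
  rcases lt_or_gt_of_ne hjk with h6 | h6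
  · have := hP.angle_lt h6 hk.le
    linarith
  · have := hP.angle_lt h6 hj.le
    linarith

lemma continuousOn_cotSum (hP : PolygonData n φ ℓ v) {k : ℕ} (hk : k < n) :
    ContinuousOn (cotSum n φ ℓ) (Ioo (φ k) (φ (k + 1))) := fun _ hψ =>
  (continuousAt_cotSum fun _ hj => hP.sin_half_sub_ne_zero hk hj hψ).continuousWithinAt

lemma eventually_right (hP : PolygonData n φ ℓ v) {k : ℕ} (hk : k < n) (hℓ : ℓ k ≠ 0) :
    ∀ᶠ ψ in 𝓝[>] (φ k), 0 < ℓ k * cotSum n φ ℓ ψ :=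
  eventually_cotSum_pos_right hk (by simp)
    (fun _ hj hjk => hP.sin_half_angle_sub_ne_zero hk hj hjk) hℓ

lemma eventually_left (hP : PolygonData n φ ℓ v) (hper : ℓ n = ℓ 0) {k : ℕ} (hk : k < n)
    (hℓ : ℓ (k + 1) ≠ 0) : ∀ᶠ ψ in 𝓝[<] (φ (k + 1)), ℓ (k + 1) * cotSum n φ ℓ ψ < 0 := by
  rcases Nat.lt_or_ge (k + 1) n with h | h
  · exact eventually_cotSum_neg_left h (by simp)
      (fun _ hj hjk => hP.sin_half_angle_sub_ne_zero h hj hjk) hℓ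
  · have hkn : k + 1 = n := by omega
    rw [hkn, hper] at hℓ ⊢
    rw [hP.period]
    refine eventually_cotSum_neg_left (by omega) (by simp) (fun j hj hj0 => ?_) hℓ
    have h1 := hP.sin_half_angle_sub_ne_zero (show 0 < n by omega) hj hj0
    rwa [show (φ 0 + 2 * π - φ j) / 2 = (φ 0 - φ j) / 2 + π by ring, Real.sin_add_pi, neg_ne_zero]

/-- If the cotangent sum changes sign on the gap after the angle `φ k` on both sides of `c`, it has
two zeros there. -/
lemma exists_two_zeros (hP : PolygonData n φ ℓ v) (hper : ℓ n = ℓ 0) {k : ℕ} (hk : k < n) {c : ℝ}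
    (hc : c ∈ Ioo (φ k) (φ (k + 1))) (h1 : ℓ k * cotSum n φ ℓ c < 0)
    (h2 : 0 < ℓ (k + 1) * cotSum n φ ℓ c) :
    ∃ Z : Finset ℝ, Z.card = 2 ∧ ∀ ψ ∈ Z, ψ ∈ Ioo (φ k) (φ (k + 1)) ∧ cotSum n φ ℓ ψ = 0 := by
  have hcont := hP.continuousOn_cotSum hk
  obtain ⟨a, ha, hac⟩ := ((hP.eventually_right hk (left_ne_zero_of_mul h1.ne)).and
    (Ioo_mem_nhdsGT hc.1)).exists
  obtain ⟨b, hb, hbc⟩ := ((hP.eventually_left hper hk (left_ne_zero_of_mul h2.ne')).and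
    (Ioo_mem_nhdsLT hc.2)).exists
  obtain ⟨z, hz, hz0⟩ := intermediate_value_Ioo' hac.2.le
    ((continuousOn_const.mul hcont).mono fun x hx => ⟨hac.1.trans_le hx.1, hx.2.trans_lt hc.2⟩)
    (show (0 : ℝ) ∈ Ioo (ℓ k * cotSum n φ ℓ c) (ℓ k * cotSum n φ ℓ a) from ⟨h1, ha⟩)
  obtain ⟨w, hw, hw0⟩ := intermediate_value_Ioo' hbc.1.le
    ((continuousOn_const.mul hcont).mono fun x hx => ⟨hc.1.trans_le hx.1, hx.2.trans_lt hbc.2⟩)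
    (show (0 : ℝ) ∈ Ioo (ℓ (k + 1) * cotSum n φ ℓ b) (ℓ (k + 1) * cotSum n φ ℓ c) from ⟨hb, h2⟩)
  refine ⟨{z, w}, Finset.card_pair (hz.2.trans hw.1).ne, fun ψ hψ => ?_⟩
  rw [Finset.mem_insert, Finset.mem_singleton] at hψ
  rcases hψ with rfl | rfl
  · exact ⟨⟨hac.1.trans hz.1, hz.2.trans hc.2⟩,
      (mul_eq_zero.1 hz0).resolve_left (left_ne_zero_of_mul h1.ne)⟩
  · exact ⟨⟨hc.1.trans hw.1, hw.2.trans hbc.2⟩,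
      (mul_eq_zero.1 hw0).resolve_left (left_ne_zero_of_mul h2.ne')⟩

lemma injOn_expNeg_neg (a : ℝ) : InjOn (fun ψ => expNeg (-ψ)) (Ioo a (a + 2 * π)) := by
  intro x hx y hy hxy
  by_contra hne
  refine one_sub_expNeg_mul_expNeg_neg_ne_zero (φ := y) (ψ := x) (sin_half_ne_zero
    (sub_ne_zero.2 hne) (by linarith [hx.1, hy.2]) (by linarith [hx.2, hy.1])) ?_
  simp only at hxy
  rw [hxy, ← expNeg_add, add_neg_cancel, expNeg_zero, sub_self]

/-- The density does not vanish when enough gaps between the angles contain two boundary zeros. -/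
lemma polyDensity_ne_zero_of_gaps (hP : PolygonData n φ ℓ v) (hn : 4 ≤ n) (hper : ℓ n = ℓ 0)
    {J : Finset ℕ} (hJ : ∀ k ∈ J, k < n) (hcard : n - 4 ≤ 2 * J.card) {c : ℕ → ℝ}
    (hc : ∀ k ∈ J, c k ∈ Ioo (φ k) (φ (k + 1))) (h1 : ∀ k ∈ J, ℓ k * cotSum n φ ℓ (c k) < 0)
    (h2 : ∀ k ∈ J, 0 < ℓ (k + 1) * cotSum n φ ℓ (c k)) {q₁ : ℂ} (hq₁ : ‖q₁‖ < 1)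
    (hp₁ : polyDensity n φ ℓ q₁ ≠ 0) (hq : ‖q‖ < 1) : polyDensity n φ ℓ q ≠ 0 := by
  have hex : ∀ k, ∃ Z : Finset ℝ, k ∈ J →
      Z.card = 2 ∧ ∀ ψ ∈ Z, ψ ∈ Ioo (φ k) (φ (k + 1)) ∧ cotSum n φ ℓ ψ = 0 := fun k => by
    by_cases hk : k ∈ J
    · obtain ⟨Z, hZ⟩ := hP.exists_two_zeros hper (hJ k hk) (hc k hk) (h1 k hk) (h2 k hk)
      exact ⟨Z, fun _ => hZ⟩
    · exact ⟨∅, fun h => absurd h hk⟩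
  choose Z hZ using hex
  have hmem : ∀ ψ ∈ J.biUnion Z, ∃ k < n, ψ ∈ Ioo (φ k) (φ (k + 1)) ∧ cotSum n φ ℓ ψ = 0 := by
    intro ψ hψ
    obtain ⟨k, hk, hkψ⟩ := Finset.mem_biUnion.1 hψ
    exact ⟨k, hJ k hk, (hZ k hk).2 ψ hkψ⟩
  have hinj : InjOn (fun ψ => expNeg (-ψ)) (J.biUnion Z : Set ℝ) := by
    refine (injOn_expNeg_neg (φ 0)).mono fun ψ hψ => ?_
    obtain ⟨k, hk, hψk, -⟩ := hmem ψ hψ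
    rw [← hP.period]
    exact ⟨(hP.angle_le (Nat.zero_le k) hk.le).trans_lt hψk.1,
      hψk.2.trans_le (hP.angle_le (show k + 1 ≤ n from hk) le_rfl)⟩
  have hdisj : (J : Set ℕ).PairwiseDisjoint Z := by
    have key : ∀ j ∈ J, ∀ k ∈ J, j < k → Disjoint (Z j) (Z k) := fun j hj k hk hjk => by
      refine Finset.disjoint_left.2 fun ψ hψj hψk => ?_
      have := hP.angle_le (show j + 1 ≤ k from hjk) (hJ k hk).le
      linarith [((hZ j hj).2 ψ hψj).1.2, ((hZ k hk).2 ψ hψk).1.1]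
    intro j hj k hk hjk
    rcases lt_or_gt_of_ne hjk with h | h
    · exact key j hj k hk h
    · exact (key k hk j hj h).symm
  refine hP.polyDensity_ne_zero hn (Z := (J.biUnion Z).image fun ψ => expNeg (-ψ)) ?_ ?_ ?_ ?_
    hq₁ hp₁ hq
  · rw [Finset.card_image_of_injOn hinj, Finset.card_biUnion hdisj,
      Finset.sum_congr rfl fun k hk => (hZ k hk).1, Finset.sum_const, smul_eq_mul]
    omega
  · intro z hz
    obtain ⟨ψ, -, rfl⟩ := Finset.mem_image.1 hz
    exact norm_expNeg _
  · intro z hz j hj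
    obtain ⟨ψ, hψ, rfl⟩ := Finset.mem_image.1 hz
    obtain ⟨k, hk, hψk, -⟩ := hmem ψ hψ
    exact one_sub_expNeg_mul_expNeg_neg_ne_zero (hP.sin_half_sub_ne_zero hk hj hψk)
  · intro z hz
    obtain ⟨ψ, hψ, rfl⟩ := Finset.mem_image.1 hz
    obtain ⟨k, hk, hψk, h0⟩ := hmem ψ hψ
    rw [sum_div_one_sub_eq_cotSum hP.sum_eq_zero fun j hj => hP.sin_half_sub_ne_zero hk hj hψk, h0]
    simp

end PolygonData

/-- The sequence `a 0, b 0, c 0, a 1, b 1, c 1, …`. -/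
def interleave {α : Type*} (a b c : ℕ → α) (k : ℕ) : α :=
  if k % 3 = 0 then a (k / 3) else if k % 3 = 1 then b (k / 3) else c (k / 3)

section Interleave

variable {α : Type*} (a b c : ℕ → α) (j : ℕ)

@[simp] lemma interleave_mul : interleave a b c (3 * j) = a j := by
  simp [interleave]

@[simp] lemma interleave_mul_add_one : interleave a b c (3 * j + 1) = b j := by
  simp [interleave, show (3 * j + 1) / 3 = j by omega]

@[simp] lemma interleave_mul_add_two : interleave a b c (3 * j + 2) = c j := by
  simp [interleave, show (3 * j + 2) / 3 = j by omega]

@[simp] lemma interleave_mul_add_three : interleave a b c (3 * j + 2 + 1) = a (j + 1) :=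
  interleave_mul a b c (j + 1)

@[simp] lemma interleave_zero : interleave a b c 0 = a 0 := rfl

lemma forall_lt_three_mul {n : ℕ} {p : ℕ → Prop}
    (h : ∀ j < n, p (3 * j) ∧ p (3 * j + 1) ∧ p (3 * j + 2)) : ∀ k < 3 * n, p k := by
  intro k hk
  have h1 := h (k / 3) (by omega)
  have h2 : k = 3 * (k / 3) ∨ k = 3 * (k / 3) + 1 ∨ k = 3 * (k / 3) + 2 := by omega
  rcases h2 with h2 | h2 | h2 <;> rw [h2]
  exacts [h1.1, h1.2.1, h1.2.2]

lemma sum_range_three_mul {M : Type*} [AddCommMonoid M] (f : ℕ → M) (n : ℕ) :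
    ∑ k ∈ Finset.range (3 * n), f k =
      ∑ j ∈ Finset.range n, (f (3 * j) + f (3 * j + 1) + f (3 * j + 2)) := by
  induction n with
  | zero => simp
  | succ n ih =>
    rw [Nat.mul_succ, Finset.sum_range_succ, Finset.sum_range_succ, Finset.sum_range_succ, ih,
      Finset.sum_range_succ, ← add_assoc, ← add_assoc]

end Interleave

/-- The angles of the polygon obtained by replacing each side with three sides whose angles differ
by `η`. -/
noncomputable def truncAngles (φ : ℕ → ℝ) (η : ℝ) : ℕ → ℝ :=
  interleave (fun j => φ j - η) φ (fun j => φ j + η)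

/-- The signed lengths of the refined polygon. -/
noncomputable def truncLengths (ℓ ε : ℕ → ℝ) (η : ℝ) : ℕ → ℝ :=
  interleave (fun j => -(ε j / sin η)) (fun j => ℓ j + 2 * (ε j / sin η) * cos η)
    (fun j => -(ε j / sin η))

/-- The vertices of the refined polygon. -/
noncomputable def truncVertices (φ ε : ℕ → ℝ) (v : ℕ → ℂ) (η : ℝ) : ℕ → ℂ :=
  interleave v (fun j => v j - Complex.I * ((ε j / sin η : ℝ) : ℂ) * expNeg (φ j - η))
    (fun j => v (j + 1) + Complex.I * ((ε j / sin η : ℝ) : ℂ) * expNeg (φ j + η))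

lemma expNeg_sub_add_expNeg_add (φ η : ℝ) :
    expNeg (φ - η) + expNeg (φ + η) = 2 * cos η * expNeg φ := by
  rw [sub_eq_add_neg, expNeg_add, expNeg_add, expNeg_eq (-η), expNeg_eq η, Real.cos_neg,
    Real.sin_neg]
  push_cast
  ring

lemma PolygonData.trunc {n : ℕ} {φ ℓ ε : ℕ → ℝ} {v : ℕ → ℂ} (hP : PolygonData n φ ℓ v)
    (hε : ∑ j ∈ Finset.range n, ε j = 0) {η : ℝ} (hη : 0 < η)
    (hgap : ∀ j < n, φ j + η < φ (j + 1) - η) :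
    PolygonData (3 * n) (truncAngles φ η) (truncLengths ℓ ε η) (truncVertices φ ε v η) where
  lt_succ := forall_lt_three_mul fun j hj => by
    have := hgap j hj
    refine ⟨?_, ?_, ?_⟩ <;> simp [truncAngles] <;> linarith
  period := by
    simp [truncAngles, hP.period]
    ring
  closed := by simp [truncVertices, hP.closed]
  side := forall_lt_three_mul fun j hj => by
    have h1 := hP.side j hj
    have h2 := expNeg_sub_add_expNeg_add (φ j) η
    refine ⟨?_, ?_, ?_⟩ <;> simp only [truncAngles, truncLengths, truncVertices, interleave_mul,
      interleave_mul_add_one, interleave_mul_add_two, interleave_mul_add_three]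
    · rw [Complex.ofReal_neg]
      ring
    · generalize ε j / sin η = m at *
      rw [Complex.ofReal_add, Complex.ofReal_mul, Complex.ofReal_mul, Complex.ofReal_ofNat]
      linear_combination h1 + Complex.I * m * h2
    · rw [Complex.ofReal_neg]
      ring
  sum_eq_zero := by
    rw [sum_range_three_mul]
    have : ∀ j, truncLengths ℓ ε η (3 * j) + truncLengths ℓ ε η (3 * j + 1) +
        truncLengths ℓ ε η (3 * j + 2) = ℓ j + ε j * (2 * (cos η - 1) / sin η) := fun j => by
      simp only [truncLengths, interleave_mul, interleave_mul_add_one, interleave_mul_add_two]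
      ring
    simp only [this]
    rw [Finset.sum_add_distrib, ← Finset.sum_mul, hP.sum_eq_zero, hε, zero_mul, add_zero]

section Limit

variable {E : Type*} [NormedAddCommGroup E] [NormedSpace ℝ E]

lemma tendsto_second_difference_div_sin {g : ℝ → E} {x : ℝ} (hg : DifferentiableAt ℝ g x) :
    Tendsto (fun η => (sin η)⁻¹ • ((2 * cos η) • g x - g (x - η) - g (x + η)))
      (𝓝[>] 0) (𝓝 0) := by
  have h1 : HasDerivAt (fun η => (2 * cos η) • g x - g (x - η) - g (x + η)) 0 0 := by
    have h2 : HasDerivAt (fun η => g (x + η)) (deriv g x) 0 := by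
      refine HasDerivAt.comp_const_add x 0 ?_
      simpa using hg.hasDerivAt
    have h3 : HasDerivAt (fun η => g (x - η)) (-deriv g x) 0 := by
      refine HasDerivAt.comp_const_sub x 0 ?_
      simpa using hg.hasDerivAt
    have h4 : HasDerivAt (fun η => (2 * cos η) • g x) ((2 * -sin 0) • g x) 0 :=
      (((Real.hasDerivAt_cos 0).const_mul 2)).smul_const (g x)
    refine ((h4.sub h3).sub h2).congr_deriv ?_
    simp
  have h5 : Tendsto (fun η => η⁻¹ • ((2 * cos η) • g x - g (x - η) - g (x + η)))
      (𝓝[>] 0) (𝓝 0) := by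
    have := (hasDerivAt_iff_tendsto_slope_zero.1 h1).mono_left (nhdsGT_le_nhdsNE 0)
    refine this.congr fun η => ?_
    simp only [zero_add, sub_zero, add_zero, Real.cos_zero, mul_one]
    congr 1
    rw [two_smul]
    abel
  have h6 : Tendsto (fun η => (η⁻¹ * sin η)⁻¹) (𝓝[>] 0) (𝓝 1⁻¹) := by
    refine Tendsto.inv₀ ?_ one_ne_zero
    have := (hasDerivAt_iff_tendsto_slope_zero.1 (Real.hasDerivAt_sin 0)).mono_left
      (nhdsGT_le_nhdsNE 0)
    simpa using this
  have h7 := h6.smul h5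
  rw [smul_zero] at h7
  refine h7.congr' ?_
  filter_upwards [self_mem_nhdsWithin] with η hη
  have hη : η ≠ 0 := (show 0 < η from hη).ne'
  rw [smul_smul]
  congr 1
  field_simp

lemma sum_trunc (g : ℝ → E) (n : ℕ) (φ ℓ ε : ℕ → ℝ) (η : ℝ) :
    ∑ k ∈ Finset.range (3 * n), truncLengths ℓ ε η k • g (truncAngles φ η k) =
      ∑ j ∈ Finset.range n, (ℓ j • g (φ j) +
        ε j • ((sin η)⁻¹ • ((2 * cos η) • g (φ j) - g (φ j - η) - g (φ j + η)))) := by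
  rw [sum_range_three_mul]
  refine Finset.sum_congr rfl fun j _ => ?_
  simp only [truncLengths, truncAngles, interleave_mul, interleave_mul_add_one,
    interleave_mul_add_two, div_eq_mul_inv]
  module

lemma tendsto_sum_trunc {g : ℝ → E} {n : ℕ} {φ : ℕ → ℝ} (ℓ ε : ℕ → ℝ)
    (hg : ∀ j < n, DifferentiableAt ℝ g (φ j)) :
    Tendsto (fun η => ∑ k ∈ Finset.range (3 * n), truncLengths ℓ ε η k • g (truncAngles φ η k))
      (𝓝[>] 0) (𝓝 (∑ j ∈ Finset.range n, ℓ j • g (φ j))) := by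
  simp only [sum_trunc]
  refine tendsto_finsetSum _ fun j hj => ?_
  have h := ((tendsto_second_difference_div_sin (hg j (Finset.mem_range.1 hj))).const_smul
    (ε j)).const_add (ℓ j • g (φ j))
  rwa [smul_zero, add_zero] at h

end Limit

lemma tendsto_polyDensity_trunc {n : ℕ} {φ : ℕ → ℝ} (ℓ ε : ℕ → ℝ) {q : ℂ} (hq : ‖q‖ < 1) :
    Tendsto (fun η => polyDensity (3 * n) (truncAngles φ η) (truncLengths ℓ ε η) q) (𝓝[>] 0)
      (𝓝 (polyDensity n φ ℓ q)) := by
  refine Tendsto.const_mul _ ?_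
  have h := tendsto_sum_trunc (n := n) (φ := φ) ℓ ε
    (g := fun x => expNeg x ^ 2 / (1 - expNeg x * q)) fun j _ => by
      have := (hasDerivAt_expNeg (φ j)).differentiableAt
      exact (this.pow 2).fun_div ((this.mul_const q).const_sub 1) (one_sub_expNeg_mul_ne_zero hq _)
  simpa only [Complex.real_smul, mul_div_assoc] using h

lemma tendsto_cotSum_trunc {n : ℕ} {φ : ℕ → ℝ} (ℓ ε : ℕ → ℝ) {ψ : ℝ}
    (h : ∀ j < n, sin ((ψ - φ j) / 2) ≠ 0) :
    Tendsto (fun η => cotSum (3 * n) (truncAngles φ η) (truncLengths ℓ ε η) ψ) (𝓝[>] 0)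
      (𝓝 (cotSum n φ ℓ ψ)) :=
  tendsto_sum_trunc ℓ ε (g := fun x => cos ((ψ - x) / 2) / sin ((ψ - x) / 2)) fun j hj =>
    DifferentiableAt.fun_div (by fun_prop) (by fun_prop) (h j hj)

lemma PolygonData.eventually_gap {n : ℕ} {φ ℓ : ℕ → ℝ} {v : ℕ → ℂ} (hP : PolygonData n φ ℓ v) :
    ∀ᶠ η in 𝓝[>] (0 : ℝ), ∀ j < n, φ j + η < φ (j + 1) - η := by
  refine (eventually_all_finite (finite_Iio n)).2 fun j hj => ?_
  have h := hP.lt_succ j hj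
  filter_upwards [Ioo_mem_nhdsGT (show (0 : ℝ) < (φ (j + 1) - φ j) / 2 by linarith)] with η hη
  linarith [hη.2]

lemma PolygonData.tendsto_polyMap_trunc {n : ℕ} {φ ℓ ε : ℕ → ℝ} {v : ℕ → ℂ}
    (hP : PolygonData n φ ℓ v) (hε : ∑ j ∈ Finset.range n, ε j = 0) {q : ℂ} (hq : ‖q‖ < 1) :
    Tendsto (fun η => polyMap (3 * n) (truncAngles φ η) (truncVertices φ ε v η) q) (𝓝[>] 0)
      (𝓝 (polyMap n φ v q)) := by
  have h := tendsto_sum_trunc (n := n) (φ := φ) ℓ ε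
    (g := fun x => expNeg x * (harmAngle x q : ℂ)) fun j _ => by
      have h1 := (hasDerivAt_expNeg (φ j)).differentiableAt
      have h2 := (hasDerivAt_harmAngle hq (φ j)).ofReal_comp.differentiableAt
      exact h1.fun_mul h2
  have h2 := (h.const_mul (Complex.I / π)).const_sub (v 0)
  rw [hP.polyMap_eq_sub_sum]
  simp only [Complex.real_smul, ← mul_assoc] at h2
  refine (h2.congr' ?_).trans (by simp only [mul_assoc]; exact le_rfl)
  filter_upwards [hP.eventually_gap, self_mem_nhdsWithin] with η h3 h4
  rw [(hP.trunc hε h4 h3).polyMap_eq_sub_sum]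
  simp [truncVertices, mul_assoc]

section Support

variable {w e : ℂ} {ℓ ε k : ℝ}

lemma re_conj_mul_I_eq (hℓ : ℓ ≠ 0) (hw : ‖w‖ = 1) (he : ‖e‖ = 1)
    (hw' : ‖w + Complex.I * ℓ * e‖ = 1) : (conj w * (Complex.I * e)).re = -(ℓ / 2) := by
  have h1 : ‖w‖ ^ 2 = 1 := by rw [hw]; norm_num
  have h2 : ‖e‖ ^ 2 = 1 := by rw [he]; norm_num
  have h3 : ‖w + Complex.I * ℓ * e‖ ^ 2 = 1 := by rw [hw']; norm_num
  rw [← Complex.normSq_eq_norm_sq, Complex.normSq_apply] at h1 h2 h3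
  simp at h3 ⊢
  refine mul_left_cancel₀ (mul_ne_zero two_ne_zero hℓ) ?_
  linear_combination h3 - h1 - ℓ ^ 2 * h2

lemma one_le_re_conj_mul_left (hk : 0 ≤ k) (hε : 0 < ε * ℓ) (hw : ‖w‖ = 1) (he : ‖e‖ = 1)
    (hw' : ‖w + Complex.I * ℓ * e‖ = 1) (hout : 0 ≤ ε * (conj w * e).re) :
    1 ≤ (conj w * (w - (k * ε : ℝ) * (Complex.I * e) + ε * e)).re := by
  have h0 := re_conj_mul_I_eq (right_ne_zero_of_mul hε.ne') hw he hw'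
  have h1 : ‖w‖ ^ 2 = 1 := by rw [hw]; norm_num
  rw [← Complex.normSq_eq_norm_sq, Complex.normSq_apply] at h1
  have h2 : (conj w * (w - (k * ε : ℝ) * (Complex.I * e) + ε * e)).re =
      (w.re * w.re + w.im * w.im) - k * ε * (conj w * (Complex.I * e)).re +
        ε * (conj w * e).re := by
    simp
    ring
  rw [h2, h0, h1]
  nlinarith [mul_nonneg hk hε.le]

lemma one_le_re_conj_mul_right (hk : 0 ≤ k) (hε : 0 < ε * ℓ) (hw : ‖w‖ = 1) (he : ‖e‖ = 1)
    (hw' : ‖w + Complex.I * ℓ * e‖ = 1) (hout : 0 ≤ ε * (conj w * e).re) :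
    1 ≤ (conj (w + Complex.I * ℓ * e) *
      (w + Complex.I * ℓ * e + (k * ε : ℝ) * (Complex.I * e) + ε * e)).re := by
  have h0 := re_conj_mul_I_eq (right_ne_zero_of_mul hε.ne') hw he hw'
  have h2 : ‖e‖ ^ 2 = 1 := by rw [he]; norm_num
  have h3 : ‖w + Complex.I * ℓ * e‖ ^ 2 = 1 := by rw [hw']; norm_num
  rw [← Complex.normSq_eq_norm_sq, Complex.normSq_apply] at h2 h3
  have h4 : (conj (w + Complex.I * ℓ * e) *
      (w + Complex.I * ℓ * e + (k * ε : ℝ) * (Complex.I * e) + ε * e)).re =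
      ((w + Complex.I * ℓ * e).re * (w + Complex.I * ℓ * e).re +
        (w + Complex.I * ℓ * e).im * (w + Complex.I * ℓ * e).im) +
      k * ε * ((conj w * (Complex.I * e)).re + ℓ * (e.re * e.re + e.im * e.im)) +
        ε * (conj w * e).re := by
    simp
    ring
  rw [h4, h0, h2, h3]
  nlinarith [mul_nonneg hk hε.le]

lemma re_conj_normal_mul (hε : ε ^ 2 = 1) (he : ‖e‖ = 1) (t : ℝ) :
    (conj (ε * e) * (w + t * (Complex.I * e) + ε * e)).re = ε * (conj w * e).re + 1 := by
  have h2 : ‖e‖ ^ 2 = 1 := by rw [he]; norm_num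
  rw [← Complex.normSq_eq_norm_sq, Complex.normSq_apply] at h2
  simp
  linear_combination (ε ^ 2) * h2 + hε

end Support

/-- Unit normals of half planes supporting the sides of the refined polygon. -/
noncomputable def truncNormals (φ ε : ℕ → ℝ) (v : ℕ → ℂ) : ℕ → ℂ :=
  interleave v (fun j => ε j * expNeg (φ j)) (fun j => v (j + 1))

namespace PolygonData

variable {n : ℕ} {φ ℓ ε : ℕ → ℝ} {v : ℕ → ℂ}

lemma truncVertices_left (φ ε : ℕ → ℝ) (v : ℕ → ℂ) {η : ℝ} (hη : sin η ≠ 0) (j : ℕ) :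
    truncVertices φ ε v η (3 * j + 1) =
      v j - (cos η / sin η * ε j : ℝ) * (Complex.I * expNeg (φ j)) + ε j * expNeg (φ j) := by
  have h : (sin η : ℂ) ≠ 0 := by exact_mod_cast hη
  simp only [truncVertices, interleave_mul_add_one]
  rw [sub_eq_add_neg (φ j), expNeg_add, expNeg_eq (-η), Real.cos_neg, Real.sin_neg,
    Complex.ofReal_mul, Complex.ofReal_div, Complex.ofReal_div, Complex.ofReal_neg]
  generalize (sin η : ℂ) = d at *
  field_simp
  linear_combination (-(ε j * d * expNeg (φ j) : ℂ)) * Complex.I_sq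

lemma truncVertices_right (φ ε : ℕ → ℝ) (v : ℕ → ℂ) {η : ℝ} (hη : sin η ≠ 0) (j : ℕ) :
    truncVertices φ ε v η (3 * j + 2) =
      v (j + 1) + (cos η / sin η * ε j : ℝ) * (Complex.I * expNeg (φ j)) + ε j * expNeg (φ j) := by
  have h : (sin η : ℂ) ≠ 0 := by exact_mod_cast hη
  simp only [truncVertices, interleave_mul_add_two]
  rw [expNeg_add, expNeg_eq η, Complex.ofReal_mul, Complex.ofReal_div, Complex.ofReal_div]
  generalize (sin η : ℂ) = d at *
  field_simp
  linear_combination (-(ε j * d * expNeg (φ j) : ℂ)) * Complex.I_sq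

lemma trunc_support (hP : PolygonData n φ ℓ v) (hv : ∀ j, ‖v j‖ = 1)
    (hε : ∀ j, ε j ^ 2 = 1) (hsign : ∀ j < n, 0 < ε j * ℓ j)
    (hout : ∀ j < n, 0 ≤ ε j * (conj (v j) * expNeg (φ j)).re) {η : ℝ} (hη : 0 < η)
    (hη' : η < π / 2) :
    ∀ k < 3 * n, ‖truncNormals φ ε v k‖ = 1 ∧
      1 ≤ (conj (truncNormals φ ε v k) * truncVertices φ ε v η k).re ∧
      1 ≤ (conj (truncNormals φ ε v k) * truncVertices φ ε v η (k + 1)).re := by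
  have hs : 0 < sin η := Real.sin_pos_of_pos_of_lt_pi hη (by linarith)
  have hc : 0 < cos η := Real.cos_pos_of_mem_Ioo ⟨by linarith, hη'⟩
  have hk : 0 ≤ cos η / sin η := by positivity
  have hself : ∀ j, 1 ≤ (conj (v j) * v j).re := fun j => by
    rw [mul_comm, Complex.mul_conj, Complex.normSq_eq_norm_sq, hv]
    simp
  refine forall_lt_three_mul fun j hj => ?_
  have hw : v (j + 1) = v j + Complex.I * ℓ j * expNeg (φ j) := by
    linear_combination hP.side j hj
  have hw' : ‖v j + Complex.I * ℓ j * expNeg (φ j)‖ = 1 := by rw [← hw]; exact hv _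
  have hside : (conj (v (j + 1)) * expNeg (φ j)).re = (conj (v j) * expNeg (φ j)).re := by
    rw [hw]
    simp
    ring
  have hout' := hout j hj
  have hleft := one_le_re_conj_mul_left hk (hsign j hj) (hv j) (norm_expNeg _) hw' hout'
  have hright := one_le_re_conj_mul_right hk (hsign j hj) (hv j) (norm_expNeg _) hw' hout'
  rw [← hw] at hright
  have hN : truncNormals φ ε v (3 * j) = v j := by simp [truncNormals]
  have hN1 : truncNormals φ ε v (3 * j + 1) = ε j * expNeg (φ j) := by simp [truncNormals]
  have hN2 : truncNormals φ ε v (3 * j + 2) = v (j + 1) := by simp [truncNormals]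
  have hV : truncVertices φ ε v η (3 * j) = v j := by simp [truncVertices]
  have hV3 : truncVertices φ ε v η (3 * j + 2 + 1) = v (j + 1) := by simp [truncVertices]
  have habs : |ε j| = 1 := by rw [← Real.sqrt_sq_eq_abs, hε, Real.sqrt_one]
  rw [hN, hN1, hN2, hV, hV3, truncVertices_left _ _ _ hs.ne', truncVertices_right _ _ _ hs.ne']
  refine ⟨⟨hv j, hself j, hleft⟩, ⟨?_, ?_, ?_⟩, ⟨hv _, hright, hself _⟩⟩
  · rw [norm_mul, norm_expNeg, Complex.norm_real, Real.norm_eq_abs, habs, one_mul]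
  · rw [sub_eq_add_neg, ← neg_mul, ← Complex.ofReal_neg,
      re_conj_normal_mul (hε j) (norm_expNeg _)]
    linarith
  · rw [re_conj_normal_mul (hε j) (norm_expNeg _), hside]
    linarith

lemma eventually_polyDensity_trunc_ne_zero (hP : PolygonData 4 φ ℓ v)
    (hε : ∑ j ∈ Finset.range 4, ε j = 0) (halt : ∀ j, ε (j + 1) = -ε j)
    (hsign : ∀ j < 4, 0 < ε j * ℓ j) {q₁ : ℂ} (hq₁ : ‖q₁‖ < 1)
    (hp₁ : polyDensity 4 φ ℓ q₁ ≠ 0) :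
    ∀ᶠ η in 𝓝[>] (0 : ℝ), ∀ q : ℂ, ‖q‖ < 1 →
      polyDensity (3 * 4) (truncAngles φ η) (truncLengths ℓ ε η) q ≠ 0 := by
  have hex : ∀ j, ∃ c, j < 4 → c ∈ Ioo (φ j) (φ (j + 1)) ∧ 0 < ε j * cotSum 4 φ ℓ c := fun j => by
    by_cases hj : j < 4
    · have h := hsign j hj
      obtain ⟨c, hc, hc'⟩ := ((hP.eventually_right hj (right_ne_zero_of_mul h.ne')).and
        (Ioo_mem_nhdsGT (hP.lt_succ j hj))).exists
      refine ⟨c, fun _ => ⟨hc', ?_⟩⟩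
      have h1 : 0 < ℓ j ^ 2 * (ε j * cotSum 4 φ ℓ c) := by
        have := mul_pos h hc
        nlinarith
      exact pos_of_mul_pos_right h1 (sq_nonneg _)
    · exact ⟨0, fun h => absurd h hj⟩
  choose c hc using hex
  have hmem : ∀ᶠ η in 𝓝[>] (0 : ℝ), ∀ j < 4, c j ∈ Ioo (φ j + η) (φ (j + 1) - η) := by
    refine (eventually_all_finite (finite_Iio 4)).2 fun j hj => ?_
    obtain ⟨h1, h2⟩ := (hc j hj).1
    filter_upwards [Ioo_mem_nhdsGT (sub_pos.2 h1), Ioo_mem_nhdsGT (sub_pos.2 h2)] with η h3 h4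
    exact ⟨by linarith [h3.2], by linarith [h4.2]⟩
  have hpos : ∀ᶠ η in 𝓝[>] (0 : ℝ), ∀ j < 4,
      0 < ε j * cotSum (3 * 4) (truncAngles φ η) (truncLengths ℓ ε η) (c j) := by
    refine (eventually_all_finite (finite_Iio 4)).2 fun j hj => ?_
    have h1 := (tendsto_cotSum_trunc ℓ ε (ψ := c j) fun i hi =>
      hP.sin_half_sub_ne_zero hj hi (hc j hj).1).const_mul (ε j)
    exact h1.eventually (lt_mem_nhds (hc j hj).2)
  filter_upwards [hP.eventually_gap, hmem, hpos,
    (tendsto_polyDensity_trunc ℓ ε hq₁).eventually_ne hp₁,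
    Ioo_mem_nhdsGT Real.pi_pos] with η h1 h2 h3 h4 h5 q hq
  have hs : 0 < sin η := Real.sin_pos_of_pos_of_lt_pi h5.1 h5.2
  have hJ : ∀ k ∈ (Finset.range 4).image (fun j => 3 * j + 2), ∃ j < 4, k = 3 * j + 2 := by
    intro k hk
    obtain ⟨j, hj, rfl⟩ := Finset.mem_image.1 hk
    exact ⟨j, Finset.mem_range.1 hj, rfl⟩
  have hdiv : ∀ j, (3 * j + 2) / 3 = j := fun j => by omega
  refine (hP.trunc hε h5.1 h1).polyDensity_ne_zero_of_gaps (by norm_num) ?_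
    (J := (Finset.range 4).image fun j => 3 * j + 2) (c := fun k => c (k / 3)) ?_ ?_ ?_ ?_ ?_
    hq₁ h4 hq
  · simp only [truncLengths, interleave_mul, interleave_zero]
    rw [halt, halt, halt, halt]
    simp
  · intro k hk
    obtain ⟨j, hj, rfl⟩ := hJ k hk
    omega
  · rw [Finset.card_image_of_injective _ fun i j (hij : 3 * i + 2 = 3 * j + 2) => by omega]
    simp
  · intro k hk
    obtain ⟨j, hj, rfl⟩ := hJ k hk
    simpa [truncAngles, hdiv] using h2 j hj
  · intro k hk
    obtain ⟨j, hj, rfl⟩ := hJ k hk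
    have := div_pos (h3 j hj) hs
    simp only [truncLengths, interleave_mul_add_two, hdiv]
    rw [mul_div_right_comm] at this
    simp only [truncLengths] at this
    linarith
  · intro k hk
    obtain ⟨j, hj, rfl⟩ := hJ k hk
    have := div_pos (h3 j hj) hs
    simp only [truncLengths, interleave_mul_add_three, hdiv, halt]
    rw [mul_div_right_comm] at this
    simp only [truncLengths] at this
    rwa [neg_div, neg_neg]

end PolygonData

/-- The signs of the boundary values on the sides of the inscribed trapezoid. -/
noncomputable def scherkSigns (j : ℕ) : ℝ := -(-1) ^ j

lemma scherkSigns_succ (j : ℕ) : scherkSigns (j + 1) = -scherkSigns j := by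
  simp [scherkSigns, pow_succ]

lemma scherkSigns_sq (j : ℕ) : scherkSigns j ^ 2 = 1 := by
  simp [scherkSigns, ← pow_mul, mul_comm j 2]

lemma sum_scherkSigns : ∑ j ∈ Finset.range 4, scherkSigns j = 0 := by
  norm_num [Finset.sum_range_succ, scherkSigns]

section Scherk

variable {s : ℝ}

lemma scherkSigns_mul_lengths_pos (h0 : 0 ≤ s) (h1 : s < 1 - s ^ 2) {j : ℕ} (hj : j < 4) :
    0 < scherkSigns j * scherkLengths s j := by
  have hm := scherkScale_pos h0 h1
  have h2 : 0 < 2 * scherkScale s * (1 - s) := mul_pos (by linarith) (by nlinarith)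
  have h3 : 0 < 2 * scherkScale s * (1 + s) := by positivity
  interval_cases j <;> simp only [scherkSigns, scherkLengths] <;> norm_num <;> linarith

lemma scherkSigns_mul_re_nonneg (h0 : 0 ≤ s) (h1 : s < 1 - s ^ 2) {j : ℕ} (hj : j < 4) :
    0 ≤ scherkSigns j * (conj (scherkVertices s j) * expNeg (scherkAngles s j)).re := by
  have hm := scherkScale_pos h0 h1
  have h3 : 0 < √(1 - s ^ 2) := Real.sqrt_pos.2 (by linarith)
  have h4 := scherkVertices_right_re_pos h0 h1
  have h5 : 0 ≤ scherkScale s * (√(1 - s ^ 2) + s / √(1 - s ^ 2)) := by positivity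
  have h6 : 0 ≤ scherkScale s * (√(1 - s ^ 2) + s * (s / √(1 - s ^ 2))) := by positivity
  interval_cases j <;> simp only [scherkSigns, scherkAngles, scherkVertices,
      expNeg_arccos h0 h1, expNeg_neg_arccos h0 h1, expNeg_zero, expNeg_pi] <;>
    generalize √(1 - s ^ 2) = c at * <;> simp <;> linarith

/-- The densities of the refined trapezoids are real on the real axis. -/
lemma polyDensity_trunc_scherk_real (s η τ : ℝ) :
    ((polyDensity (3 * 4) (truncAngles (scherkAngles s) η)
      (truncLengths (scherkLengths s) scherkSigns η) τ).re : ℂ) =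
    polyDensity (3 * 4) (truncAngles (scherkAngles s) η)
      (truncLengths (scherkLengths s) scherkSigns η) τ := by
  rw [← Complex.conj_eq_iff_re]
  obtain ⟨g, hg⟩ : ∃ g : ℝ → ℂ, g = fun x => expNeg x ^ 2 / (1 - expNeg x * τ) := ⟨_, rfl⟩
  have hconj : ∀ x, conj (g x) = g (-x) := fun x => by
    simp [hg, conj_expNeg]
  have hper : ∀ x, g (-π + x) = g (π + x) := fun x => by
    have h := expNeg_add_two_pi (-π + x)
    rw [show -π + x + 2 * π = π + x by ring] at h
    simp only [hg, h]
  have hdens : polyDensity (3 * 4) (truncAngles (scherkAngles s) η)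
      (truncLengths (scherkLengths s) scherkSigns η) τ = 1 / (2 * π) *
        ∑ k ∈ Finset.range (3 * 4), truncLengths (scherkLengths s) scherkSigns η k •
          g (truncAngles (scherkAngles s) η k) := by
    simp only [polyDensity, hg, Complex.real_smul, mul_div_assoc]
  have hπ : g (-π) = g π := by simpa using hper 0
  have hsub : g (-(π - η)) = g (π + η) := by rw [← hper η]; congr 1; ring
  have hadd : g (-(π + η)) = g (π - η) := by
    rw [sub_eq_add_neg, ← hper (-η)]
    congr 1
    ring
  have hsub' : g (-(arccos s - η)) = g (-arccos s + η) := by congr 1; ring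
  have hadd' : g (-(arccos s + η)) = g (-arccos s - η) := by congr 1; ring
  have hsub'' : g (-(-arccos s - η)) = g (arccos s + η) := by congr 1; ring
  have hadd'' : g (-(-arccos s + η)) = g (arccos s - η) := by congr 1; ring
  rw [hdens, sum_trunc, map_mul]
  simp only [Finset.sum_range_succ, Finset.sum_range_zero, zero_add, scherkAngles, scherkLengths,
    Complex.real_smul, map_add, map_sub, map_mul, map_div₀, map_one, map_ofNat,
    Complex.conj_ofReal, hconj, hπ, hsub, hadd, hsub', hadd', hsub'', hadd'', neg_neg, neg_zero,
    zero_sub]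
  have h20 : scherkSigns 2 = scherkSigns 0 := by simp [scherkSigns]
  rw [h20]
  ring

/-- Every curvature below the extremal one is attained. -/
lemma exists_minimal_graph_of_lt_scherkCurv (h0 : 0 ≤ s) (h1 : s < 1 - s ^ 2) {τ κ : ℝ}
    (hτ0 : 0 ≤ τ) (hτ : τ < 1) (hs : 2 * τ / (1 + τ ^ 2) = scherkSlope s) (hκ : 0 < κ)
    (hκ' : κ < scherkCurv s) :
    ∃ f : ℝ × ℝ → ℝ, ContDiffOn ℝ 2 f unitDisk ∧ MinimalSurfaceEq f unitDisk ∧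
      IsSymmetricPt f (0, 0) (0, 1) ∧
      √(1 + (pdu f (0, 0)) ^ 2 + (pdv f (0, 0)) ^ 2) = (1 + τ ^ 2) / (1 - τ ^ 2) ∧
      |gaussCurv f (0, 0)| = κ := by
  have hP := scherk_polygonData h0 h1
  have hτ' : |τ| < 1 := by rwa [abs_of_nonneg hτ0]
  have hτn : ‖(τ : ℂ)‖ < 1 := by rwa [Complex.norm_real, Real.norm_eq_abs]
  have hD := scherkDensity_pos h0 h1 hτ0 hτ
  have hdens := polyDensity_scherk h0 h1 hτ0 hτ
  have hne : polyDensity 4 (scherkAngles s) (scherkLengths s) τ ≠ 0 := by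
    rw [hdens]
    exact_mod_cast hD.ne'
  have hlimP := (Complex.continuous_re.tendsto _).comp (tendsto_polyDensity_trunc (n := 4)
    (φ := scherkAngles s) (scherkLengths s) scherkSigns hτn)
  rw [hdens, Complex.ofReal_re] at hlimP
  have hlimc := (hP.tendsto_polyMap_trunc sum_scherkSigns hτn).norm
  rw [polyMap_scherk h0 h1 hτ0 hτ hs, norm_zero] at hlimc
  have hlim := ((hlimP.const_mul (√κ)).mul_const ((1 + τ ^ 2) ^ 2 / 2)).add hlimc
  have hlt : √κ * scherkDensity s τ * ((1 + τ ^ 2) ^ 2 / 2) + 0 < 1 := by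
    rw [← scherkCurv_eq h0 h1 hτ0 hτ hs, ← Real.sqrt_lt' (by positivity),
      lt_div_iff₀ (by positivity)] at hκ'
    linarith
  obtain ⟨η, hgap, hp, hPpos, hsmall, hη⟩ := (hP.eventually_gap.and
    ((hP.eventually_polyDensity_trunc_ne_zero sum_scherkSigns scherkSigns_succ
      (fun j hj => scherkSigns_mul_lengths_pos h0 h1 hj) hτn hne).and
    ((hlimP.eventually (lt_mem_nhds hD)).and ((hlim.eventually (gt_mem_nhds hlt)).and
      (Ioo_mem_nhdsGT Real.pi_div_two_pos))))).exists
  have hQ := hP.trunc sum_scherkSigns hη.1 hgap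
  simp only [Function.comp_apply] at hPpos hsmall
  set c := polyMap (3 * 4) (truncAngles (scherkAngles s) η)
    (truncVertices (scherkAngles s) scherkSigns (scherkVertices s) η) τ with hc
  set P := (polyDensity (3 * 4) (truncAngles (scherkAngles s) η)
      (truncLengths (scherkLengths s) scherkSigns η) τ).re with hPdef
  have hsupp := hP.trunc_support (norm_scherkVertices h0 h1) scherkSigns_sq
    (fun j hj => scherkSigns_mul_lengths_pos h0 h1 hj)
    (fun j hj => scherkSigns_mul_re_nonneg h0 h1 hj) hη.1 hη.2
  have hshift : ∀ N w : ℂ, ‖N‖ = 1 → 1 ≤ (conj N * w).re → 1 - ‖c‖ ≤ (conj N * (w - c)).re := by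
    intro N w hN hw
    have h := Complex.re_le_norm (conj N * c)
    rw [norm_mul, Complex.norm_conj, hN, one_mul] at h
    rw [mul_sub, Complex.sub_re]
    linarith
  have hr : 0 < √κ * P * ((1 + τ ^ 2) ^ 2 / 2) := by
    have := Real.sqrt_pos.2 hκ
    positivity
  obtain ⟨f, hf1, hf2, hf3, hf4, hf5⟩ := (hQ.sub_const c).exists_minimal_graph hp hr
    (fun ζ hζ => (hQ.sub_const c).eventually_lt_norm_polyMap
      (show _ < 1 - ‖c‖ by linarith) (fun k hk => (hsupp k hk).1)
      (fun k hk => hshift _ _ (hsupp k hk).1 (hsupp k hk).2.1)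
      (fun k hk => hshift _ _ (hsupp k hk).1 (hsupp k hk).2.2) hζ) hτ'
    (by rw [hQ.polyMap_sub_const, ← hc, sub_self])
    (polyDensity_trunc_scherk_real s η τ).symm
  refine ⟨f, hf1, hf2, hf3, hf4, hf5.trans ?_⟩
  rw [← hPdef, ← Real.sq_sqrt hκ.le]
  congr 1
  rw [Real.sqrt_sq (Real.sqrt_nonneg κ)]
  have : (1 + τ ^ 2) ≠ 0 := by positivity
  field_simp

end Scherk

/-- Inclined planes are minimal graphs of zero curvature. -/
lemma exists_flat_minimal_graph (a : ℝ) :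
    ∃ f : ℝ × ℝ → ℝ, ContDiffOn ℝ 2 f unitDisk ∧ MinimalSurfaceEq f unitDisk ∧
      IsSymmetricPt f (0, 0) (0, 1) ∧
      √(1 + (pdu f (0, 0)) ^ 2 + (pdv f (0, 0)) ^ 2) = √(1 + a ^ 2) ∧ gaussCurv f (0, 0) = 0 := by
  have hline : ∀ p w : ℝ × ℝ, lineDeriv ℝ (fun p : ℝ × ℝ => a * p.1) p w = a * w.1 := fun p w =>
    (((ContinuousLinearMap.fst ℝ ℝ ℝ).hasFDerivAt (x := p)).const_mul a).hasLineDerivAt w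
      |>.lineDeriv
  have hconst : ∀ (b : ℝ) (p w : ℝ × ℝ), lineDeriv ℝ (fun _ : ℝ × ℝ => b) p w = 0 := fun b p w =>
    ((hasFDerivAt_const b p).hasLineDerivAt w).lineDeriv
  have hu : pdu (fun p : ℝ × ℝ => a * p.1) = fun _ => a := funext fun p => by
    rw [pdu, hline, mul_one]
  have hv : pdv (fun p : ℝ × ℝ => a * p.1) = fun _ => 0 := funext fun p => by
    rw [pdv, hline, mul_zero]
  refine ⟨fun p => a * p.1, (contDiff_const.mul contDiff_fst).contDiffOn, fun p _ => ?_, ?_, ?_, ?_⟩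
  · rw [hu, hv]
    simp only [pdu, pdv, hconst]
    ring
  · exact ⟨by norm_num, by simp [hline], by simp [hline, hconst]⟩
  · simp [hu, hv]
  · simp only [gaussCurv, hu, hv]
    simp [pdu, pdv, hconst]

/-- **Kalaj, Theorem 4.**  There is a continuous strictly decreasing function
`Ψ : [0, π/2] → ℝ` with `Ψ(0) = π²/2` and `Ψ(π/2) = 0` such that:
(i) for any `C²` solution `f` of the minimal surface equation on the unit disk whose
point above the origin is `h`-symmetric, if `θ ∈ [0, π/2)` is the angle of the tangent
plane at the point above the origin with the horizontal plane, i.e.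
`cos θ = 1/√(1 + f_u(0,0)² + f_v(0,0)²)`, then `|K(0,0)| < Ψ(θ)`; and
(ii) for every `θ ∈ [0, π/2)` and every `φ ∈ [0, Ψ(θ))` there is such an `f` with
tangent angle `θ` at the symmetric point above the origin and `|K(0,0)| = φ`. -/
theorem exists_Psi_curvature_bound :
    ∃ Ψ : ℝ → ℝ,
      ContinuousOn Ψ (Set.Icc 0 (Real.pi / 2)) ∧
      StrictAntiOn Ψ (Set.Icc 0 (Real.pi / 2)) ∧
      Ψ 0 = Real.pi ^ 2 / 2 ∧
      Ψ (Real.pi / 2) = 0 ∧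
      (∀ f : ℝ × ℝ → ℝ, ContDiffOn ℝ 2 f unitDisk → MinimalSurfaceEq f unitDisk →
        (∃ h : ℝ × ℝ, IsSymmetricPt f (0, 0) h) →
        ∀ θ ∈ Set.Ico (0 : ℝ) (Real.pi / 2),
          Real.cos θ = 1 / Real.sqrt (1 + (pdu f (0, 0)) ^ 2 + (pdv f (0, 0)) ^ 2) →
          |gaussCurv f (0, 0)| < Ψ θ) ∧
      (∀ θ ∈ Set.Ico (0 : ℝ) (Real.pi / 2), ∀ φ : ℝ, 0 ≤ φ → φ < Ψ θ →
        ∃ f : ℝ × ℝ → ℝ, ContDiffOn ℝ 2 f unitDisk ∧ MinimalSurfaceEq f unitDisk ∧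
          (∃ h : ℝ × ℝ, IsSymmetricPt f (0, 0) h) ∧
          Real.cos θ = 1 / Real.sqrt (1 + (pdu f (0, 0)) ^ 2 + (pdv f (0, 0)) ^ 2) ∧
          |gaussCurv f (0, 0)| = φ) := by
  obtain ⟨Ψ, hcont, hanti, hzero, hpi, hΨ⟩ := exists_scherk_Psi
  refine ⟨Ψ, hcont, hanti, hzero, hpi, ?_, ?_⟩
  · rintro f hf hM ⟨h, hsym⟩ θ hθ hcos
    obtain ⟨s, h0, h1, hs, hval⟩ := hΨ θ hθ
    rw [hval]
    exact abs_gaussCurv_lt_scherkCurv hf hM hsym hθ hcos h0 h1 hs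
  · intro θ hθ κ hκ hlt
    rcases hκ.eq_or_lt with rfl | hκ
    · obtain ⟨f, hf1, hf2, hf3, hf4, hf5⟩ := exists_flat_minimal_graph (Real.tan θ)
      refine ⟨f, hf1, hf2, ⟨_, hf3⟩, ?_, by rw [hf5, abs_zero]⟩
      have hcos : 0 < Real.cos θ :=
        Real.cos_pos_of_mem_Ioo ⟨by linarith [hθ.1, Real.pi_pos], hθ.2⟩
      rw [hf4, one_div, Real.inv_sqrt_one_add_tan_sq hcos]
    · obtain ⟨s, h0, h1, hs, hval⟩ := hΨ θ hθ
      obtain ⟨τ, hτ0, hτ, hsin, hcos⟩ := exists_half_tangent hθ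
      obtain ⟨f, hf1, hf2, hf3, hf4, hf5⟩ := exists_minimal_graph_of_lt_scherkCurv h0 h1 hτ0 hτ
        (hsin.trans hs) hκ (hval ▸ hlt)
      exact ⟨f, hf1, hf2, ⟨_, hf3⟩, by rw [hf4, one_div_div, hcos], hf5⟩
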